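/- Let H ⊆ (Fin k)^ℤ be a nonempty one-dimensional SFT. Then a real number h satisfies h = h(X_{H,F}) for some finite set F of finite forbidden patterns with X_{H,F} nonempty if and only if h is Π₁-computable and 0 ≤ h ≤ h(H). -/

import Mathlib

open Filter

/-- Shift on one-dimensional configurations: `(shift1 p x) k = x (k - p)`. -/
def shift1 {A : Type*} (p : ℤ) (x : ℤ → A) : ℤ → A := fun k => x (k - p)

/-- Shift on two-dimensional configurations: `(shift2 v x) k = x (k - v)`. -/
def shift2 {A : Type*} (v : ℤ × ℤ) (x : ℤ × ℤ → A) : ℤ × ℤ → A := fun k => x (k - v)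

/-- The finite word `w` occurs in the bi-infinite sequence `x`. -/
def occursIn1 {A : Type*} (w : List A) (x : ℤ → A) : Prop :=
  ∃ i : ℤ, ∀ (n : ℕ) (h : n < w.length), x (i + n) = w.get ⟨n, h⟩

/-- The one-dimensional SFT avoiding the finite set `F` of forbidden words. -/
def SFT1 {A : Type*} (F : Finset (List A)) : Set (ℤ → A) :=
  {x | ∀ w ∈ F, ¬ occursIn1 w x}

/-- `H` is a one-dimensional subshift of finite type. -/
def IsSFT1 {A : Type*} (H : Set (ℤ → A)) : Prop :=
  ∃ F : Finset (List A), H = SFT1 F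

/-- A finite two-dimensional pattern: a finite support together with values. -/
structure Pattern2 (A : Type*) where
  support : Finset (ℤ × ℤ)
  val : ℤ × ℤ → A

/-- The pattern `p` occurs in the configuration `x`. -/
def Pattern2.OccursIn {A : Type*} (p : Pattern2 A) (x : ℤ × ℤ → A) : Prop :=
  ∃ v : ℤ × ℤ, ∀ u ∈ p.support, x (u + v) = p.val u

/-- The two-dimensional SFT avoiding the finite set `F` of forbidden patterns. -/
def SFT2 {A : Type*} (F : Finset (Pattern2 A)) : Set (ℤ × ℤ → A) :=
  {x | ∀ p ∈ F, ¬ p.OccursIn x}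

/-- The SFT `X_F` with added horizontal constraints from `H`: every row lies in `H`
and no pattern of `F` occurs. -/
def XHF {A : Type*} (H : Set (ℤ → A)) (F : Finset (Pattern2 A)) : Set (ℤ × ℤ → A) :=
  {x | (∀ j : ℤ, (fun k => x (k, j)) ∈ H) ∧ ∀ p ∈ F, ¬ p.OccursIn x}

/-- The combined subshift: rows in `H`, columns in `V`. -/
def XHV {A : Type*} (H V : Set (ℤ → A)) : Set (ℤ × ℤ → A) :=
  {x | (∀ j : ℤ, (fun k => x (k, j)) ∈ H) ∧ ∀ i : ℤ, (fun l => x (i, l)) ∈ V}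

/-- Number of restrictions of elements of `X` to `[0,m) × [0,n)`. -/
noncomputable def patCount2 {A : Type*} (X : Set (ℤ × ℤ → A)) (m n : ℕ) : ℕ :=
  Set.ncard {p : Fin m → Fin n → A |
    ∃ x ∈ X, ∀ (i : Fin m) (j : Fin n), x ((i : ℤ), (j : ℤ)) = p i j}

/-- Topological entropy of a two-dimensional subshift. -/
noncomputable def entropy2 {A : Type*} (X : Set (ℤ × ℤ → A)) : ℝ :=
  ⨅ n : ℕ, Real.logb 2 (patCount2 X (n + 1) (n + 1)) / ((n : ℝ) + 1) ^ 2

/-- The word `w` belongs to the language of `H`. -/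
def wordIn {A : Type*} (H : Set (ℤ → A)) (w : List A) : Prop :=
  ∃ x ∈ H, occursIn1 w x

/-- Number of length-`n` words in the language of `H`. -/
noncomputable def wordCount {A : Type*} (H : Set (ℤ → A)) (n : ℕ) : ℕ :=
  Set.ncard {w : List A | w.length = n ∧ wordIn H w}

/-- Topological entropy of a one-dimensional subshift. -/
noncomputable def entropy1 {A : Type*} (H : Set (ℤ → A)) : ℝ :=
  ⨅ n : ℕ, Real.logb 2 (wordCount H (n + 1)) / ((n : ℝ) + 1)

/-- `X` is a two-dimensional subshift (closed and shift-invariant). -/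
def IsSubshift2 {A : Type*} [TopologicalSpace A] (X : Set (ℤ × ℤ → A)) : Prop :=
  IsClosed X ∧ ∀ (v : ℤ × ℤ) (x : ℤ × ℤ → A), x ∈ X → shift2 v x ∈ X

/-- `X` is an `(m,n)`-th root of `Y`. -/
def IsRoot {A B : Type*} [TopologicalSpace A] [TopologicalSpace B]
    (X : Set (ℤ × ℤ → A)) (Y : Set (ℤ × ℤ → B)) (m n : ℕ) : Prop :=
  ∃ Z : Set (ℤ × ℤ → A), Z ⊆ X ∧ IsClopen {x : X | (x : ℤ × ℤ → A) ∈ Z} ∧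
    shift2 ((m : ℤ), 0) '' Z = Z ∧ shift2 (0, (n : ℤ)) '' Z = Z ∧
    (∃ φ : Z ≃ₜ Y,
      ∀ (x : Z) (k₁ k₂ : ℤ)
        (hx : shift2 (k₁ * (m : ℤ), k₂ * (n : ℤ)) (x : ℤ × ℤ → A) ∈ Z),
        (φ ⟨shift2 (k₁ * (m : ℤ), k₂ * (n : ℤ)) (x : ℤ × ℤ → A), hx⟩ : ℤ × ℤ → B) =
          shift2 (k₁, k₂) (φ x : ℤ × ℤ → B)) ∧
    (∀ i j : ℕ, i < m → j < n → shift2 ((i : ℤ), (j : ℤ)) '' Z ⊆ X) ∧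
    ∀ x ∈ X, ∃! q : Fin m × Fin n, x ∈ shift2 ((q.1 : ℤ), (q.2 : ℤ)) '' Z

/-- The vertex shift (nearest-neighbor SFT) of a directed graph on `A`. -/
def vertexShift {A : Type*} (E : A → A → Prop) : Set (ℤ → A) :=
  {x | ∀ i : ℤ, E (x i) (x (i + 1))}

/-- Strongly connected component: a maximal nonempty set whose vertices are pairwise
joined by nonempty directed paths. -/
def IsSCC {A : Type*} (E : A → A → Prop) (S : Set A) : Prop :=
  S.Nonempty ∧ (∀ a ∈ S, ∀ b ∈ S, Relation.TransGen E a b) ∧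
    ∀ T : Set A, S ⊆ T → (∀ a ∈ T, ∀ b ∈ T, Relation.TransGen E a b) → T = S

def ReflexiveType {A : Type*} (E : A → A → Prop) (S : Set A) : Prop :=
  ∀ v ∈ S, E v v

def SymmetricType {A : Type*} (E : A → A → Prop) (S : Set A) : Prop :=
  ∀ v ∈ S, ∀ w ∈ S, v ≠ w → E v w → E w v

def StateSplitType {A : Type*} (E : A → A → Prop) (S : Set A) : Prop :=
  ∃ p : ℕ, 0 < p ∧ ∃ f : A → ZMod p,
    (∀ i : ZMod p, ∃ v ∈ S, f v = i) ∧
    ∀ v ∈ S, ∀ w ∈ S, (E v w ↔ f w = f v + 1)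

/-- Condition D: all SCCs share one of the three types. -/
def ConditionD {A : Type*} (E : A → A → Prop) : Prop :=
  (∀ S : Set A, IsSCC E S → ReflexiveType E S) ∨
  (∀ S : Set A, IsSCC E S → SymmetricType E S) ∨
  (∀ S : Set A, IsSCC E S → StateSplitType E S)

/-- A real is Π₁-computable (right-recursively enumerable). -/
def Pi1Computable (x : ℝ) : Prop :=
  ∃ f : ℕ → ℚ, Computable f ∧ Antitone f ∧
    Tendsto (fun n => (f n : ℝ)) atTop (nhds x)

/-- A computable real number. -/
def IsComputableReal (x : ℝ) : Prop :=
  ∃ f : ℕ → ℚ, Computable f ∧ ∀ n : ℕ, |(f n : ℝ) - x| ≤ (2 : ℝ) ^ (-(n : ℤ))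

/-- `w` is a finite concatenation of copies of `w₁` and `w₂`. -/
def IsConcat {A : Type*} (w₁ w₂ w : List A) : Prop :=
  ∃ L : List (List A), (∀ v ∈ L, v = w₁ ∨ v = w₂) ∧ w = L.flatten

/-- Transitivity of a one-dimensional subshift. -/
def Transitive1 {A : Type*} (H : Set (ℤ → A)) : Prop :=
  ∀ u w : List A, wordIn H u → wordIn H w → ∃ v : List A, wordIn H (u ++ v ++ w)

/-- The subshift of elements of `H` avoiding the word `u`. -/
def avoidWord {A : Type*} (H : Set (ℤ → A)) (u : List A) : Set (ℤ → A) :=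
  {x ∈ H | ¬ occursIn1 u x}

namespace HEnt

/-- The local rules of the hierarchical skeleton: `A` compares the level of a column with the
level of a row, `d` and `e` are the base-`5` digits of columns and rows, `R` and `U` are the
digit counters transported along rows and columns. -/
structure SkelValid (A : ℤ → ℤ → Ordering) (d e : ℤ → ZMod 5) (R U : ℤ → ℤ → ZMod 5) : Prop where
  d_ne : ∀ x, d x ≠ 0
  e_ne : ∀ y, e y ≠ 0
  lt_R : ∀ x y, A x y = .lt → R x y = R (x - 1) y
  lt_U : ∀ x y, A x y = .lt → U x y = 0
  lt_U' : ∀ x y, A x y = .lt → U x (y - 1) = 4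
  eq_R : ∀ x y, A x y = .eq → R x y = d x
  eq_R' : ∀ x y, A x y = .eq → d x = R (x - 1) y + 1
  eq_U : ∀ x y, A x y = .eq → U x y = e y
  eq_U' : ∀ x y, A x y = .eq → e y = U x (y - 1) + 1
  gt_R : ∀ x y, A x y = .gt → R x y = 0
  gt_R' : ∀ x y, A x y = .gt → R (x - 1) y = 4
  gt_U : ∀ x y, A x y = .gt → U x y = U x (y - 1)

namespace SkelValid

variable {A : ℤ → ℤ → Ordering} {d e : ℤ → ZMod 5} {R U : ℤ → ℤ → ZMod 5}

theorem transpose (h : SkelValid A d e R U) :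
    SkelValid (fun x y => (A y x).swap) e d (fun x y => U y x) (fun x y => R y x) where
  d_ne := h.e_ne
  e_ne := h.d_ne
  lt_R x y hA := h.gt_U y x (by simpa using hA)
  lt_U x y hA := h.gt_R y x (by simpa using hA)
  lt_U' x y hA := h.gt_R' y x (by simpa using hA)
  eq_R x y hA := h.eq_U y x (by simpa using hA)
  eq_R' x y hA := h.eq_U' y x (by simpa using hA)
  eq_U x y hA := h.eq_R y x (by simpa using hA)
  eq_U' x y hA := h.eq_R' y x (by simpa using hA)
  gt_R x y hA := h.lt_U y x (by simpa using hA)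
  gt_R' x y hA := h.lt_U' y x (by simpa using hA)
  gt_U x y hA := h.lt_R y x (by simpa using hA)

theorem shift (h : SkelValid A d e R U) (X Y : ℤ) :
    SkelValid (fun x y => A (x + X) (y + Y)) (fun x => d (x + X)) (fun y => e (y + Y))
      (fun x y => R (x + X) (y + Y)) (fun x y => U (x + X) (y + Y)) where
  d_ne _ := h.d_ne _
  e_ne _ := h.e_ne _
  lt_R x y hA := by have := h.lt_R _ _ hA; rwa [add_sub_right_comm] at this
  lt_U x y hA := h.lt_U _ _ hA
  lt_U' x y hA := by have := h.lt_U' _ _ hA; rwa [add_sub_right_comm] at this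
  eq_R x y hA := h.eq_R _ _ hA
  eq_R' x y hA := by have := h.eq_R' _ _ hA; rwa [add_sub_right_comm] at this
  eq_U x y hA := h.eq_U _ _ hA
  eq_U' x y hA := by have := h.eq_U' _ _ hA; rwa [add_sub_right_comm] at this
  gt_R x y hA := h.gt_R _ _ hA
  gt_R' x y hA := by have := h.gt_R' _ _ hA; rwa [add_sub_right_comm] at this
  gt_U x y hA := by have := h.gt_U _ _ hA; rwa [add_sub_right_comm] at this

theorem U_step (h : SkelValid A d e R U) (x y : ℤ) :
    (A x y = .lt ∧ U x (y - 1) = 4 ∧ U x y = 0) ∨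
      (A x y ≠ .lt ∧ (U x y = U x (y - 1) ∨ U x y = U x (y - 1) + 1)) := by
  rcases hA : A x y with _ | _ | _
  · exact Or.inl ⟨rfl, h.lt_U' _ _ hA, h.lt_U _ _ hA⟩
  · exact Or.inr ⟨by simp, Or.inr ((h.eq_U _ _ hA).trans (h.eq_U' _ _ hA))⟩
  · exact Or.inr ⟨by simp, Or.inl (h.gt_U _ _ hA)⟩

private theorem decide_aux (u0 u1 u2 u3 : ZMod 5) (h0 : u0 = 0) (h1 : u1 = u0 ∨ u1 = u0 + 1)
    (h2 : u2 = u1 ∨ u2 = u1 + 1) (h3 : u3 = u2 ∨ u3 = u2 + 1) :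
    u0 ≠ 4 ∧ u1 ≠ 4 ∧ u2 ≠ 4 ∧ u3 ≠ 4 := by
  subst h0
  rcases h1 with rfl | rfl <;> rcases h2 with rfl | rfl <;> rcases h3 with rfl | rfl <;> decide

theorem lt_not_lt (h : SkelValid A d e R U) {x y : ℤ} (hA : A x y = .lt) :
    A x (y + 1) ≠ .lt ∧ A x (y + 2) ≠ .lt ∧ A x (y + 3) ≠ .lt ∧ A x (y + 4) ≠ .lt := by
  have h0 := h.lt_U _ _ hA
  have s1 := h.U_step x (y + 1)
  have s2 := h.U_step x (y + 2)
  have s3 := h.U_step x (y + 3)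
  have s4 := h.U_step x (y + 4)
  rw [show y + 1 - 1 = y by ring] at s1
  rw [show y + 2 - 1 = y + 1 by ring] at s2
  rw [show y + 3 - 1 = y + 2 by ring] at s3
  rw [show y + 4 - 1 = y + 3 by ring] at s4
  have n1 : A x (y + 1) ≠ .lt := by
    rcases s1 with ⟨-, b, -⟩ | ⟨a, -⟩
    · rw [h0] at b; exact absurd b (by decide)
    · exact a
  have t1 := (s1.resolve_left fun c => n1 c.1).2
  have n2 : A x (y + 2) ≠ .lt := by
    rcases s2 with ⟨-, b, -⟩ | ⟨a, -⟩
    · exact absurd b (decide_aux _ _ _ _ h0 t1 (Or.inl rfl) (Or.inl rfl)).2.1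
    · exact a
  have t2 := (s2.resolve_left fun c => n2 c.1).2
  have n3 : A x (y + 3) ≠ .lt := by
    rcases s3 with ⟨-, b, -⟩ | ⟨a, -⟩
    · exact absurd b (decide_aux _ _ _ _ h0 t1 t2 (Or.inl rfl)).2.2.1
    · exact a
  have t3 := (s3.resolve_left fun c => n3 c.1).2
  have n4 : A x (y + 4) ≠ .lt := by
    rcases s4 with ⟨-, b, -⟩ | ⟨a, -⟩
    · exact absurd b (decide_aux _ _ _ _ h0 t1 t2 t3).2.2.2
    · exact a
  exact ⟨n1, n2, n3, n4⟩

theorem lt_unique (h : SkelValid A d e R U) {x : ℤ} {s t : Fin 5} (hs : A x (s : ℕ) = .lt)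
    (ht : A x (t : ℕ) = .lt) : s = t := by
  obtain ⟨a1, a2, a3, a4⟩ := h.lt_not_lt hs
  obtain ⟨b1, b2, b3, b4⟩ := h.lt_not_lt ht
  fin_cases s <;> fin_cases t <;> simp_all

theorem exists_row (h : SkelValid A d e R U) (x : ℤ) :
    ∃ y, ∀ t : Fin 4, A (x + (t : ℕ)) y ≠ .lt := by
  by_contra! hc
  choose f hf using fun s : Fin 5 => hc (s : ℕ)
  have : Function.Injective f := fun s t hst => by
    have h1 := hf s
    rw [hst] at h1
    exact h.lt_unique h1 (hf t)
  simpa using Fintype.card_le_of_injective f this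

theorem row_step (h : SkelValid A d e R U) {x y : ℤ} (hA : A x y ≠ .lt) :
    R x y = R (x - 1) y + 1 ∧ (R x y ≠ 0 → d x = R x y) := by
  rcases hc : A x y with _ | _ | _
  · exact absurd hc hA
  · exact ⟨(h.eq_R _ _ hc).trans (h.eq_R' _ _ hc), fun _ => (h.eq_R _ _ hc).symm⟩
  · refine ⟨?_, fun h0 => absurd (h.gt_R _ _ hc) h0⟩
    rw [h.gt_R _ _ hc, h.gt_R' _ _ hc]; decide

theorem exists_phase (h : SkelValid A d e R U) (x : ℤ) :
    ∃ p : ZMod 5, (p ≠ 0 → d x = p) ∧ (p + 1 ≠ 0 → d (x + 1) = p + 1) ∧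
      (p + 2 ≠ 0 → d (x + 2) = p + 2) ∧ (p + 3 ≠ 0 → d (x + 3) = p + 3) := by
  obtain ⟨y, hy⟩ := h.exists_row x
  have s0 := h.row_step (x := x) (y := y) (by simpa using hy 0)
  have s1 := h.row_step (x := x + 1) (y := y) (by simpa using hy 1)
  have s2 := h.row_step (x := x + 2) (y := y) (by simpa using hy 2)
  have s3 := h.row_step (x := x + 3) (y := y) (by simpa using hy 3)
  rw [show x + 1 - 1 = x by ring] at s1
  rw [show x + 2 - 1 = x + 1 by ring] at s2
  rw [show x + 3 - 1 = x + 2 by ring] at s3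
  have r2 : R (x + 2) y = R x y + 2 := by rw [s2.1, s1.1]; ring
  have r3 : R (x + 3) y = R x y + 3 := by rw [s3.1, r2]; ring
  exact ⟨R x y, s0.2, s1.1 ▸ s1.2, r2 ▸ s2.2, r3 ▸ s3.2⟩

private theorem phase_aux : ∀ p p' d1 d2 d3 : ZMod 5, (p + 1 ≠ 0 → d1 = p + 1) →
    (p + 2 ≠ 0 → d2 = p + 2) → (p + 3 ≠ 0 → d3 = p + 3) → (p' ≠ 0 → d1 = p') →
    (p' + 1 ≠ 0 → d2 = p' + 1) → (p' + 2 ≠ 0 → d3 = p' + 2) → p' = p + 1 := by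
  intro p p' d1 d2 d3 a1 a2 a3 b1 b2 b3
  by_contra hne
  have c1 : p + 1 = 0 ∨ p' = 0 := by
    by_contra! hc
    exact hne ((b1 hc.2).symm.trans (a1 hc.1))
  have c2 : p + 2 = 0 ∨ p' + 1 = 0 := by
    by_contra! hc
    have := (b2 hc.2).symm.trans (a2 hc.1)
    exact hne (by linear_combination this)
  have c3 : p + 3 = 0 ∨ p' + 2 = 0 := by
    by_contra! hc
    have := (b3 hc.2).symm.trans (a3 hc.1)
    exact hne (by linear_combination this)
  clear a1 a2 a3 b1 b2 b3 d1 d2 d3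
  revert p p'
  decide

theorem exists_origin (h : SkelValid A d e R U) :
    ∃ x0 : ℤ, ∀ x : ℤ, (x : ZMod 5) ≠ 0 → d (x + x0) = x := by
  choose p hp using h.exists_phase
  have hs : ∀ x, p (x + 1) = p x + 1 := fun x => by
    obtain ⟨-, a1, a2, a3⟩ := hp x
    obtain ⟨b1, b2, b3, -⟩ := hp (x + 1)
    rw [show x + 1 + 1 = x + 2 by ring] at b2
    rw [show x + 1 + 2 = x + 3 by ring] at b3
    exact phase_aux _ _ _ _ _ a1 a2 a3 b1 b2 b3
  have hx : ∀ x : ℤ, p x = p 0 + x := fun x => by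
    induction x using Int.induction_on with
    | zero => simp
    | succ i ih => rw [hs, ih]; push_cast; ring
    | pred i ih =>
      have := hs (-i - 1)
      rw [sub_add_cancel, ih] at this
      push_cast at this ⊢
      linear_combination -this
  refine ⟨-((p 0).val : ℤ), fun x h0 => ?_⟩
  have key : p (x + -((p 0).val : ℤ)) = x := by
    rw [hx]
    push_cast
    rw [ZMod.natCast_zmod_val]; ring
  have := (hp (x + -((p 0).val : ℤ))).1
  rw [key] at this
  exact this h0

end SkelValid

/-- A valid skeleton whose lowest-level columns and rows are the non-multiples of `5`. -/
structure SkelOrigin (A : ℤ → ℤ → Ordering) (d e : ℤ → ZMod 5) (R U : ℤ → ℤ → ZMod 5) : Prop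
    extends SkelValid A d e R U where
  d_low : ∀ x : ℤ, (x : ZMod 5) ≠ 0 → d x = x
  e_low : ∀ y : ℤ, (y : ZMod 5) ≠ 0 → e y = y

namespace SkelOrigin

variable {A : ℤ → ℤ → Ordering} {d e : ℤ → ZMod 5} {R U : ℤ → ℤ → ZMod 5}

theorem transpose (h : SkelOrigin A d e R U) :
    SkelOrigin (fun x y => (A y x).swap) e d (fun x y => U y x) (fun x y => R y x) where
  toSkelValid := h.toSkelValid.transpose
  d_low := h.e_low
  e_low := h.d_low

theorem gt_right (h : SkelOrigin A d e R U) {x y : ℤ} (hx : (x : ZMod 5) ≠ 0)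
    (hx' : ((x + 1 : ℤ) : ZMod 5) ≠ 0) (hA : A x y = .gt) : A (x + 1) y = .lt := by
  have r := h.gt_R _ _ hA
  rcases hc : A (x + 1) y with _ | _ | _
  · rfl
  · have := h.eq_R' _ _ hc
    rw [add_sub_cancel_right, r, h.d_low _ hx'] at this
    push_cast at this
    exact absurd (by linear_combination this) hx
  · have := h.gt_R' _ _ hc
    rw [add_sub_cancel_right, r] at this
    exact absurd this (by decide)

theorem gt_left (h : SkelOrigin A d e R U) {x y : ℤ} (hx : ((x + 1 : ℤ) : ZMod 5) ≠ 0)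
    (hx' : (x : ZMod 5) ≠ 0) (hA : A (x + 1) y = .gt) : A x y = .lt := by
  have r := h.gt_R' _ _ hA
  rw [add_sub_cancel_right] at r
  rcases hc : A x y with _ | _ | _
  · rfl
  · have := h.eq_R _ _ hc
    rw [r, h.d_low _ hx'] at this
    push_cast at hx
    rw [← this] at hx
    exact absurd (by decide) hx
  · have := h.gt_R _ _ hc
    rw [r] at this
    exact absurd this (by decide)

theorem lt_up (h : SkelOrigin A d e R U) {x y : ℤ} (hy : (y : ZMod 5) ≠ 0)
    (hy' : ((y + 1 : ℤ) : ZMod 5) ≠ 0) (hA : A x y = .lt) : A x (y + 1) = .gt := by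
  have := h.transpose.gt_right (x := y) (y := x) hy hy' (by simp [hA])
  simpa using this

theorem lt_down (h : SkelOrigin A d e R U) {x y : ℤ} (hy : ((y + 1 : ℤ) : ZMod 5) ≠ 0)
    (hy' : (y : ZMod 5) ≠ 0) (hA : A x (y + 1) = .lt) : A x y = .gt := by
  have := h.transpose.gt_left (x := y) (y := x) hy hy' (by simp [hA])
  simpa using this

private theorem low_pair : ∀ y : ZMod 5, y ≠ 0 →
    (y + 1 ≠ 0 ∧ y + 2 ≠ 0) ∨ (y - 1 ≠ 0 ∧ y - 2 ≠ 0) := by decide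

theorem low_not_lt_of_gt (h : SkelOrigin A d e R U) {x x' y : ℤ} (hy : (y : ZMod 5) ≠ 0)
    (h1 : ∀ y, A x y = .gt → A x' y = .lt) (h2 : ∀ y, A x' y = .gt → A x y = .lt)
    (hA : A x y = .gt) : False := by
  have l0 := h1 _ hA
  rcases low_pair _ hy with ⟨a1, a2⟩ | ⟨a1, a2⟩
  · have g1 := h.lt_up (x := x') hy (by push_cast; exact a1) l0
    have l1 := h2 _ g1
    have g2 := h.lt_up (x := x) (y := y + 1) (by push_cast; exact a1)
      (by push_cast; rw [add_assoc, one_add_one_eq_two]; exact a2) l1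
    have l2 := h1 _ g2
    rw [add_assoc, one_add_one_eq_two] at l2
    exact (h.lt_not_lt l0).2.1 l2
  · have g1 := h.lt_down (x := x') (y := y - 1) (by rwa [sub_add_cancel]) (by push_cast; exact a1)
      (by rwa [sub_add_cancel])
    have l1 := h2 _ g1
    have g2 := h.lt_down (x := x) (y := y - 2)
      (by push_cast; rw [show (y : ZMod 5) - 2 + 1 = y - 1 by ring]; exact a1)
      (by push_cast; exact a2) (by rwa [show y - 2 + 1 = y - 1 by ring])
    have l2 := h1 _ g2
    refine (h.lt_not_lt l2).2.1 ?_
    rwa [sub_add_cancel]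

theorem low_not_gt (h : SkelOrigin A d e R U) {x y : ℤ} (hx : (x : ZMod 5) ≠ 0)
    (hy : (y : ZMod 5) ≠ 0) : A x y ≠ .gt := by
  intro hA
  rcases low_pair _ hx with ⟨a1, -⟩ | ⟨a1, -⟩
  · exact h.low_not_lt_of_gt (x' := x + 1) hy
      (fun y hc => h.gt_right hx (by push_cast; exact a1) hc)
      (fun y hc => h.gt_left (by push_cast; exact a1) hx hc) hA
  · have a1' : ((x - 1 : ℤ) : ZMod 5) ≠ 0 := by push_cast; exact a1
    refine h.low_not_lt_of_gt (x' := x - 1) hy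
      (fun y hc => h.gt_left (x := x - 1) (by rwa [sub_add_cancel]) a1' (by rwa [sub_add_cancel]))
      (fun y hc => ?_) hA
    have := h.gt_right (x := x - 1) a1' (by rwa [sub_add_cancel]) hc
    rwa [sub_add_cancel] at this

theorem low_low (h : SkelOrigin A d e R U) {x y : ℤ} (hx : (x : ZMod 5) ≠ 0)
    (hy : (y : ZMod 5) ≠ 0) : A x y = .eq := by
  have h1 := h.low_not_gt hx hy
  have h2 := h.transpose.low_not_gt hy hx
  rcases hc : A x y with _ | _ | _
  · simp [hc] at h2
  · rfl
  · exact absurd hc h1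

theorem low_high (h : SkelOrigin A d e R U) {x y : ℤ} (hx : (x : ZMod 5) ≠ 0)
    (hy : (y : ZMod 5) = 0) : A x y = .lt := by
  have y1 : ((y - 1 : ℤ) : ZMod 5) = 4 := by push_cast; rw [hy]; decide
  have y2 : ((y + 1 : ℤ) : ZMod 5) = 1 := by push_cast; rw [hy]; decide
  have e1 := h.low_low hx (y := y - 1) (by rw [y1]; decide)
  have e2 := h.low_low hx (y := y + 1) (by rw [y2]; decide)
  have u1 := h.eq_U _ _ e1
  rw [h.e_low _ (by rw [y1]; decide), y1] at u1
  have u2 := h.eq_U' _ _ e2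
  rw [h.e_low _ (by rw [y2]; decide), y2, add_sub_cancel_right] at u2
  rcases hc : A x y with _ | _ | _
  · rfl
  · have := h.eq_U' _ _ hc
    rw [u1] at this
    exact absurd (this.trans (by decide)) (h.e_ne y)
  · have := h.gt_U _ _ hc
    rw [u1] at this
    rw [this] at u2
    exact absurd u2 (by decide)

theorem high_low (h : SkelOrigin A d e R U) {x y : ℤ} (hx : (x : ZMod 5) = 0)
    (hy : (y : ZMod 5) ≠ 0) : A x y = .gt := by
  simpa using h.transpose.low_high hy hx

theorem R_high (h : SkelOrigin A d e R U) {y : ℤ} (hy : (y : ZMod 5) = 0) (x s : ℤ) (hs : 0 ≤ s)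
    (hs' : s < 5) : R (5 * x + s) y = R (5 * x) y := by
  have five : (5 : ZMod 5) = 0 := by decide
  have step : ∀ s : ℤ, (s : ZMod 5) ≠ 0 → R (5 * x + s) y = R (5 * x + (s - 1)) y := fun s h0 => by
    rw [h.lt_R _ _ (h.low_high (x := 5 * x + s) (by push_cast; rwa [five, zero_mul, zero_add]) hy),
      add_sub_assoc]
  have n1 := step 1 (by decide)
  have n2 := step 2 (by decide)
  have n3 := step 3 (by decide)
  have n4 := step 4 (by decide)
  norm_num at n1 n2 n3 n4
  interval_cases s
  · simp
  · exact n1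
  · rw [n2, n1]
  · rw [n3, n2, n1]
  · rw [n4, n3, n2, n1]

theorem U_high (h : SkelOrigin A d e R U) {x : ℤ} (hx : (x : ZMod 5) = 0) (y s : ℤ) (hs : 0 ≤ s)
    (hs' : s < 5) : U x (5 * y + s) = U x (5 * y) :=
  h.transpose.R_high hx y s hs hs'

theorem compress (h : SkelOrigin A d e R U) :
    SkelValid (fun x y => A (5 * x) (5 * y)) (fun x => d (5 * x)) (fun y => e (5 * y))
      (fun x y => R (5 * x) (5 * y)) (fun x y => U (5 * x) (5 * y)) := by
  have five : (5 : ZMod 5) = 0 := by decide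
  have hR : ∀ x y, R (5 * x - 1) (5 * y) = R (5 * (x - 1)) (5 * y) := fun x y => by
    have := h.R_high (y := 5 * y) (by push_cast; rw [five, zero_mul]) (x - 1) 4 (by simp) (by simp)
    rwa [show 5 * (x - 1) + 4 = 5 * x - 1 by ring] at this
  have hU : ∀ x y, U (5 * x) (5 * y - 1) = U (5 * x) (5 * (y - 1)) := fun x y => by
    have := h.U_high (x := 5 * x) (by push_cast; rw [five, zero_mul]) (y - 1) 4 (by simp) (by simp)
    rwa [show 5 * (y - 1) + 4 = 5 * y - 1 by ring] at this
  exact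
  { d_ne _ := h.d_ne _
    e_ne _ := h.e_ne _
    lt_R x y hA := (h.lt_R _ _ hA).trans (hR x y)
    lt_U x y hA := h.lt_U _ _ hA
    lt_U' x y hA := (hU x y).symm.trans (h.lt_U' _ _ hA)
    eq_R x y hA := h.eq_R _ _ hA
    eq_R' x y hA := by rw [h.eq_R' _ _ hA, hR]
    eq_U x y hA := h.eq_U _ _ hA
    eq_U' x y hA := by rw [h.eq_U' _ _ hA, hU]
    gt_R x y hA := h.gt_R _ _ hA
    gt_R' x y hA := (hR x y).symm.trans (h.gt_R' _ _ hA)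
    gt_U x y hA := (h.gt_U _ _ hA).trans (hU x y) }

end SkelOrigin

/-- `5 ^ r` exactly divides `x`. -/
def Lv (r : ℕ) (x : ℤ) : Prop := (5 : ℤ) ^ r ∣ x ∧ ¬ (5 : ℤ) ^ (r + 1) ∣ x

theorem lv_zero_iff {x : ℤ} : Lv 0 x ↔ (x : ZMod 5) ≠ 0 := by
  rw [Lv, Ne, ZMod.intCast_zmod_eq_zero_iff_dvd]; simp

theorem zmod5_eq_zero_iff {x : ℤ} : (x : ZMod 5) = 0 ↔ 5 ∣ x := by
  have := ZMod.intCast_zmod_eq_zero_iff_dvd x 5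
  simpa using this

theorem pow_succ_dvd_five_mul {r : ℕ} {x : ℤ} : (5 : ℤ) ^ (r + 1) ∣ 5 * x ↔ (5 : ℤ) ^ r ∣ x := by
  rw [pow_succ', mul_dvd_mul_iff_left (by norm_num)]

theorem lv_five_mul {r : ℕ} {x : ℤ} : Lv (r + 1) (5 * x) ↔ Lv r x := by
  rw [Lv, Lv, pow_succ_dvd_five_mul, pow_succ_dvd_five_mul]

theorem Lv.exists_five_mul {r : ℕ} {x : ℤ} (h : Lv (r + 1) x) : ∃ x', x = 5 * x' ∧ Lv r x' := by
  obtain ⟨x', rfl⟩ : 5 ∣ x := dvd_trans (dvd_pow_self _ (by simp)) h.1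
  exact ⟨x', rfl, lv_five_mul.1 h⟩

theorem five_mul_ediv_pow (x : ℤ) (r : ℕ) : (5 * x) / (5 : ℤ) ^ (r + 1) = x / 5 ^ r := by
  rw [pow_succ', Int.mul_ediv_mul_of_pos _ _ (by norm_num)]

/-- The first `k` levels of the skeleton are the standard hierarchy at the origin. -/
structure Std (k : ℕ) (A : ℤ → ℤ → Ordering) (d e : ℤ → ZMod 5) (R U : ℤ → ℤ → ZMod 5) : Prop where
  d_eq : ∀ r < k, ∀ x, Lv r x → d x = ((x / 5 ^ r : ℤ) : ZMod 5)
  e_eq : ∀ r < k, ∀ y, Lv r y → e y = ((y / 5 ^ r : ℤ) : ZMod 5)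
  A_eq : ∀ r < k, ∀ x y, Lv r x → Lv r y → A x y = .eq
  A_lt : ∀ r < k, ∀ x y, Lv r x → (5 : ℤ) ^ (r + 1) ∣ y → A x y = .lt
  A_gt : ∀ r < k, ∀ x y, (5 : ℤ) ^ (r + 1) ∣ x → Lv r y → A x y = .gt
  R_eq : ∀ r < k, ∀ x y, Lv r y → R x y = ((x / 5 ^ r : ℤ) : ZMod 5)
  U_eq : ∀ r < k, ∀ x y, Lv r x → U x y = ((y / 5 ^ r : ℤ) : ZMod 5)

namespace SkelOrigin

variable {A : ℤ → ℤ → Ordering} {d e : ℤ → ZMod 5} {R U : ℤ → ℤ → ZMod 5}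

theorem R_low (h : SkelOrigin A d e R U) {x y : ℤ} (hy : (y : ZMod 5) ≠ 0) : R x y = x := by
  by_cases hx : (x : ZMod 5) = 0
  · rw [h.gt_R _ _ (h.high_low hx hy), hx]
  · rw [h.eq_R _ _ (h.low_low hx hy), h.d_low _ hx]

theorem U_low (h : SkelOrigin A d e R U) {x y : ℤ} (hx : (x : ZMod 5) ≠ 0) : U x y = y :=
  h.transpose.R_low hx

theorem std_succ (h : SkelOrigin A d e R U) {k : ℕ}
    (hk : Std k (fun x y => A (5 * x) (5 * y)) (fun x => d (5 * x)) (fun y => e (5 * y))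
      (fun x y => R (5 * x) (5 * y)) (fun x y => U (5 * x) (5 * y))) :
    Std (k + 1) A d e R U where
  d_eq r hr x hx := by
    rcases r with _ | r
    · rw [h.d_low _ (lv_zero_iff.1 hx)]; simp
    · obtain ⟨x, rfl, hx'⟩ := hx.exists_five_mul
      rw [five_mul_ediv_pow]
      exact hk.d_eq r (by omega) x hx'
  e_eq r hr x hx := by
    rcases r with _ | r
    · rw [h.e_low _ (lv_zero_iff.1 hx)]; simp
    · obtain ⟨x, rfl, hx'⟩ := hx.exists_five_mul
      rw [five_mul_ediv_pow]
      exact hk.e_eq r (by omega) x hx'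
  A_eq r hr x y hx hy := by
    rcases r with _ | r
    · exact h.low_low (lv_zero_iff.1 hx) (lv_zero_iff.1 hy)
    · obtain ⟨x, rfl, hx'⟩ := hx.exists_five_mul
      obtain ⟨y, rfl, hy'⟩ := hy.exists_five_mul
      exact hk.A_eq r (by omega) x y hx' hy'
  A_lt r hr x y hx hy := by
    rcases r with _ | r
    · exact h.low_high (lv_zero_iff.1 hx) (zmod5_eq_zero_iff.2 (by simpa using hy))
    · obtain ⟨x, rfl, hx'⟩ := hx.exists_five_mul
      obtain ⟨y, rfl⟩ : 5 ∣ y := dvd_trans (dvd_pow_self _ (by simp)) hy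
      exact hk.A_lt r (by omega) x y hx' (pow_succ_dvd_five_mul.1 hy)
  A_gt r hr x y hx hy := by
    rcases r with _ | r
    · exact h.high_low (zmod5_eq_zero_iff.2 (by simpa using hx)) (lv_zero_iff.1 hy)
    · obtain ⟨y, rfl, hy'⟩ := hy.exists_five_mul
      obtain ⟨x, rfl⟩ : 5 ∣ x := dvd_trans (dvd_pow_self _ (by simp)) hx
      exact hk.A_gt r (by omega) x y (pow_succ_dvd_five_mul.1 hx) hy'
  R_eq r hr x y hy := by
    rcases r with _ | r
    · rw [h.R_low (lv_zero_iff.1 hy)]; simp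
    · obtain ⟨y, rfl, hy'⟩ := hy.exists_five_mul
      have h1 := h.R_high (y := 5 * y) (zmod5_eq_zero_iff.2 (by simp)) (x / 5) (x % 5)
        (by omega) (by omega)
      rw [Int.mul_ediv_add_emod] at h1
      rw [h1, pow_succ', ← Int.ediv_ediv_of_nonneg (by norm_num)]
      exact hk.R_eq r (by omega) (x / 5) y hy'
  U_eq r hr x y hx := by
    rcases r with _ | r
    · rw [h.U_low (lv_zero_iff.1 hx)]; simp
    · obtain ⟨x, rfl, hx'⟩ := hx.exists_five_mul
      have h1 := h.U_high (x := 5 * x) (zmod5_eq_zero_iff.2 (by simp)) (y / 5) (y % 5)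
        (by omega) (by omega)
      rw [Int.mul_ediv_add_emod] at h1
      rw [h1, pow_succ', ← Int.ediv_ediv_of_nonneg (by norm_num)]
      exact hk.U_eq r (by omega) x (y / 5) hx'

end SkelOrigin

theorem SkelValid.exists_std (k : ℕ) {A : ℤ → ℤ → Ordering} {d e : ℤ → ZMod 5}
    {R U : ℤ → ℤ → ZMod 5} (h : SkelValid A d e R U) :
    ∃ X Y : ℤ, Std k (fun x y => A (x + X) (y + Y)) (fun x => d (x + X)) (fun y => e (y + Y))
      (fun x y => R (x + X) (y + Y)) (fun x y => U (x + X) (y + Y)) := by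
  induction k generalizing A d e R U with
  | zero => exact ⟨0, 0, by constructor <;> intro r hr <;> simp at hr⟩
  | succ k ih =>
    obtain ⟨x0, hx0⟩ := h.exists_origin
    obtain ⟨y0, hy0⟩ := h.transpose.exists_origin
    have h' : SkelOrigin (fun x y => A (x + x0) (y + y0)) (fun x => d (x + x0))
        (fun y => e (y + y0)) (fun x y => R (x + x0) (y + y0)) (fun x y => U (x + x0) (y + y0)) :=
      { toSkelValid := h.shift x0 y0, d_low := hx0, e_low := hy0 }
    obtain ⟨X, Y, hXY⟩ := ih h'.compress
    have h'' : SkelOrigin (fun x y => A (x + (5 * X + x0)) (y + (5 * Y + y0)))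
        (fun x => d (x + (5 * X + x0))) (fun y => e (y + (5 * Y + y0)))
        (fun x y => R (x + (5 * X + x0)) (y + (5 * Y + y0)))
        (fun x y => U (x + (5 * X + x0)) (y + (5 * Y + y0))) :=
      { toSkelValid := h.shift _ _
        d_low := fun x hx => by
          have := hx0 (x + 5 * X) (by push_cast; rw [show (5 : ZMod 5) = 0 by decide]; simpa using hx)
          rw [add_assoc] at this
          rw [this]; push_cast; rw [show (5 : ZMod 5) = 0 by decide]; simp
        e_low := fun x hx => by
          have := hy0 (x + 5 * Y) (by push_cast; rw [show (5 : ZMod 5) = 0 by decide]; simpa using hx)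
          rw [add_assoc] at this
          rw [this]; push_cast; rw [show (5 : ZMod 5) = 0 by decide]; simp }
    refine ⟨5 * X + x0, 5 * Y + y0, h''.std_succ ?_⟩
    have e1 : ∀ x X x0 : ℤ, 5 * x + (5 * X + x0) = 5 * (x + X) + x0 := fun x X x0 => by ring
    simpa only [e1] using hXY

end HEnt

namespace HEnt

/-- A one-sided array automaton: a head state `Q` looking at cell `0` of an array over `C`; at each
step every cell is updated from the head state, the content of cell `0` and its neighbours. -/
structure AM (Q C : Type) where
  q0 : Q
  blank : C
  next : Q → C → Q
  rej : Set Q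
  upd : Q → C → Option C → C → C → C
  ini : ZMod 5 → C

namespace AM

variable {Q C : Type}

/-- One step of an array automaton. -/
def step (M : AM Q C) (c : Q × (ℕ → C)) : Q × (ℕ → C) :=
  (M.next c.1 (c.2 0), fun i =>
    M.upd c.1 (c.2 0) (if i = 0 then none else some (c.2 (i - 1))) (c.2 i) (c.2 (i + 1)))

/-- The configuration after `s` steps on the input stream `σ`. -/
def run (M : AM Q C) (σ : ℕ → ZMod 5) (s : ℕ) : Q × (ℕ → C) :=
  M.step^[s] (M.q0, fun i => M.ini (σ i))

/-- Restriction of an array automaton to a closed set of states. -/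
def restrict (M : AM Q C) (S : Set Q) (h0 : M.q0 ∈ S) (h : ∀ q ∈ S, ∀ c, M.next q c ∈ S) :
    AM S C where
  q0 := ⟨M.q0, h0⟩
  blank := M.blank
  next q c := ⟨M.next q c, h q q.2 c⟩
  rej := {q | (q : Q) ∈ M.rej}
  upd q := M.upd q
  ini := M.ini

theorem restrict_run (M : AM Q C) (S : Set Q) (h0 : M.q0 ∈ S) (h : ∀ q ∈ S, ∀ c, M.next q c ∈ S)
    (σ : ℕ → ZMod 5) (s : ℕ) :
    M.run σ s = (((M.restrict S h0 h).run σ s).1.1, ((M.restrict S h0 h).run σ s).2) := by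
  induction s with
  | zero => rfl
  | succ s ih =>
    rw [run, Function.iterate_succ_apply', ← run, ih, run, run, Function.iterate_succ_apply']
    rfl

end AM

open Turing Turing.ToPartrec Turing.PartrecToTM2

/-- Statements of the stack machine for partial recursive functions. -/
abbrev PStmt := TM2.Stmt (fun _ : K' => Γ') Λ' (Option Γ')

/-- States of the machine that feeds the input stream to a stack machine. -/
inductive WState
  | start
  | loop
  | pushing (l : List Γ')
  | sim (q : PStmt) (v : Option Γ')
  | rej

/-- Operations on a single stack. -/
inductive SOp
  | nop
  | pop
  | push (γ : Γ')

/-- The state transition of the stream-feeding machine. -/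
def wnext (c : Code) : WState → (K' → Option Γ') × ZMod 5 → WState
  | .start, _ => .loop
  | .loop, t => .pushing (trNat t.2.val ++ [Γ'.cons]).reverse
  | .pushing [], _ => .sim (tr (trNormal c Cont'.halt)) none
  | .pushing (_ :: l), _ => .pushing l
  | .sim (.push _ _ q) v, _ => .sim q v
  | .sim (.peek k f q) v, t => .sim q (f v (t.1 k))
  | .sim (.pop k f q) v, t => .sim q (f v (t.1 k))
  | .sim (.load f q) v, _ => .sim q (f v)
  | .sim (.branch f q₁ q₂) v, _ => .sim (cond (f v) q₁ q₂) v
  | .sim (.goto f) v, _ => .sim (tr (f v)) v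
  | .sim .halt _, t => if t.1 K'.main = some Γ'.cons then .rej else .loop
  | .rej, _ => .rej

/-- The stack operations of the stream-feeding machine. -/
def wop : WState → K' → SOp
  | .start, K'.main => .push Γ'.cons
  | .pushing (γ :: _), K'.main => .push γ
  | .sim (.push k f _) v, k' => if k' = k then .push (f v) else .nop
  | .sim (.pop k _ _) _, k' => if k' = k then .pop else .nop
  | _, _ => .nop

/-- Whether the stream-feeding machine consumes an input symbol. -/
def wadv : WState → Bool
  | .loop => true
  | _ => false

/-- The stream-feeding machine as an array automaton. -/
def wAM (c : Code) : AM WState ((K' → Option Γ') × ZMod 5) where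
  q0 := .start
  blank := (fun _ => none, 0)
  next := wnext c
  rej := {.rej}
  upd q _ l o r :=
    (fun k => match wop q k with
      | .nop => o.1 k
      | .pop => r.1 k
      | .push γ => match l with
        | none => some γ
        | some l => l.1 k, if wadv q then r.2 else o.2)
  ini a := (fun _ => none, a)

/-- The array contents representing four stacks and the rest of the stream. -/
def arrOf (σ : ℕ → ZMod 5) (S : K' → List Γ') (p : ℕ) (i : ℕ) : (K' → Option Γ') × ZMod 5 :=
  (fun k => (S k)[i]?, σ (p + i))

/-- One step of the stream-feeding machine on actual stacks. -/
def mstep (c : Code) (σ : ℕ → ZMod 5) (x : WState × (K' → List Γ') × ℕ) :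
    WState × (K' → List Γ') × ℕ :=
  (wnext c x.1 (fun k => (x.2.1 k).head?, σ x.2.2),
    fun k => match wop x.1 k with
      | .nop => x.2.1 k
      | .pop => (x.2.1 k).tail
      | .push γ => γ :: x.2.1 k,
    if wadv x.1 then x.2.2 + 1 else x.2.2)

theorem step_arrOf (c : Code) (σ : ℕ → ZMod 5) (x : WState × (K' → List Γ') × ℕ) :
    (wAM c).step (x.1, arrOf σ x.2.1 x.2.2) =
      ((mstep c σ x).1, arrOf σ (mstep c σ x).2.1 (mstep c σ x).2.2) := by
  obtain ⟨q, S, p⟩ := x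
  refine Prod.ext ?_ (funext fun i => Prod.ext (funext fun k => ?_) ?_)
  · simp [AM.step, wAM, mstep, arrOf, List.head?_eq_getElem?]
  · simp only [AM.step, wAM, mstep, arrOf]
    cases wop q k with
    | nop => rfl
    | pop => simp
    | push γ => rcases i with _ | i <;> simp
  · simp only [AM.step, wAM, mstep, arrOf]
    cases wadv q
    · simp
    · simp only [if_true]
      congr 1
      ring

theorem run_wAM (c : Code) (σ : ℕ → ZMod 5) (s : ℕ) :
    ((wAM c).run σ s).1 = ((mstep c σ)^[s] (.start, fun _ => [], 0)).1 := by
  suffices h : (wAM c).run σ s = (((mstep c σ)^[s] (.start, fun _ => [], 0)).1,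
      arrOf σ ((mstep c σ)^[s] (.start, fun _ => [], 0)).2.1
        ((mstep c σ)^[s] (.start, fun _ => [], 0)).2.2) by rw [h]
  induction s with
  | zero => simp [AM.run, wAM, arrOf, funext_iff]
  | succ s ih =>
    rw [AM.run, Function.iterate_succ_apply', ← AM.run, ih, step_arrOf,
      Function.iterate_succ_apply']

/-- Reachability for the stream-feeding machine. -/
def MReach (c : Code) (σ : ℕ → ZMod 5) (x y : WState × (K' → List Γ') × ℕ) : Prop :=
  ∃ n, (mstep c σ)^[n] x = y

theorem MReach.trans {c : Code} {σ : ℕ → ZMod 5} {x y z : WState × (K' → List Γ') × ℕ}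
    (h : MReach c σ x y) (h' : MReach c σ y z) : MReach c σ x z := by
  obtain ⟨n, rfl⟩ := h
  obtain ⟨m, rfl⟩ := h'
  exact ⟨m + n, Function.iterate_add_apply _ _ _ _⟩

theorem MReach.head {c : Code} {σ : ℕ → ZMod 5} {x z : WState × (K' → List Γ') × ℕ}
    (h : MReach c σ (mstep c σ x) z) : MReach c σ x z :=
  MReach.trans ⟨1, rfl⟩ h

theorem MReach.head_of_eq {c : Code} {σ : ℕ → ZMod 5} {x y z : WState × (K' → List Γ') × ℕ}
    (h : mstep c σ x = y) (h' : MReach c σ y z) : MReach c σ x z :=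
  MReach.head (h ▸ h')

theorem mreach_stepAux (c : Code) (σ : ℕ → ZMod 5) (p : ℕ) (q : PStmt) (v : Option Γ')
    (S : K' → List Γ') :
    MReach c σ (.sim q v, S, p)
      (.sim ((TM2.stepAux q v S).l.elim TM2.Stmt.halt tr) (TM2.stepAux q v S).var,
        (TM2.stepAux q v S).stk, p) := by
  induction q generalizing v S with
  | push k f q ih =>
    refine MReach.head_of_eq ?_ (ih v (Function.update S k (f v :: S k)))
    refine Prod.ext rfl (Prod.ext (funext fun k' => ?_) rfl)
    by_cases hk : k' = k
    · subst hk; simp [mstep, wop]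
    · simp [mstep, wop, hk]
  | peek k f q ih => exact MReach.head (ih _ _)
  | pop k f q ih =>
    refine MReach.head_of_eq ?_ (ih (f v (S k).head?) (Function.update S k (S k).tail))
    refine Prod.ext rfl (Prod.ext (funext fun k' => ?_) rfl)
    by_cases hk : k' = k
    · subst hk; simp [mstep, wop]
    · simp [mstep, wop, hk]
  | load f q ih => exact MReach.head (ih _ _)
  | branch f q₁ q₂ ih₁ ih₂ =>
    simp only [TM2.stepAux]
    cases hf : f v
    · exact MReach.head_of_eq (by simp [mstep, wnext, wop, wadv, hf]) (ih₂ v S)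
    · exact MReach.head_of_eq (by simp [mstep, wnext, wop, wadv, hf]) (ih₁ v S)
  | goto f => exact MReach.head ⟨0, rfl⟩
  | halt => exact ⟨0, rfl⟩

theorem mreach_of_reaches (c : Code) (σ : ℕ → ZMod 5) (p : ℕ) {x y : Cfg'}
    (h : StateTransition.Reaches (TM2.step tr) x y) :
    MReach c σ (.sim (x.l.elim TM2.Stmt.halt tr) x.var, x.stk, p)
      (.sim (y.l.elim TM2.Stmt.halt tr) y.var, y.stk, p) := by
  induction h with
  | refl => exact ⟨0, rfl⟩
  | @tail y z _ h ih =>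
    refine ih.trans ?_
    obtain ⟨l, v, S⟩ := y
    rcases l with _ | l
    · cases h
    · obtain rfl : TM2.stepAux (tr l) v S = z := Option.some.inj h
      exact mreach_stepAux c σ p (tr l) v S

theorem mreach_pushing (c : Code) (σ : ℕ → ZMod 5) (p : ℕ) (l m : List Γ') :
    MReach c σ (.pushing l, K'.elim m [] [] [], p)
      (.sim (tr (trNormal c Cont'.halt)) none, K'.elim (l.reverse ++ m) [] [] [], p) := by
  induction l generalizing m with
  | nil =>
    refine MReach.head ⟨0, ?_⟩
    simp only [Function.iterate_zero, id, mstep, wnext, wadv]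
    refine Prod.ext rfl (Prod.ext (funext fun k => ?_) rfl)
    cases k <;> rfl
  | cons γ l ih =>
    rw [List.reverse_cons, List.append_assoc]
    refine MReach.head_of_eq ?_ (ih (γ :: m))
    refine Prod.ext rfl (Prod.ext (funext fun k => ?_) rfl)
    cases k <;> rfl

theorem mreach_body (c : Code) (σ : ℕ → ZMod 5) (p n g : ℕ)
    (hc : c.eval [(σ p).val, n] = pure [g]) :
    MReach c σ (.pushing (trNat (σ p).val ++ [Γ'.cons]).reverse, K'.elim (trList [n]) [] [] [],
      p + 1) (if g = 0 then .rej else .loop, K'.elim (trList [g]) [] [] [], p + 1) := by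
  refine (mreach_pushing c σ (p + 1) _ _).trans ?_
  have h : halt [g] ∈ StateTransition.eval (TM2.step tr) (init c [(σ p).val, n]) := by
    rw [tr_eval, hc]
    exact Part.mem_map _ (Part.mem_some _)
  have := mreach_of_reaches c σ (p + 1) (StateTransition.mem_eval.1 h).1
  simp only [init, halt, Option.elim] at this
  rw [List.reverse_reverse, List.append_assoc]
  refine MReach.trans this (MReach.head ⟨0, ?_⟩)
  simp only [Function.iterate_zero, id, mstep, wnext, wop, wadv, K'.elim_main]
  refine Prod.ext ?_ rfl
  rcases g with _ | g
  · simp [trList, trNat, trNum]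
  · have key : ∀ m : PosNum, ∃ a t, trPosNum m = a :: t ∧ a ≠ Γ'.cons := by
      intro m
      cases m
      · exact ⟨_, _, rfl, by decide⟩
      · exact ⟨_, _, rfl, by decide⟩
      · exact ⟨_, _, rfl, by decide⟩
    have hg : ∃ m : PosNum, ((g + 1 : ℕ) : Num) = Num.pos m := by
      rcases h0 : ((g + 1 : ℕ) : Num) with _ | m
      · have := congrArg (fun x : Num => (x : ℕ)) h0
        simp at this
      · exact ⟨m, rfl⟩
    obtain ⟨m, hm⟩ := hg
    obtain ⟨a, t, hat, ha⟩ := key m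
    simp [trList, trNat, hm, trNum, hat, ha]

/-- The first `T` symbols of the stream, the most recent one first. -/
def initRev (σ : ℕ → ZMod 5) (T : ℕ) : List ℕ :=
  ((List.range T).map fun i => (σ i).val).reverse

theorem initRev_succ (σ : ℕ → ZMod 5) (T : ℕ) :
    initRev σ (T + 1) = (σ T).val :: initRev σ T := by
  simp [initRev, List.range_succ]

/-- The list coded by the register of the stream-feeding machine. -/
def regList (n : ℕ) : List ℕ := (Encodable.decode (n - 1) : Option (List ℕ)).getD []

theorem regList_encode (l : List ℕ) : regList (Encodable.encode l + 1) = l := by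
  simp [regList]

theorem wAM_never_rejects_iff (c : Code) (bad : List ℕ → Prop) [DecidablePred bad]
    (hc : ∀ a n, c.eval [a, n] =
      pure [if bad (a :: regList n) then 0 else Encodable.encode (a :: regList n) + 1])
    (σ : ℕ → ZMod 5) :
    (∀ s, ((wAM c).run σ s).1 ∉ (wAM c).rej) ↔ ∀ T, ¬ bad (initRev σ (T + 1)) := by
  simp only [run_wAM]
  set x0 : WState × (K' → List Γ') × ℕ := (.start, fun _ => [], 0) with hx0
  let L : ℕ → ℕ → WState × (K' → List Γ') × ℕ := fun n p =>
    (.loop, K'.elim (trList [n]) [] [] [], p)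
  have absorb : ∀ s x, x.1 = WState.rej → ((mstep c σ)^[s] x).1 = WState.rej := by
    intro s
    induction s with
    | zero => exact fun x hx => hx
    | succ s ih =>
      intro x hx
      rw [Function.iterate_succ_apply]
      exact ih _ (by simp [mstep, hx, wnext])
  have hstart : mstep c σ x0 = L 0 0 := by
    refine Prod.ext rfl (Prod.ext (funext fun k => ?_) rfl)
    cases k <;> rfl
  have hbody : ∀ n p, ∃ s, (mstep c σ)^[s + 1] (L n p) =
      (if bad ((σ p).val :: regList n) then .rej else .loop,
        K'.elim (trList [if bad ((σ p).val :: regList n) then 0 else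
          Encodable.encode ((σ p).val :: regList n) + 1]) [] [] [], p + 1) := by
    intro n p
    obtain ⟨s, hs⟩ := mreach_body c σ p n _ (hc _ n)
    refine ⟨s, ?_⟩
    rw [Function.iterate_succ_apply]
    have h1 : mstep c σ (L n p) =
        (.pushing (trNat (σ p).val ++ [Γ'.cons]).reverse, K'.elim (trList [n]) [] [] [], p + 1) := by
      refine Prod.ext rfl (Prod.ext (funext fun k => ?_) rfl)
      cases k <;> rfl
    rw [h1, hs]
    by_cases hb : bad ((σ p).val :: regList n) <;> simp [hb]
  have hloop : ∀ T, (∀ T' < T, ¬ bad (initRev σ (T' + 1))) →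
      ∃ s n, T ≤ s ∧ (mstep c σ)^[s] x0 = L n T ∧ regList n = initRev σ T := by
    intro T
    induction T with
    | zero => exact fun _ => ⟨1, 0, Nat.zero_le _, hstart, 
      (show regList 0 = regList 1 from rfl).trans (regList_encode [])⟩
    | succ T ih =>
      intro hT
      obtain ⟨s, n, hs, hsn, hn⟩ := ih fun T' hT' => hT T' (by omega)
      obtain ⟨s', hs'⟩ := hbody n T
      have hb := hT T (Nat.lt_succ_self T)
      rw [initRev_succ, ← hn] at hb
      refine ⟨s' + 1 + s, Encodable.encode ((σ T).val :: regList n) + 1, by omega, ?_, ?_⟩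
      · rw [Function.iterate_add_apply, hsn, hs']
        simp only [hb, if_false, L]
      · rw [regList_encode, initRev_succ, hn]
  constructor
  · intro h
    by_contra! hT
    classical
    obtain ⟨s, n, -, hsn, hn⟩ := hloop (Nat.find hT) fun T' hT' => Nat.find_min hT hT'
    have hb := Nat.find_spec hT
    rw [initRev_succ, ← hn] at hb
    obtain ⟨s', hs'⟩ := hbody n (Nat.find hT)
    refine h (s' + 1 + s) ?_
    rw [Function.iterate_add_apply, hsn, hs']
    simp [hb, wAM]
  · intro h s hs
    obtain ⟨s', n, hss', hs', -⟩ := hloop s fun T' _ => h T'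
    have := absorb (s' - s) _ hs
    rw [← Function.iterate_add_apply, Nat.sub_add_cancel hss', hs'] at this
    cases this

theorem exists_code_of_computable {f : ℕ → ℕ → ℕ} (hf : Computable₂ f) :
    ∃ c : Code, ∀ a n, c.eval [a, n] = pure [f a n] := by
  obtain ⟨c, hc⟩ := Code.exists_code (Nat.Partrec'.part_iff₂.2 hf.partrec₂)
  refine ⟨c, fun a n => ?_⟩
  have := hc (a ::ᵥ n ::ᵥ List.Vector.nil)
  rw [show (a ::ᵥ n ::ᵥ List.Vector.nil).1 = [a, n] from rfl] at this
  rw [this]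
  rfl

/-- The states occurring in runs of the stream-feeding machine. -/
def wStates (c : Code) : Set WState :=
  {.start, .loop, .rej} ∪ WState.pushing '' {l | l.length ≤ 10} ∪
    Set.image2 WState.sim
      {q | some q ∈ TM2.stmts tr (codeSupp c Cont'.halt) ∨ q = TM2.Stmt.halt} Set.univ

instance : Finite K' :=
  Finite.of_injective (fun k => match k with
    | K'.main => (0 : Fin 4) | K'.rev => 1 | K'.aux => 2 | K'.stack => 3)
    (by intro a b; cases a <;> cases b <;> simp)

theorem wStates_finite (c : Code) : (wStates c).Finite := by
  classical
  refine Set.Finite.union (Set.Finite.union (Set.toFinite _) ?_) ?_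
  · exact (List.finite_length_le _ _).image _
  · refine Set.Finite.image2 _ ?_ (Set.toFinite _)
    have : {q | some q ∈ TM2.stmts tr (codeSupp c Cont'.halt) ∨ q = TM2.Stmt.halt} ⊆
        (Option.some ⁻¹' (TM2.stmts tr (codeSupp c Cont'.halt) : Set (Option PStmt))) ∪
          {TM2.Stmt.halt} := by
      rintro q (h | h)
      · exact Or.inl h
      · exact Or.inr h
    exact ((Finset.finite_toSet _).preimage (Option.some_injective _).injOn |>.union
      (Set.finite_singleton _)).subset this

theorem sim_mem_wStates {c : Code} {q : PStmt} {v : Option Γ'} :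
    WState.sim q v ∈ wStates c ↔
      some q ∈ TM2.stmts tr (codeSupp c Cont'.halt) ∨ q = TM2.Stmt.halt := by
  simp [wStates]

theorem pushing_mem_wStates {c : Code} {l : List Γ'} :
    WState.pushing l ∈ wStates c ↔ l.length ≤ 10 := by
  simp [wStates]

theorem tr_mem_stmts {c : Code} {l : Λ'} (hl : l ∈ codeSupp c Cont'.halt) :
    some (tr l) ∈ TM2.stmts tr (codeSupp c Cont'.halt) := by
  classical
  exact Finset.some_mem_insertNone.2 (Finset.mem_biUnion.2 ⟨l, hl, TM2.stmts₁_self⟩)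

theorem wStates_closed (c : Code) (q : WState) (hq : q ∈ wStates c)
    (t : (K' → Option Γ') × ZMod 5) : wnext c q t ∈ wStates c := by
  have hsup := tr_supports c Cont'.halt
  have sub : ∀ {q₁ q₂ : PStmt}, q₁ ∈ TM2.stmts₁ q₂ → some q₂ ∈ TM2.stmts tr (codeSupp c Cont'.halt) →
      some q₁ ∈ TM2.stmts tr (codeSupp c Cont'.halt) := fun h => TM2.stmts_trans h
  rcases q with _ | _ | l | ⟨q, v⟩ | _
  · simp [wnext, wStates]
  · rw [wnext, pushing_mem_wStates]
    have : ∀ a : ZMod 5, (trNat a.val ++ [Γ'.cons]).reverse.length ≤ 10 := by decide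
    exact this t.2
  · rw [pushing_mem_wStates] at hq
    rcases l with _ | ⟨γ, l⟩
    · exact sim_mem_wStates.2 (Or.inl (tr_mem_stmts hsup.1))
    · exact pushing_mem_wStates.2 (by simp at hq; omega)
  · rw [sim_mem_wStates] at hq
    cases q with
    | push k f q =>
      refine sim_mem_wStates.2 (Or.inl (sub ?_ (hq.resolve_right (by simp))))
      simp [TM2.stmts₁, TM2.stmts₁_self]
    | peek k f q =>
      refine sim_mem_wStates.2 (Or.inl (sub ?_ (hq.resolve_right (by simp))))
      simp [TM2.stmts₁, TM2.stmts₁_self]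
    | pop k f q =>
      refine sim_mem_wStates.2 (Or.inl (sub ?_ (hq.resolve_right (by simp))))
      simp [TM2.stmts₁, TM2.stmts₁_self]
    | load f q =>
      refine sim_mem_wStates.2 (Or.inl (sub ?_ (hq.resolve_right (by simp))))
      simp [TM2.stmts₁, TM2.stmts₁_self]
    | branch f q₁ q₂ =>
      refine sim_mem_wStates.2 (Or.inl (sub ?_ (hq.resolve_right (by simp))))
      cases f v <;> simp [TM2.stmts₁, TM2.stmts₁_self]
    | goto f =>
      have h := hq.resolve_right (by simp)
      exact sim_mem_wStates.2 (Or.inl (tr_mem_stmts (@TM2.stmts_supportsStmt _ _ _ _ ⟨trNormal c Cont'.halt⟩ _ _ _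
        hsup h v)))
    | halt =>
      rw [wnext]
      split_ifs <;> simp [wStates]
  · simp [wnext, wStates]

theorem exists_am (bad : List ℕ → Prop) (hbad : ComputablePred bad) :
    ∃ (Q C : Type) (_ : Finite Q) (_ : Finite C) (M : AM Q C), ∀ σ : ℕ → ZMod 5,
      (∀ s, (M.run σ s).1 ∉ M.rej) ↔ ∀ T, ¬ bad (initRev σ (T + 1)) := by
  obtain ⟨_, hb⟩ := hbad
  have hreg : Computable₂ fun a n : ℕ => a :: regList n := by
    refine Computable.list_cons.comp Computable.fst ?_
    have : Primrec fun n : ℕ => regList n := by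
      unfold regList
      exact Primrec.option_getD.comp (Primrec.decode.comp Primrec.pred) (Primrec.const [])
    exact this.to_comp.comp Computable.snd
  have hG : Computable₂ fun a n : ℕ => if bad (a :: regList n) then 0 else
      Encodable.encode (a :: regList n) + 1 := by
    have := Computable.cond (hb.comp hreg) (Computable.const 0)
      (Computable.succ.comp (Computable.encode.comp hreg))
    refine this.of_eq fun x => ?_
    by_cases h : bad (x.1 :: regList x.2) <;> simp [h]
  obtain ⟨c, hc⟩ := exists_code_of_computable hG
  refine ⟨wStates c, _, (wStates_finite c).to_subtype, inferInstance,
    (wAM c).restrict (wStates c) (by simp [wAM, wStates]) (wStates_closed c), fun σ => ?_⟩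
  rw [← wAM_never_rejects_iff c bad hc σ]
  refine forall_congr' fun s => ?_
  rw [AM.restrict_run (wAM c) (wStates c) (by simp [wAM, wStates]) (wStates_closed c) σ s]
  rfl

end HEnt

namespace HEnt

/-- The base-`5` digit of an integer at position `n`. -/
def dig (n : ℕ) (x : ℤ) : ZMod 5 := ((x / 5 ^ n : ℤ) : ZMod 5)

/-- `m` is the first position at which a base-`5` digit of `x` equals `1`. -/
def IsRank (m : ℕ) (x : ℤ) : Prop := dig m x = 1 ∧ ∀ i < m, dig i x ≠ 1

/-- The increasing enumeration of the naturals with no base-`5` digit equal to `1`. -/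
def fr (t : ℕ) : ℕ :=
  if h : t = 0 then 0 else 5 * fr (t / 4) + (if t % 4 = 0 then 0 else t % 4 + 1)
decreasing_by omega

theorem fr_zero : fr 0 = 0 := by rw [fr]; simp

theorem fr_eq (t : ℕ) : fr t = 5 * fr (t / 4) + (if t % 4 = 0 then 0 else t % 4 + 1) := by
  by_cases h : t = 0
  · subst h; simp [fr_zero]
  · conv_lhs => rw [fr]
    simp [h]

theorem fr_lt_succ (t : ℕ) : fr t < fr (t + 1) := by
  induction t using Nat.strong_induction_on with
  | _ t ih =>
    rw [fr_eq t, fr_eq (t + 1)]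
    by_cases h : (t + 1) % 4 = 0
    · have h1 : (t + 1) / 4 = t / 4 + 1 := by omega
      have h2 := ih (t / 4) (by omega)
      rw [h1]
      split_ifs <;> omega
    · have h1 : (t + 1) / 4 = t / 4 := by omega
      rw [h1]
      split_ifs <;> omega

theorem fr_strictMono : StrictMono fr := strictMono_nat_of_lt_succ fr_lt_succ

theorem dig_five_mul_add {n s : ℕ} (hs : s < 5) (x : ℤ) : dig (n + 1) (5 * x + s) = dig n x := by
  rw [dig, dig, pow_succ', ← Int.ediv_ediv_of_nonneg (by norm_num)]
  congr 3
  omega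

theorem dig_zero (x : ℤ) : dig 0 x = x := by simp [dig]

theorem dig_fr (n t : ℕ) : dig n (fr t) ≠ 1 := by
  induction n generalizing t with
  | zero =>
    rw [dig_zero, fr_eq]
    have h4 : t % 4 = 0 ∨ t % 4 = 1 ∨ t % 4 = 2 ∨ t % 4 = 3 := by omega
    rw [Int.cast_natCast, Nat.cast_add, Nat.cast_mul, show ((5 : ℕ) : ZMod 5) = 0 by decide,
      zero_mul, zero_add]
    rcases h4 with h | h | h | h <;> simp only [h] <;> decide
  | succ n ih =>
    rw [fr_eq]
    push_cast
    have := dig_five_mul_add (n := n) (s := if t % 4 = 0 then 0 else t % 4 + 1)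
      (by split_ifs <;> omega) (fr (t / 4))
    push_cast at this
    rw [this]
    exact ih _

theorem exists_fr_eq (n : ℕ) (h : ∀ i, dig i n ≠ 1) : ∃ t, fr t = n := by
  induction n using Nat.strong_induction_on with
  | _ n ih =>
    by_cases hn : n = 0
    · exact ⟨0, by rw [hn, fr_zero]⟩
    obtain ⟨t, ht⟩ := ih (n / 5) (by omega) fun i => by
      have h1 := dig_five_mul_add (n := i) (s := n % 5) (by omega) ((n / 5 : ℕ) : ℤ)
      rw [← h1]
      have : 5 * ((n / 5 : ℕ) : ℤ) + ((n % 5 : ℕ) : ℤ) = n := by exact_mod_cast Nat.div_add_mod n 5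
      rw [this]
      exact h _
    have h0 : n % 5 ≠ 1 := fun h1 => h 0 (by
      rw [dig_zero, Int.cast_natCast, ← ZMod.natCast_mod, h1]; rfl)
    refine ⟨4 * t + (n % 5 - 1), ?_⟩
    rw [fr_eq, show (4 * t + (n % 5 - 1)) / 4 = t by omega, ht]
    split_ifs <;> omega

theorem fr_pow (m : ℕ) : fr (4 ^ m) = 2 * 5 ^ m := by
  induction m with
  | zero => rw [fr_eq]; simp [fr_zero]
  | succ m ih =>
    rw [fr_eq, pow_succ, Nat.mul_div_cancel _ (by norm_num), Nat.mul_mod_left, ih]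
    simp [pow_succ]; ring

theorem fr_lt_pow {m t : ℕ} (h : t < 4 ^ m) : fr t < 5 ^ m := by
  induction m generalizing t with
  | zero =>
    obtain rfl : t = 0 := by simpa using h
    simp [fr_zero]
  | succ m ih =>
    have := ih (t := t / 4) (by rw [pow_succ] at h; omega)
    rw [fr_eq, pow_succ]
    split_ifs <;> omega

theorem exists_fr_eq_of_lt {m n : ℕ} (hn : n < 5 ^ m) (h : ∀ i < m, dig i n ≠ 1) :
    ∃ t < 4 ^ m, fr t = n := by
  obtain ⟨t, ht⟩ := exists_fr_eq n fun i => by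
    by_cases hi : i < m
    · exact h i hi
    · rw [dig, Int.ediv_eq_zero_of_lt (by positivity)]
      · decide
      · exact_mod_cast hn.trans_le (Nat.pow_le_pow_right (by norm_num) (by omega))
  refine ⟨t, ?_, ht⟩
  by_contra! hc
  have := fr_strictMono.monotone hc
  rw [fr_pow] at this
  have : 0 < 5 ^ m := by positivity
  omega

theorem dig_pow_add {i m : ℕ} (hi : i < m) (q x : ℤ) : dig i (5 ^ m * q + x) = dig i x := by
  obtain ⟨k, rfl⟩ := Nat.exists_eq_add_of_lt hi
  rw [dig, dig, show (5 : ℤ) ^ (i + k + 1) * q + x = 5 ^ i * (5 * (5 ^ k * q)) + x by ring,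
    Int.add_comm, Int.add_mul_ediv_left _ _ (by positivity)]
  push_cast
  rw [show (5 : ZMod 5) = 0 by decide]; ring

theorem dig_pow_add_self {m : ℕ} (q : ℤ) {x : ℕ} (hx : x < 5 ^ m) : dig m (5 ^ m * q + x) = q := by
  rw [dig, Int.add_comm, Int.add_mul_ediv_left _ _ (by positivity), Int.ediv_eq_zero_of_lt
    (by positivity) (by exact_mod_cast hx), zero_add]

theorem isRank_board {m t : ℕ} (ht : t < 4 ^ m) : IsRank m (5 ^ m + fr t) := by
  constructor
  · simpa using dig_pow_add_self 1 (fr_lt_pow ht)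
  · intro i hi
    have := dig_pow_add hi 1 (fr t)
    rw [mul_one] at this
    rw [this]
    exact dig_fr _ _

/-- Cells of the board which are not enumerated by `fr` have smaller rank. -/
theorem exists_isRank_lt {m n : ℕ} (hn : n < 5 ^ m) (h : ∀ t < 4 ^ m, fr t ≠ n) :
    ∃ m' < m, IsRank m' (5 ^ m + n) := by
  have h1 : ∃ i, i < m ∧ dig i n = 1 := by
    by_contra! hc
    obtain ⟨t, ht, htn⟩ := exists_fr_eq_of_lt hn fun i hi => hc i hi
    exact h t ht htn
  classical
  refine ⟨Nat.find h1, (Nat.find_spec h1).1, ?_, fun i hi => ?_⟩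
  · have := dig_pow_add (Nat.find_spec h1).1 1 (n : ℤ)
    rw [mul_one] at this
    rw [this]
    exact (Nat.find_spec h1).2
  · have him := hi.trans (Nat.find_spec h1).1
    have := dig_pow_add him 1 (n : ℤ)
    rw [mul_one] at this
    rw [this]
    exact fun hc => Nat.find_min h1 hi ⟨him, hc⟩

theorem IsRank.unique {m m' : ℕ} {x : ℤ} (h : IsRank m x) (h' : IsRank m' x) : m = m' := by
  rcases lt_trichotomy m m' with hlt | he | hlt
  · exact absurd h.1 (h'.2 m hlt)
  · exact he
  · exact absurd h'.1 (h.2 m' hlt)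

/-- The stream read by the automaton when the columns of level `r` carry the symbol `a r`. -/
def strm (a : ℕ → ZMod 5) (t : ℕ) : ZMod 5 := if t = 0 then 0 else a (padicValNat 5 (fr t))

theorem strm_pow (a : ℕ → ZMod 5) (r : ℕ) : strm a (4 ^ r) = a r := by
  have : Fact (Nat.Prime 5) := ⟨by norm_num⟩
  rw [strm, if_neg (by positivity), fr_pow, padicValNat.mul (by norm_num) (by positivity),
    padicValNat.prime_pow, padicValNat.eq_zero_of_not_dvd (by norm_num), zero_add]

/-- Tiles: skeleton data, level symbols `b` (columns) and `b'` (rows), segment states of the row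
and column, and signals carried along rows and columns. -/
structure Tile (Q C : Type) where
  A : Ordering
  d : ZMod 5
  e : ZMod 5
  R : ZMod 5
  U : ZMod 5
  b : ZMod 5
  b' : ZMod 5
  row : Bool × Bool
  col : Bool × Bool
  h : Option (Q × C × Option C × C × C)
  v : Option (Q × C)

instance {Q C : Type} [Finite Q] [Finite C] : Finite (Tile Q C) := by
  have : Finite Ordering := Finite.of_injective (fun o : Ordering => match o with
    | .lt => (0 : Fin 3) | .eq => 1 | .gt => 2) (by intro a b; cases a <;> cases b <;> simp)
  refine Finite.of_injective (fun t : Tile Q C =>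
    (t.A, t.d, t.e, t.R, t.U, t.b, t.b', t.row, t.col, t.h, t.v)) ?_
  rintro ⟨⟩ ⟨⟩ h
  simpa using h

/-- The segment state of cells strictly inside a board. -/
def inner : Bool × Bool := (true, false)

/-- Horizontal rules: `a` is the left neighbour of `b`. -/
structure HRule {Q C : Type} (M : AM Q C) (a b : Tile Q C) : Prop where
  d_ne : b.d ≠ 0
  lt_R : b.A = .lt → b.R = a.R
  eq_R : b.A = .eq → b.R = b.d ∧ b.d = a.R + 1
  gt_R : b.A = .gt → b.R = 0 ∧ a.R = 4
  e_eq : b.e = a.e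
  b'_eq : b.b' = a.b'
  b_eq : b.A = .eq → b.b = b.b'
  cross : b.U = 1 → (b.d = 1 ∨ b.d = 2) → a.row.2 = decide (b.d = 1) ∧ b.row.1 = decide (b.d = 1)
  pass : ¬ (b.U = 1 ∧ (b.d = 1 ∨ b.d = 2)) → b.row = a.row
  h_none : b.row ≠ inner → b.h = none
  h_pass : b.row = inner → b.col ≠ inner → b.h = a.h
  h_comp : b.row = inner → b.col = inner → ∃ q top l c r, b.h = some (q, top, l, c, r) ∧
    (a.h = none → l = none ∧ top = c) ∧
    (∀ q₁ top₁ l₁ c₁ r₁, a.h = some (q₁, top₁, l₁, c₁, r₁) →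
      q = q₁ ∧ top = top₁ ∧ l = some c₁ ∧ c = r₁)
  h_edge : b.row ≠ inner → ∀ q top l c r, a.h = some (q, top, l, c, r) → r = M.blank

/-- Vertical rules: `a` is the lower neighbour of `b`. -/
structure VRule {Q C : Type} (M : AM Q C) (a b : Tile Q C) : Prop where
  e_ne : b.e ≠ 0
  gt_U : b.A = .gt → b.U = a.U
  eq_U : b.A = .eq → b.U = b.e ∧ b.e = a.U + 1
  lt_U : b.A = .lt → b.U = 0 ∧ a.U = 4
  d_eq : b.d = a.d
  b_eq : b.b = a.b
  cross : b.R = 1 → (b.e = 1 ∨ b.e = 2) → a.col.2 = decide (b.e = 1) ∧ b.col.1 = decide (b.e = 1)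
  pass : ¬ (b.R = 1 ∧ (b.e = 1 ∨ b.e = 2)) → b.col = a.col
  v_none : b.col ≠ inner → b.v = none
  v_pass : b.col = inner → b.row ≠ inner → b.v = a.v
  v_comp : b.col = inner → b.row = inner → ∀ q top l c r, b.h = some (q, top, l, c, r) →
    (a.v = none → q = M.q0 ∧ c = M.ini (if b.A = .eq then 0 else b.b)) ∧
    (∀ q₁ c₁, a.v = some (q₁, c₁) → q = q₁ ∧ c = c₁) ∧
    q ∉ M.rej ∧ b.v = some (M.next q top, M.upd q top l c r)

/-- Valid tilings of the plane. -/
structure TValid {Q C : Type} (M : AM Q C) (z : ℤ → ℤ → Tile Q C) : Prop where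
  hr : ∀ x y, HRule M (z (x - 1) y) (z x y)
  vr : ∀ x y, VRule M (z x (y - 1)) (z x y)

/-- If a segment state changes only as prescribed at the multiples of `5 ^ m`, then the state is
inner exactly where the digit at position `m` is `1`. -/
theorem seg_inner_iff (m : ℕ) (p : ℤ → Bool × Bool) (cr : ℤ → Prop) (dv : ℤ → ZMod 5)
    (hcross : ∀ x, cr x → (p (x - 1)).2 = decide (dv x = 1) ∧ (p x).1 = decide (dv x = 1))
    (hpass : ∀ x, ¬ cr x → p x = p (x - 1))
    (hlow : ∀ x, ¬ (5 : ℤ) ^ m ∣ x → ¬ cr x)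
    (hlev : ∀ q : ℤ, (q : ZMod 5) ≠ 0 → (cr (5 ^ m * q) ↔ (q : ZMod 5) = 1 ∨ (q : ZMod 5) = 2) ∧
      dv (5 ^ m * q) = q) (x : ℤ) :
    p x = inner ↔ dig m x = 1 := by
  have hblock : ∀ (q : ℤ) (s : ℕ), s < 5 ^ m → p (5 ^ m * q + s) = p (5 ^ m * q) := by
    intro q s
    induction s with
    | zero => intro _; simp
    | succ s ih =>
      intro hs
      rw [← ih (by omega), hpass]
      · congr 1; push_cast; ring
      · refine hlow _ fun hd => ?_
        rw [dvd_add_right (dvd_mul_right _ _)] at hd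
        have := Nat.le_of_dvd (Nat.succ_pos s) (by exact_mod_cast hd)
        omega
  have hprev : ∀ q : ℤ, p (5 ^ m * q - 1) = p (5 ^ m * (q - 1)) := by
    intro q
    have h5 : 0 < 5 ^ m := by positivity
    have := hblock (q - 1) (5 ^ m - 1) (by omega)
    rw [← this]
    congr 1
    rw [Nat.cast_sub (by omega)]
    push_cast; ring
  obtain ⟨q, s, hs, rfl⟩ : ∃ (q : ℤ) (s : ℕ), s < 5 ^ m ∧ x = 5 ^ m * q + s := by
    have h5 : (0 : ℤ) < 5 ^ m := by positivity
    have h1 := Int.emod_nonneg x h5.ne'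
    have h2 := Int.emod_lt_of_pos x h5
    refine ⟨x / 5 ^ m, (x % 5 ^ m).toNat, ?_, ?_⟩
    · zify; rw [Int.toNat_of_nonneg h1]; exact h2
    · rw [Int.toNat_of_nonneg h1, Int.mul_ediv_add_emod]
  rw [hblock q s hs, dig_pow_add_self q hs]
  have at1 : ∀ q : ℤ, (q : ZMod 5) = 1 → (p (5 ^ m * (q - 1))).2 = true ∧ (p (5 ^ m * q)).1 = true := by
    intro q hq
    obtain ⟨c1, c2⟩ := hlev q (by rw [hq]; decide)
    have := hcross _ (c1.2 (Or.inl hq))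
    rw [c2, hq, hprev] at this
    simpa using this
  have at2 : ∀ q : ℤ, (q : ZMod 5) = 2 →
      (p (5 ^ m * (q - 1))).2 = false ∧ (p (5 ^ m * q)).1 = false := by
    intro q hq
    obtain ⟨c1, c2⟩ := hlev q (by rw [hq]; decide)
    have := hcross _ (c1.2 (Or.inr hq))
    rw [c2, hq, hprev] at this
    rw [this.1, this.2]
    decide
  have at3 : ∀ q : ℤ, (q : ZMod 5) = 3 ∨ (q : ZMod 5) = 4 → p (5 ^ m * q) = p (5 ^ m * (q - 1)) := by
    intro q hq
    rw [hpass, hprev]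
    have h0 : (q : ZMod 5) ≠ 0 := by rcases hq with h | h <;> rw [h] <;> decide
    rw [(hlev q h0).1]
    rcases hq with h | h <;> rw [h] <;> decide
  have cases5 : ∀ a : ZMod 5, a = 0 ∨ a = 1 ∨ a = 2 ∨ a = 3 ∨ a = 4 := by decide
  have h3 : ∀ q : ℤ, (q : ZMod 5) = 3 → (p (5 ^ m * q)).1 = false := fun q h => by
    rw [at3 q (Or.inl h)]
    exact (at2 (q - 1) (by push_cast; rw [h]; decide)).2
  rw [inner, Prod.ext_iff]
  rcases cases5 q with h | h | h | h | h
  · have := (at1 (q + 1) (by push_cast; rw [h]; decide)).1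
    rw [add_sub_cancel_right] at this
    rw [this, h]
    exact iff_of_false (by simp) (by decide)
  · have h2 := (at2 (q + 1) (by push_cast; rw [h]; decide)).1
    rw [add_sub_cancel_right] at h2
    simp [h, h2, (at1 q h).2]
  · rw [(at2 q h).2, h]
    exact iff_of_false (by simp) (by decide)
  · rw [h3 q h, h]
    exact iff_of_false (by simp) (by decide)
  · rw [at3 q (Or.inr h)]
    have := h3 (q - 1) (by push_cast; rw [h]; decide)
    rw [this, h]
    exact iff_of_false (by simp) (by decide)

theorem not_dvd_exists_lv {m : ℕ} {x : ℤ} (h : ¬ (5 : ℤ) ^ m ∣ x) : ∃ r < m, Lv r x := by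
  induction m with
  | zero => simp at h
  | succ m ih =>
    by_cases h' : (5 : ℤ) ^ m ∣ x
    · exact ⟨m, Nat.lt_succ_self m, h', h⟩
    · obtain ⟨r, hr, hx⟩ := ih h'
      exact ⟨r, hr.trans (Nat.lt_succ_self m), hx⟩

theorem lv_pow_mul {m : ℕ} {q : ℤ} (h : (q : ZMod 5) ≠ 0) : Lv m (5 ^ m * q) := by
  refine ⟨dvd_mul_right _ _, fun hd => h ?_⟩
  rw [pow_succ] at hd
  exact zmod5_eq_zero_iff.2 ((mul_dvd_mul_iff_left (by positivity)).1 hd)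

namespace TValid

variable {Q C : Type} {M : AM Q C} {z : ℤ → ℤ → Tile Q C}

theorem shift (h : TValid M z) (X Y : ℤ) : TValid M fun x y => z (x + X) (y + Y) where
  hr x y := by have := h.hr (x + X) (y + Y); rwa [add_sub_right_comm] at this
  vr x y := by have := h.vr (x + X) (y + Y); rwa [add_sub_right_comm] at this

theorem const_col {β : Type*} (f : ℤ → β) (h : ∀ y, f y = f (y - 1)) (y y' : ℤ) : f y = f y' := by
  have : ∀ y, f y = f 0 := fun y => by
    induction y using Int.induction_on with
    | zero => rfl
    | succ i ih => rw [h, add_sub_cancel_right, ih]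
    | pred i ih => rw [← ih, h (-i)]
  rw [this y, this y']

theorem d_const (h : TValid M z) (x y y' : ℤ) : (z x y).d = (z x y').d :=
  const_col (fun y => (z x y).d) (fun y => (h.vr x y).d_eq) y y'

theorem e_const (h : TValid M z) (x x' y : ℤ) : (z x y).e = (z x' y).e :=
  const_col (fun x => (z x y).e) (fun x => (h.hr x y).e_eq) x x'

theorem b_const (h : TValid M z) (x y y' : ℤ) : (z x y).b = (z x y').b :=
  const_col (fun y => (z x y).b) (fun y => (h.vr x y).b_eq) y y'

theorem b'_const (h : TValid M z) (x x' y : ℤ) : (z x y).b' = (z x' y).b' :=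
  const_col (fun x => (z x y).b') (fun x => (h.hr x y).b'_eq) x x'

theorem skelValid (h : TValid M z) : SkelValid (fun x y => (z x y).A) (fun x => (z x 0).d)
    (fun y => (z 0 y).e) (fun x y => (z x y).R) (fun x y => (z x y).U) where
  d_ne x := (h.hr x 0).d_ne
  e_ne y := (h.vr 0 y).e_ne
  lt_R x y hA := (h.hr x y).lt_R hA
  lt_U x y hA := ((h.vr x y).lt_U hA).1
  lt_U' x y hA := ((h.vr x y).lt_U hA).2
  eq_R x y hA := ((h.hr x y).eq_R hA).1.trans (h.d_const x y 0)
  eq_R' x y hA := (h.d_const x 0 y).trans ((h.hr x y).eq_R hA).2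
  eq_U x y hA := ((h.vr x y).eq_U hA).1.trans (h.e_const x 0 y)
  eq_U' x y hA := (h.e_const 0 x y).trans ((h.vr x y).eq_U hA).2
  gt_R x y hA := ((h.hr x y).gt_R hA).1
  gt_R' x y hA := ((h.hr x y).gt_R hA).2
  gt_U x y hA := (h.vr x y).gt_U hA

/-- The skeleton of a tiling is standard up to level `K`. -/
abbrev IsStd (K : ℕ) (z : ℤ → ℤ → Tile Q C) : Prop :=
  Std K (fun x y => (z x y).A) (fun x => (z x 0).d)
    (fun y => (z 0 y).e) (fun x y => (z x y).R) (fun x y => (z x y).U)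

theorem exists_isStd (h : TValid M z) (K : ℕ) :
    ∃ X Y : ℤ, IsStd K fun x y => z (x + X) (y + Y) := by
  obtain ⟨X, Y, hs⟩ := h.skelValid.exists_std K
  refine ⟨X, Y, ?_⟩
  rw [IsStd]
  have h1 : (fun x => (z (x + X) (0 + Y)).d) = fun x => (z (x + X) 0).d :=
    funext fun x => h.d_const _ _ _
  have h2 : (fun y => (z (0 + X) (y + Y)).e) = fun y => (z 0 (y + Y)).e :=
    funext fun x => h.e_const _ _ _
  rw [h1, h2]
  exact hs

variable {K : ℕ}

theorem row_inner_iff (h : TValid M z) (hs : IsStd K z) {m : ℕ} (hm : m < K) {y : ℤ}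
    (hy : IsRank m y) (x : ℤ) : (z x y).row = inner ↔ dig m x = 1 := by
  refine seg_inner_iff m (fun x => (z x y).row)
    (fun x => (z x y).U = 1 ∧ ((z x y).d = 1 ∨ (z x y).d = 2)) (fun x => (z x y).d)
    (fun x hx => (h.hr x y).cross hx.1 hx.2) (fun x hx => (h.hr x y).pass hx) ?_ ?_ x
  · intro x hx hc
    obtain ⟨r, hr, hl⟩ := not_dvd_exists_lv hx
    have := hs.U_eq r (hr.trans hm) x y hl
    exact hy.2 r hr (this.symm.trans hc.1)
  · intro q hq
    have hl := lv_pow_mul (m := m) hq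
    have hd := hs.d_eq m hm _ hl
    rw [Int.mul_ediv_cancel_left _ (by positivity), h.d_const _ 0 y] at hd
    have hU := hs.U_eq m hm _ y hl
    have hU' : (z (5 ^ m * q) y).U = 1 := hU.trans hy.1
    simp only [hU', hd, true_and, and_true]

theorem col_inner_iff (h : TValid M z) (hs : IsStd K z) {m : ℕ} (hm : m < K) {x : ℤ}
    (hx : IsRank m x) (y : ℤ) : (z x y).col = inner ↔ dig m y = 1 := by
  refine seg_inner_iff m (fun y => (z x y).col)
    (fun y => (z x y).R = 1 ∧ ((z x y).e = 1 ∨ (z x y).e = 2)) (fun y => (z x y).e)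
    (fun y hy => (h.vr x y).cross hy.1 hy.2) (fun y hy => (h.vr x y).pass hy) ?_ ?_ y
  · intro y hy hc
    obtain ⟨r, hr, hl⟩ := not_dvd_exists_lv hy
    have := hs.R_eq r (hr.trans hm) x y hl
    exact hx.2 r hr (this.symm.trans hc.1)
  · intro q hq
    have hl := lv_pow_mul (m := m) hq
    have hd := hs.e_eq m hm _ hl
    rw [Int.mul_ediv_cancel_left _ (by positivity), h.e_const 0 x] at hd
    have hU := hs.R_eq m hm x _ hl
    have hU' : (z x (5 ^ m * q)).R = 1 := hU.trans hx.1
    simp only [hU', hd, true_and, and_true]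

end TValid

/-- A quantity that does not change strictly between consecutive board positions. -/
theorem board_pass {β : Type*} (m : ℕ) (f : ℤ → β)
    (hf : ∀ n : ℕ, n < 5 ^ m → (∀ t < 4 ^ m, fr t ≠ n) → f (5 ^ m + n) = f (5 ^ m + n - 1))
    {t : ℕ} (n : ℕ) (hn : fr t ≤ n) (hn' : n < fr (t + 1)) (hnm : n < 5 ^ m) :
    f (5 ^ m + n) = f (5 ^ m + fr t) := by
  induction n with
  | zero => rw [Nat.le_zero.1 hn]
  | succ n ih =>
    by_cases hc : fr t = n + 1
    · rw [hc]
    · rw [hf (n + 1) hnm, ← ih (by omega) (by omega) (by omega)]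
      · congr 1; push_cast; ring
      · intro t' _ he
        have h1 : t < t' := fr_strictMono.lt_iff_lt.1 (by omega)
        have h2 : t' < t + 1 := fr_strictMono.lt_iff_lt.1 (by omega)
        omega

namespace TValid

variable {Q C : Type} {M : AM Q C} {z : ℤ → ℤ → Tile Q C} {K : ℕ}

theorem row_inner_board (h : TValid M z) (hs : IsStd K z) {m : ℕ} (hm : m < K) {s n : ℕ}
    (hms : s < 4 ^ m) (hn : n < 5 ^ m) : (z (5 ^ m + n) (5 ^ m + fr s)).row = inner := by
  rw [h.row_inner_iff hs hm (isRank_board hms)]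
  simpa using dig_pow_add_self 1 hn

theorem col_inner_board (h : TValid M z) (hs : IsStd K z) {m : ℕ} (hm : m < K) {s n : ℕ}
    (hms : s < 4 ^ m) (hn : n < 5 ^ m) : (z (5 ^ m + fr s) (5 ^ m + n)).col = inner := by
  rw [h.col_inner_iff hs hm (isRank_board hms)]
  simpa using dig_pow_add_self 1 hn

theorem h_pass_board (h : TValid M z) (hs : IsStd K z) {m : ℕ} (hm : m < K) {s : ℕ}
    (hms : s < 4 ^ m) (n : ℕ) (hn : n < 5 ^ m) (hfr : ∀ t < 4 ^ m, fr t ≠ n) :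
    (z (5 ^ m + n) (5 ^ m + fr s)).h = (z (5 ^ m + n - 1) (5 ^ m + fr s)).h := by
  refine (h.hr _ _).h_pass (h.row_inner_board hs hm hms hn) ?_
  obtain ⟨m', hm', hr⟩ := exists_isRank_lt hn hfr
  rw [Ne, h.col_inner_iff hs (hm'.trans hm) hr]
  exact (isRank_board hms).2 m' hm'

theorem v_pass_board (h : TValid M z) (hs : IsStd K z) {m : ℕ} (hm : m < K) {s : ℕ}
    (hms : s < 4 ^ m) (n : ℕ) (hn : n < 5 ^ m) (hfr : ∀ t < 4 ^ m, fr t ≠ n) :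
    (z (5 ^ m + fr s) (5 ^ m + n)).v = (z (5 ^ m + fr s) (5 ^ m + n - 1)).v := by
  refine (h.vr _ _).v_pass (h.col_inner_board hs hm hms hn) ?_
  obtain ⟨m', hm', hr⟩ := exists_isRank_lt hn hfr
  rw [Ne, h.row_inner_iff hs (hm'.trans hm) hr]
  exact (isRank_board hms).2 m' hm'

theorem h_prev (h : TValid M z) (hs : IsStd K z) {m : ℕ} (hm : m < K) {s t : ℕ}
    (hms : s < 4 ^ m) (hmt : t + 1 < 4 ^ m) :
    (z (5 ^ m + fr (t + 1) - 1) (5 ^ m + fr s)).h = (z (5 ^ m + fr t) (5 ^ m + fr s)).h := by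
  have h1 := fr_lt_succ t
  have h2 := fr_lt_pow hmt
  have := board_pass m (fun x => (z x (5 ^ m + fr s)).h) (h.h_pass_board hs hm hms) (t := t)
    (fr (t + 1) - 1) (by omega) (by omega) (by omega)
  rw [← this]
  congr 3
  rw [Nat.cast_sub (by omega)]; push_cast; ring

theorem v_prev (h : TValid M z) (hs : IsStd K z) {m : ℕ} (hm : m < K) {s t : ℕ}
    (hms : s < 4 ^ m) (hmt : t + 1 < 4 ^ m) :
    (z (5 ^ m + fr s) (5 ^ m + fr (t + 1) - 1)).v = (z (5 ^ m + fr s) (5 ^ m + fr t)).v := by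
  have h1 := fr_lt_succ t
  have h2 := fr_lt_pow hmt
  have := board_pass m (fun y => (z (5 ^ m + fr s) y).v) (h.v_pass_board hs hm hms) (t := t)
    (fr (t + 1) - 1) (by omega) (by omega) (by omega)
  rw [← this]
  congr 2
  rw [Nat.cast_sub (by omega)]; push_cast; ring

theorem dig_pow_sub_one (m : ℕ) : dig m (5 ^ m - 1) ≠ 1 := by
  rw [dig, Int.ediv_eq_zero_of_lt]
  · decide
  · have : (0 : ℤ) < 5 ^ m := by positivity
    omega
  · omega

theorem h_start (h : TValid M z) (hs : IsStd K z) {m : ℕ} (hm : m < K) {s : ℕ}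
    (hms : s < 4 ^ m) : (z (5 ^ m + fr 0 - 1) (5 ^ m + fr s)).h = none := by
  refine (h.hr _ _).h_none ?_
  rw [Ne, h.row_inner_iff hs hm (isRank_board hms), fr_zero]
  simpa using dig_pow_sub_one m

theorem v_start (h : TValid M z) (hs : IsStd K z) {m : ℕ} (hm : m < K) {s : ℕ}
    (hms : s < 4 ^ m) : (z (5 ^ m + fr s) (5 ^ m + fr 0 - 1)).v = none := by
  refine (h.vr _ _).v_none ?_
  rw [Ne, h.col_inner_iff hs hm (isRank_board hms), fr_zero]
  simpa using dig_pow_sub_one m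

theorem lv_board {m t : ℕ} (ht : t < 4 ^ m) (h0 : t ≠ 0) :
    padicValNat 5 (fr t) < m ∧ Lv (padicValNat 5 (fr t)) (5 ^ m + fr t) := by
  have : Fact (Nat.Prime 5) := ⟨by norm_num⟩
  have hpos : fr t ≠ 0 := by
    have := fr_strictMono (Nat.pos_of_ne_zero h0)
    rw [fr_zero] at this; omega
  have hd := pow_padicValNat_dvd (p := 5) (n := fr t)
  have hle := Nat.le_of_dvd (Nat.pos_of_ne_zero hpos) hd
  have hlt : padicValNat 5 (fr t) < m :=
    (Nat.pow_lt_pow_iff_right (by norm_num)).1 (hle.trans_lt (fr_lt_pow ht))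
  refine ⟨hlt, ?_, ?_⟩
  · exact dvd_add (pow_dvd_pow _ hlt.le) (by exact_mod_cast hd)
  · rw [dvd_add_right (pow_dvd_pow _ hlt)]
    exact_mod_cast pow_succ_padicValNat_not_dvd hpos

theorem board_row (h : TValid M z) (hs : IsStd K z) {m : ℕ} (hm : m < K) {s : ℕ}
    (hms : s < 4 ^ m) (q : Q) (c : ℕ → C)
    (hb : ∀ t, t + s < 4 ^ m → ∀ q' top l c' r,
      (z (5 ^ m + fr t) (5 ^ m + fr s)).h = some (q', top, l, c', r) → q' = q ∧ c' = c t) :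
    ∀ t, t + s < 4 ^ m → ∃ r, (z (5 ^ m + fr t) (5 ^ m + fr s)).h =
      some (q, c 0, if t = 0 then none else some (c (t - 1)), c t, r) ∧
      (t + s + 1 < 4 ^ m → r = c (t + 1)) := by
  have key : ∀ t, t + s < 4 ^ m → ∃ r, (z (5 ^ m + fr t) (5 ^ m + fr s)).h =
      some (q, c 0, if t = 0 then none else some (c (t - 1)), c t, r) := by
    intro t
    induction t with
    | zero =>
      intro ht
      have h0 : 0 < 4 ^ m := by positivity
      obtain ⟨q', top, l, c', r, h1, h2, -⟩ := (h.hr _ _).h_comp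
        (h.row_inner_board hs hm hms (fr_lt_pow h0)) (h.col_inner_board hs hm h0 (fr_lt_pow hms))
      obtain ⟨rfl, rfl⟩ := h2 (h.h_start hs hm hms)
      obtain ⟨rfl, rfl⟩ := hb 0 ht _ _ _ _ _ h1
      exact ⟨r, by simpa using h1⟩
    | succ t ih =>
      intro ht
      obtain ⟨r₀, h0⟩ := ih (by omega)
      obtain ⟨q', top, l, c', r, h1, -, h2⟩ := (h.hr _ _).h_comp
        (h.row_inner_board hs hm hms (fr_lt_pow (by omega : t + 1 < 4 ^ m)))
        (h.col_inner_board hs hm (by omega) (fr_lt_pow hms))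
      obtain ⟨rfl, rfl, rfl, rfl⟩ := h2 _ _ _ _ _ ((h.h_prev hs hm hms (by omega)).trans h0)
      obtain ⟨-, rfl⟩ := hb (t + 1) ht _ _ _ _ _ h1
      exact ⟨r, by simpa using h1⟩
  intro t ht
  obtain ⟨r, hr⟩ := key t ht
  refine ⟨r, hr, fun ht' => ?_⟩
  obtain ⟨q', top, l, c', r', h1, -, h2⟩ := (h.hr _ _).h_comp
    (h.row_inner_board hs hm hms (fr_lt_pow (by omega : t + 1 < 4 ^ m)))
    (h.col_inner_board hs hm (by omega) (fr_lt_pow hms))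
  obtain ⟨-, -, -, h3⟩ := h2 _ _ _ _ _ ((h.h_prev hs hm hms (by omega)).trans hr)
  obtain ⟨-, h4⟩ := hb (t + 1) (by omega) _ _ _ _ _ h1
  rw [← h3, h4]

theorem _root_.HEnt.AM.run_succ (M : AM Q C) (σ : ℕ → ZMod 5) (s : ℕ) :
    M.run σ (s + 1) = M.step (M.run σ s) := by
  simp only [AM.run, Function.iterate_succ_apply']

/-- The rows of a board simulate the automaton inside the light cone of the right edge. -/
theorem board_sound (h : TValid M z) (hs : IsStd K z) {a : ℕ → ZMod 5}
    (ha : ∀ r < K, ∀ x y, Lv r x → (z x y).b = a r) {m : ℕ} (hm : m < K) (s : ℕ)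
    (hms : s < 4 ^ m) : (M.run (strm a) s).1 ∉ M.rej ∧
      ∀ t, t + s + 1 < 4 ^ m → (z (5 ^ m + fr t) (5 ^ m + fr s)).v =
        some ((M.run (strm a) (s + 1)).1, (M.run (strm a) (s + 1)).2 t) := by
  have main : ∀ s < 4 ^ m, (∀ t, t + s < 4 ^ m → ∀ q' top l c' r,
      (z (5 ^ m + fr t) (5 ^ m + fr s)).h = some (q', top, l, c', r) →
        q' = (M.run (strm a) s).1 ∧ c' = (M.run (strm a) s).2 t) →
      (M.run (strm a) s).1 ∉ M.rej ∧
      ∀ t, t + s + 1 < 4 ^ m → (z (5 ^ m + fr t) (5 ^ m + fr s)).v =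
        some ((M.run (strm a) (s + 1)).1, (M.run (strm a) (s + 1)).2 t) := by
    intro s hms hb
    have hrow := h.board_row hs hm hms _ _ hb
    have hv := fun t (ht : t < 4 ^ m) => (h.vr _ _).v_comp
      (h.col_inner_board hs hm ht (fr_lt_pow hms)) (h.row_inner_board hs hm hms (fr_lt_pow ht))
    refine ⟨?_, fun t ht => ?_⟩
    · obtain ⟨r, hr, -⟩ := hrow 0 (by omega)
      exact (hv 0 (by omega) _ _ _ _ _ hr).2.2.1
    · obtain ⟨r, hr, hr'⟩ := hrow t (by omega)
      rw [(hv t (by omega) _ _ _ _ _ hr).2.2.2, hr' ht, AM.run_succ, AM.step]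
  have hcell : ∀ s < 4 ^ m, ∀ t, t + s < 4 ^ m → ∀ q' top l c' r,
      (z (5 ^ m + fr t) (5 ^ m + fr s)).h = some (q', top, l, c', r) → _ := fun s hms t ht =>
    (h.vr (5 ^ m + fr t) (5 ^ m + fr s)).v_comp
      (h.col_inner_board hs hm (by omega) (fr_lt_pow hms))
      (h.row_inner_board hs hm hms (fr_lt_pow (by omega)))
  induction s with
  | zero =>
    refine main 0 hms fun t ht q' top l c' r hh => ?_
    obtain ⟨rfl, rfl⟩ := (hcell 0 hms t ht _ _ _ _ _ hh).1 (h.v_start hs hm (by omega))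
    refine ⟨rfl, ?_⟩
    have hm0 : Lv m (5 ^ m : ℤ) := by
      have := lv_pow_mul (m := m) (q := 1) (by decide)
      rwa [mul_one] at this
    change _ = M.ini (strm a t)
    congr 1
    by_cases h0 : t = 0
    · subst h0
      rw [if_pos]
      · rfl
      · rw [fr_zero]
        exact hs.A_eq m hm _ _ (by simpa using hm0) (by simpa using hm0)
    · obtain ⟨h1, h2⟩ := lv_board (t := t) (by omega) h0
      rw [strm, if_neg h0, if_neg, ha _ (h1.trans hm) _ _ h2]
      have := hs.A_lt _ (h1.trans hm) _ (5 ^ m + fr 0) h2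
        (by rw [fr_zero]; simpa using pow_dvd_pow (5 : ℤ) h1)
      exact fun hc => absurd (this.symm.trans hc) (by decide)
  | succ s ih =>
    refine main (s + 1) hms fun t ht q' top l c' r hh => ?_
    have := (hcell (s + 1) hms t ht _ _ _ _ _ hh).2.1 _ _
      ((h.v_prev hs hm (by omega) hms).trans ((ih (by omega)).2 t (by omega)))
    exact this

theorem dvd_of_isStd {X Y X' Y' : ℤ} (h : TValid M z)
    (hs : IsStd K fun x y => z (x + X) (y + Y)) (hs' : IsStd K fun x y => z (x + X') (y + Y')) :
    ∀ r ≤ K, (5 : ℤ) ^ r ∣ X' - X := by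
  intro r
  induction r with
  | zero => simp
  | succ r ih =>
    intro hr
    obtain ⟨w, hw⟩ := ih (by omega)
    obtain ⟨s, h1, h2⟩ : ∃ s : ℤ, (s : ZMod 5) ≠ 0 ∧ ((s + w : ℤ) : ZMod 5) ≠ 0 := by
      by_cases hc : (w : ZMod 5) = 4
      · exact ⟨2, by decide, by push_cast; rw [hc]; decide⟩
      · refine ⟨1, by decide, fun h => hc ?_⟩
        push_cast at h
        revert h
        generalize (w : ZMod 5) = w
        revert w; decide
    have e1 := hs.d_eq r (by omega) _ (lv_pow_mul h2)
    have e2 := hs'.d_eq r (by omega) _ (lv_pow_mul h1)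
    rw [Int.mul_ediv_cancel_left _ (by positivity)] at e1 e2
    beta_reduce at e1 e2
    have : 5 ^ r * (s + w) + X = 5 ^ r * s + X' := by linear_combination -hw
    rw [this, h.d_const _ _ (0 + Y'), e2] at e1
    push_cast at e1
    have hw0 : (w : ZMod 5) = 0 := by simpa using e1
    obtain ⟨v, rfl⟩ := zmod5_eq_zero_iff.1 hw0
    exact ⟨v, by rw [hw]; ring⟩

theorem b_eq_of_lv (h : TValid M z) (hs : IsStd K z) {r : ℕ} (hr : r < K) {x x' : ℤ}
    (hx : Lv r x) (hx' : Lv r x') (y y' : ℤ) : (z x y).b = (z x' y').b := by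
  have h0 := lv_pow_mul (m := r) (q := 1) (by decide)
  have e := fun x (hx : Lv r x) => (h.hr x (5 ^ r * 1)).b_eq (hs.A_eq r hr x _ hx h0)
  rw [h.b_const x y (5 ^ r * 1), h.b_const x' y' (5 ^ r * 1), e x hx, e x' hx',
    h.b'_const x x']

/-- In a valid tiling the level symbols form a stream which the automaton never rejects. -/
theorem exists_digits (h : TValid M z) : ∃ a : ℕ → ZMod 5,
    (∀ K, ∃ X Y : ℤ, IsStd K (fun x y => z (x + X) (y + Y)) ∧
      ∀ r < K, ∀ x y, Lv r x → (z (x + X) (y + Y)).b = a r) ∧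
    ∀ s, (M.run (strm a) s).1 ∉ M.rej := by
  choose X Y hs using h.exists_isStd
  have hb : ∀ K, ∀ r < K, ∀ x y, Lv r x →
      (z (x + X K) (y + Y K)).b = (z (5 ^ r + X (r + 1)) 0).b := by
    intro K r hr x y hx
    obtain ⟨v, hv⟩ := (dvd_of_isStd (K := r + 1) h (X := X K) (Y := Y K)
      ⟨fun i hi => (hs K).d_eq i (by omega), fun i hi => (hs K).e_eq i (by omega),
        fun i hi => (hs K).A_eq i (by omega), fun i hi => (hs K).A_lt i (by omega),
        fun i hi => (hs K).A_gt i (by omega), fun i hi => (hs K).R_eq i (by omega),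
        fun i hi => (hs K).U_eq i (by omega)⟩ (hs (r + 1)) (r + 1) le_rfl)
    have hx' : Lv r (5 ^ r * (1 + 5 * v)) := lv_pow_mul (by
      push_cast; rw [show (5 : ZMod 5) = 0 by decide, zero_mul, add_zero]; decide)
    have e := (h.shift (X K) (Y K)).b_eq_of_lv (hs K) hr hx hx' y (-Y K)
    beta_reduce at e
    rw [e]
    congr 2
    · linear_combination -hv
    · ring
  refine ⟨fun r => (z (5 ^ r + X (r + 1)) 0).b, fun K => ⟨X K, Y K, hs K, hb K⟩, fun s => ?_⟩
  refine ((h.shift _ _).board_sound (hs (s + 1)) (hb (s + 1)) (m := s) (Nat.lt_succ_self s) s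
    (Nat.lt_pow_self (by norm_num))).1

end TValid

/-- `x` has level `r < n` and its leading digit is at most `a r`. -/
def Free (a : ℕ → ZMod 5) (n : ℕ) (x : ℤ) : Prop :=
  ∃ r < n, Lv r x ∧ ((x / 5 ^ r : ℤ) : ZMod 5).val ≤ (a r).val

theorem Lv.unique {r r' : ℕ} {x : ℤ} (h : Lv r x) (h' : Lv r' x) : r = r' := by
  rcases lt_trichotomy r r' with hlt | he | hlt
  · exact absurd ((pow_dvd_pow 5 hlt).trans h'.1) h.2
  · exact he
  · exact absurd ((pow_dvd_pow 5 hlt).trans h.1) h'.2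

theorem lv_digit_iff {n s : ℕ} (hs : s < 5) (hs0 : s ≠ 0) (x : ℤ) :
    (Lv n x ∧ ((x / 5 ^ n : ℤ) : ZMod 5).val = s) ↔ x ≡ s * 5 ^ n [ZMOD (5 ^ (n + 1) : ℤ)] := by
  rw [Int.modEq_comm, Int.modEq_iff_dvd]
  constructor
  · rintro ⟨⟨⟨q, rfl⟩, -⟩, h⟩
    rw [Int.mul_ediv_cancel_left _ (by positivity)] at h
    rw [show (5 : ℤ) ^ n * q - s * 5 ^ n = 5 ^ n * (q - s) by ring, pow_succ]
    refine mul_dvd_mul_left _ (zmod5_eq_zero_iff.1 ?_)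
    push_cast
    rw [← h, ZMod.natCast_zmod_val, sub_self]
  · rintro ⟨v, hv⟩
    obtain rfl : x = 5 ^ n * (s + 5 * v) := by rw [pow_succ] at hv; linear_combination hv
    have h1 : ((s + 5 * v : ℤ) : ZMod 5) = (s : ℕ) := by
      push_cast; rw [show (5 : ZMod 5) = 0 by decide]; simp
    have h2 : ((s : ℕ) : ZMod 5).val = s := ZMod.val_cast_of_lt hs
    refine ⟨lv_pow_mul ?_, ?_⟩
    · rw [h1]; intro h0; rw [h0] at h2; simp at h2; omega
    · rw [Int.mul_ediv_cancel_left _ (by positivity), h1, h2]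

open Classical in
theorem card_modEq {n j : ℕ} (hn : n ≤ j) (x₀ v : ℤ) :
    ((Finset.Ico x₀ (x₀ + 5 ^ j)).filter (fun x => x ≡ v [ZMOD (5 ^ n : ℤ)])).card =
      5 ^ (j - n) := by
  have := Int.Ico_filter_modEq_card x₀ (x₀ + 5 ^ j) (r := 5 ^ n) (by positivity) v
  zify
  convert this
  have h1 : ((x₀ + 5 ^ j : ℤ) - v : ℚ) / ((5 ^ n : ℤ) : ℚ) =
      (x₀ - v : ℚ) / ((5 ^ n : ℤ) : ℚ) + ((5 ^ (j - n) : ℤ) : ℚ) := by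
    push_cast
    rw [pow_sub₀ _ (by norm_num) hn]
    field_simp
    ring
  rw [h1, Int.ceil_add_intCast, add_sub_cancel_left, max_eq_left (by positivity)]

open Classical in
theorem card_free (a : ℕ → ZMod 5) {n j : ℕ} (hn : n ≤ j) (x₀ : ℤ) :
    ((Finset.Ico x₀ (x₀ + 5 ^ j)).filter (Free a n)).card =
      ∑ r ∈ Finset.range n, (a r).val * 5 ^ (j - 1 - r) := by
  induction n with
  | zero => simp [Free]
  | succ n ih =>
    have hlt : ∀ s ∈ Finset.Icc 1 (a n).val, s < 5 ∧ s ≠ 0 := fun s hs => by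
      have := ZMod.val_lt (a n)
      rw [Finset.mem_Icc] at hs
      omega
    have hU : (Finset.Ico x₀ (x₀ + 5 ^ j)).filter (Free a (n + 1)) =
        (Finset.Ico x₀ (x₀ + 5 ^ j)).filter (Free a n) ∪
        (Finset.Icc 1 (a n).val).biUnion fun s =>
          (Finset.Ico x₀ (x₀ + 5 ^ j)).filter (fun x => x ≡ s * 5 ^ n [ZMOD (5 ^ (n + 1) : ℤ)]) := by
      ext x
      simp only [Finset.mem_union, Finset.mem_biUnion, Finset.mem_filter]
      constructor
      · rintro ⟨hx, r, hr, h1, h2⟩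
        rcases Nat.lt_succ_iff_lt_or_eq.1 hr with hr | rfl
        · exact Or.inl ⟨hx, r, hr, h1, h2⟩
        · obtain ⟨q, hq⟩ := h1.1
          have h0 : ((x / 5 ^ r : ℤ) : ZMod 5).val ∈ Finset.Icc 1 (a r).val := by
            refine Finset.mem_Icc.2 ⟨Nat.one_le_iff_ne_zero.2 fun h0 => h1.2 ?_, h2⟩
            rw [ZMod.val_eq_zero, zmod5_eq_zero_iff] at h0
            rw [pow_succ]
            rw [hq]
            refine mul_dvd_mul_left _ ?_
            rwa [hq, Int.mul_ediv_cancel_left _ (by positivity)] at h0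
          exact Or.inr ⟨_, h0, hx, (lv_digit_iff (hlt _ h0).1 (hlt _ h0).2 x).1 ⟨h1, rfl⟩⟩
      · rintro (⟨hx, r, hr, h1, h2⟩ | ⟨s, hs, hx, h⟩)
        · exact ⟨hx, r, by omega, h1, h2⟩
        · obtain ⟨h1, h2⟩ := (lv_digit_iff (hlt _ hs).1 (hlt _ hs).2 x).2 h
          exact ⟨hx, n, Nat.lt_succ_self n, h1, h2.trans_le (Finset.mem_Icc.1 hs).2⟩
    rw [Finset.sum_range_succ, ← ih (by omega), hU, Finset.card_union_of_disjoint,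
      Finset.card_biUnion]
    · rw [Finset.sum_congr rfl fun s _ => card_modEq hn x₀ _]
      simp [Nat.sub_sub, add_comm]
    · intro s hs s' hs' hne
      refine Finset.disjoint_left.2 fun x hx hx' => hne ?_
      rw [Finset.mem_filter] at hx hx'
      rw [← ((lv_digit_iff (hlt _ hs).1 (hlt _ hs).2 x).2 hx.2).2,
        ← ((lv_digit_iff (hlt _ hs').1 (hlt _ hs').2 x).2 hx'.2).2]
    · refine Finset.disjoint_left.2 fun x hx hx' => ?_
      simp only [Finset.mem_biUnion, Finset.mem_filter] at hx hx'
      obtain ⟨s, hs, -, hx'⟩ := hx'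
      obtain ⟨-, r, hr, h1, -⟩ := hx
      have := Lv.unique h1 ((lv_digit_iff (hlt _ hs).1 (hlt _ hs).2 x).2 hx').1
      omega

end HEnt

namespace HEnt

namespace TValid

variable {Q C : Type} {M : AM Q C} {z z' : ℤ → ℤ → Tile Q C}

/-- The part of a row signal which is known before the right neighbour is seen. -/
def leftPart (h : Option (Q × C × Option C × C × C)) : Option (Q × C × Option C × C) :=
  h.map fun p => (p.1, p.2.1, p.2.2.1, p.2.2.2.1)

theorem leftPart_some {h : Option (Q × C × Option C × C × C)} {q top l c r}
    {h' : Option (Q × C × Option C × C × C)} (he : leftPart h = leftPart h')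
    (hh : h = some (q, top, l, c, r)) : ∃ r', h' = some (q, top, l, c, r') := by
  subst hh
  rcases h' with _ | ⟨q', top', l', c', r'⟩
  · simp [leftPart] at he
  · simp only [leftPart, Option.map_some, Option.some.injEq, Prod.mk.injEq] at he
    obtain ⟨rfl, rfl, rfl, rfl⟩ := he
    exact ⟨r', rfl⟩

theorem leftPart_none {h h' : Option (Q × C × Option C × C × C)} (he : leftPart h = leftPart h')
    (hh : h = none) : h' = none := by
  subst hh
  rcases h' with _ | h'
  · rfl
  · simp [leftPart] at he

theorem tile_eq {s t : Tile Q C} (hA : s.A = t.A) (hd : s.d = t.d) (he : s.e = t.e) (hR : s.R = t.R)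
    (hU : s.U = t.U) (hb : s.b = t.b) (hb' : s.b' = t.b') (hrow : s.row = t.row)
    (hcol : s.col = t.col) (hh : s.h = t.h) (hv : s.v = t.v) : s = t := by
  cases s; cases t; simp_all

/-- Left-to-right propagation along an interval. -/
theorem prop_up {P : ℤ → Prop} {x₀ x₁ : ℤ} (h : ∀ x, x₀ ≤ x → x < x₁ → (x₀ < x → P (x - 1)) → P x)
    (x : ℤ) (hx : x₀ ≤ x) (hx' : x < x₁) : P x := by
  obtain ⟨n, rfl⟩ := Int.le.dest hx
  induction n with
  | zero => exact h _ hx hx' fun hc => by simp at hc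
  | succ n ih =>
    refine h _ hx hx' fun _ => ?_
    have := ih (by omega) (by push_cast at hx'; omega)
    convert this using 1
    push_cast; ring

/-- Right-to-left propagation along an interval. -/
theorem prop_down {P : ℤ → Prop} {x₀ x₁ : ℤ}
    (h : ∀ x, x₀ ≤ x → x < x₁ → (x + 1 < x₁ → P (x + 1)) → P x)
    (x : ℤ) (hx : x₀ ≤ x) (hx' : x < x₁) : P x := by
  have := prop_up (P := fun x => P (-x)) (x₀ := 1 - x₁) (x₁ := 1 - x₀)
    (fun x h1 h2 h3 => h (-x) (by omega) (by omega) fun h4 => by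
      have := h3 (by omega)
      rwa [neg_sub, sub_eq_neg_add, add_comm, add_comm, neg_add_eq_sub, sub_eq_neg_add] at this)
    (-x) (by omega) (by omega)
  rwa [neg_neg] at this

/-- The tiles of a window are determined by those on its border together with the skeleton. -/
theorem determined (hz : TValid M z) (hz' : TValid M z') {x₀ x₁ y₀ y₁ : ℤ}
    (hs : ∀ x y, x₀ ≤ x → x < x₁ → y₀ ≤ y → y < y₁ → z x y = z' x y ∨
      (x₀ < x ∧ x + 1 < x₁ ∧ y₀ < y ∧ y + 1 < y₁ ∧ (z x y).A = (z' x y).A ∧ (z x y).d = (z' x y).d ∧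
        (z x y).e = (z' x y).e ∧ (z x y).R = (z' x y).R ∧ (z x y).U = (z' x y).U)) :
    ∀ x y, x₀ ≤ x → x < x₁ → y₀ ≤ y → y < y₁ → z x y = z' x y := by
  have hskel : ∀ x y, x₀ ≤ x → x < x₁ → y₀ ≤ y → y < y₁ →
      (z x y).A = (z' x y).A ∧ (z x y).d = (z' x y).d ∧
        (z x y).e = (z' x y).e ∧ (z x y).R = (z' x y).R ∧ (z x y).U = (z' x y).U := by
    intro x y h1 h2 h3 h4
    rcases hs x y h1 h2 h3 h4 with h | h
    · rw [h]; exact ⟨rfl, rfl, rfl, rfl, rfl⟩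
    · exact h.2.2.2.2
  have hb : ∀ x y, x₀ ≤ x → x < x₁ → y₀ ≤ y → y < y₁ → (z x y).b = (z' x y).b := by
    intro x y h1 h2 h3 h4
    rcases hs x y₀ h1 h2 le_rfl (h3.trans_lt h4) with h | h
    · rw [hz.b_const x y y₀, hz'.b_const x y y₀, h]
    · exact absurd h.2.2.1 (lt_irrefl _)
  have hb' : ∀ x y, x₀ ≤ x → x < x₁ → y₀ ≤ y → y < y₁ → (z x y).b' = (z' x y).b' := by
    intro x y h1 h2 h3 h4
    rcases hs x₀ y le_rfl (h1.trans_lt h2) h3 h4 with h | h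
    · rw [hz.b'_const x x₀ y, hz'.b'_const x x₀ y, h]
    · exact absurd h.1 (lt_irrefl _)
  have hrow1 : ∀ x y, x₀ ≤ x → x < x₁ → y₀ ≤ y → y < y₁ → (z x y).row.1 = (z' x y).row.1 := by
    intro x y h1 h2 h3 h4
    refine prop_up (P := fun x => (z x y).row.1 = (z' x y).row.1) (fun x h1 h2 ih => ?_) x h1 h2
    rcases hs x y h1 h2 h3 h4 with h | ⟨hx, -, -, -, -, hd, -, -, hU⟩
    · rw [h]
    · by_cases hc : (z x y).U = 1 ∧ ((z x y).d = 1 ∨ (z x y).d = 2)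
      · rw [((hz.hr x y).cross hc.1 hc.2).2]
        rw [hU, hd] at hc
        rw [((hz'.hr x y).cross hc.1 hc.2).2, hd]
      · rw [(hz.hr x y).pass hc]
        rw [hU, hd] at hc
        rw [(hz'.hr x y).pass hc, ih hx]
  have hrow2 : ∀ x y, x₀ ≤ x → x < x₁ → y₀ ≤ y → y < y₁ → (z x y).row.2 = (z' x y).row.2 := by
    intro x y h1 h2 h3 h4
    refine prop_down (P := fun x => (z x y).row.2 = (z' x y).row.2) (fun x h1 h2 ih => ?_) x h1 h2
    rcases hs x y h1 h2 h3 h4 with h | ⟨hx, hx1, -⟩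
    · rw [h]
    · obtain ⟨-, hd, -, -, hU⟩ := hskel (x + 1) y (by omega) hx1 h3 h4
      have e := (hz.hr (x + 1) y)
      have e' := (hz'.hr (x + 1) y)
      rw [add_sub_cancel_right] at e e'
      by_cases hc : (z (x + 1) y).U = 1 ∧ ((z (x + 1) y).d = 1 ∨ (z (x + 1) y).d = 2)
      · rw [(e.cross hc.1 hc.2).1]
        rw [hU, hd] at hc
        rw [(e'.cross hc.1 hc.2).1, hd]
      · rw [← e.pass hc]
        rw [hU, hd] at hc
        rw [← e'.pass hc, ih hx1]
  have hrow : ∀ x y, x₀ ≤ x → x < x₁ → y₀ ≤ y → y < y₁ → (z x y).row = (z' x y).row :=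
    fun x y h1 h2 h3 h4 => Prod.ext (hrow1 x y h1 h2 h3 h4) (hrow2 x y h1 h2 h3 h4)
  have hcol1 : ∀ x y, x₀ ≤ x → x < x₁ → y₀ ≤ y → y < y₁ → (z x y).col.1 = (z' x y).col.1 := by
    intro x y h1 h2 h3 h4
    refine prop_up (P := fun y => (z x y).col.1 = (z' x y).col.1) (fun y h3 h4 ih => ?_) y h3 h4
    rcases hs x y h1 h2 h3 h4 with h | ⟨-, -, hy, -, -, -, hd, hU, -⟩
    · rw [h]
    · by_cases hc : (z x y).R = 1 ∧ ((z x y).e = 1 ∨ (z x y).e = 2)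
      · rw [((hz.vr x y).cross hc.1 hc.2).2]
        rw [hU, hd] at hc
        rw [((hz'.vr x y).cross hc.1 hc.2).2, hd]
      · rw [(hz.vr x y).pass hc]
        rw [hU, hd] at hc
        rw [(hz'.vr x y).pass hc, ih hy]
  have hcol2 : ∀ x y, x₀ ≤ x → x < x₁ → y₀ ≤ y → y < y₁ → (z x y).col.2 = (z' x y).col.2 := by
    intro x y h1 h2 h3 h4
    refine prop_down (P := fun y => (z x y).col.2 = (z' x y).col.2) (fun y h3 h4 ih => ?_) y h3 h4
    rcases hs x y h1 h2 h3 h4 with h | ⟨-, -, -, hy1, -⟩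
    · rw [h]
    · obtain ⟨-, -, hd, hU, -⟩ := hskel x (y + 1) h1 h2 (by omega) hy1
      have e := (hz.vr x (y + 1))
      have e' := (hz'.vr x (y + 1))
      rw [add_sub_cancel_right] at e e'
      by_cases hc : (z x (y + 1)).R = 1 ∧ ((z x (y + 1)).e = 1 ∨ (z x (y + 1)).e = 2)
      · rw [(e.cross hc.1 hc.2).1]
        rw [hU, hd] at hc
        rw [(e'.cross hc.1 hc.2).1, hd]
      · rw [← e.pass hc]
        rw [hU, hd] at hc
        rw [← e'.pass hc, ih hy1]
  have hcol : ∀ x y, x₀ ≤ x → x < x₁ → y₀ ≤ y → y < y₁ → (z x y).col = (z' x y).col :=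
    fun x y h1 h2 h3 h4 => Prod.ext (hcol1 x y h1 h2 h3 h4) (hcol2 x y h1 h2 h3 h4)
  have hhv : ∀ y, y₀ ≤ y → y < y₁ → ∀ x, x₀ ≤ x → x < x₁ →
      (z x y).h = (z' x y).h ∧ (z x y).v = (z' x y).v := by
    refine prop_up fun y h3 h4 ihy => ?_
    have hbelow : ∀ x, x₀ ≤ x → x < x₁ → y₀ < y → (z x y).row = inner → (z x y).col = inner →
        ∀ q top l c r q' top' l' c' r', (z x y).h = some (q, top, l, c, r) →
        (z' x y).h = some (q', top', l', c', r') → q = q' ∧ c = c' := by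
      intro x h1 h2 hy hr hc q top l c r q' top' l' c' r' e e'
      obtain ⟨f1, f2, -⟩ := (hz.vr x y).v_comp hc hr _ _ _ _ _ e
      rw [hrow x y h1 h2 h3 h4] at hr
      rw [hcol x y h1 h2 h3 h4] at hc
      obtain ⟨f1', f2', -⟩ := (hz'.vr x y).v_comp hc hr _ _ _ _ _ e'
      rw [(ihy hy x h1 h2).2, (hskel x y h1 h2 h3 h4).1, hb x y h1 h2 h3 h4] at f1
      rw [(ihy hy x h1 h2).2] at f2
      rcases hv : (z' x (y - 1)).v with _ | ⟨q₁, c₁⟩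
      · rw [(f1 hv).1, (f1' hv).1, (f1 hv).2, (f1' hv).2]; exact ⟨rfl, rfl⟩
      · rw [(f2 _ _ hv).1, (f2' _ _ hv).1, (f2 _ _ hv).2, (f2' _ _ hv).2]; exact ⟨rfl, rfl⟩
    have hleft : ∀ x, x₀ ≤ x → x < x₁ → leftPart (z x y).h = leftPart (z' x y).h := by
      refine prop_up fun x h1 h2 ihx => ?_
      rcases hs x y h1 h2 h3 h4 with h | ⟨hx, -, hy, -⟩
      · rw [h]
      have er := hrow x y h1 h2 h3 h4
      have ec := hcol x y h1 h2 h3 h4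
      by_cases hr : (z x y).row = inner
      · by_cases hc : (z x y).col = inner
        · obtain ⟨q, top, l, c, r, e, f1, f2⟩ := (hz.hr x y).h_comp hr hc
          obtain ⟨q', top', l', c', r', e', f1', f2'⟩ := (hz'.hr x y).h_comp (er ▸ hr) (ec ▸ hc)
          obtain ⟨rfl, rfl⟩ := hbelow x h1 h2 hy hr hc _ _ _ _ _ _ _ _ _ _ e e'
          rw [e, e']
          rcases hp : (z (x - 1) y).h with _ | ⟨q₁, top₁, l₁, c₁, r₁⟩
          · obtain ⟨rfl, rfl⟩ := f1 hp
            obtain ⟨rfl, rfl⟩ := f1' (leftPart_none (ihx hx) hp)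
            rfl
          · obtain ⟨r₂, hp'⟩ := leftPart_some (ihx hx) hp
            obtain ⟨rfl, rfl, rfl, -⟩ := f2 _ _ _ _ _ hp
            obtain ⟨-, rfl, rfl, -⟩ := f2' _ _ _ _ _ hp'
            rfl
        · rw [(hz.hr x y).h_pass hr hc, (hz'.hr x y).h_pass (er ▸ hr) (ec ▸ hc), ihx hx]
      · rw [(hz.hr x y).h_none hr, (hz'.hr x y).h_none (er ▸ hr)]
    have hfull : ∀ x, x₀ ≤ x → x < x₁ → (z x y).h = (z' x y).h := by
      refine prop_down fun x h1 h2 ihx => ?_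
      rcases hs x y h1 h2 h3 h4 with h | ⟨hx, hx1, hy, -⟩
      · rw [h]
      have e := hz.hr (x + 1) y
      have e' := hz'.hr (x + 1) y
      rw [add_sub_cancel_right] at e e'
      have er := hrow (x + 1) y (by omega) hx1 h3 h4
      have ec := hcol (x + 1) y (by omega) hx1 h3 h4
      rcases hp : (z x y).h with _ | ⟨q₁, top₁, l₁, c₁, r₁⟩
      · rw [leftPart_none (hleft x h1 h2) hp]
      obtain ⟨r₂, hp'⟩ := leftPart_some (hleft x h1 h2) hp
      by_cases hr : (z (x + 1) y).row = inner
      · by_cases hc : (z (x + 1) y).col = inner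
        · obtain ⟨q, top, l, c, r, k, -, f2⟩ := e.h_comp hr hc
          obtain ⟨q', top', l', c', r', k', -, f2'⟩ := e'.h_comp (er ▸ hr) (ec ▸ hc)
          obtain ⟨-, -, -, hc1⟩ := f2 _ _ _ _ _ hp
          obtain ⟨-, -, -, hc2⟩ := f2' _ _ _ _ _ hp'
          have := ihx hx1
          rw [k, k'] at this
          simp only [Option.some.injEq, Prod.mk.injEq] at this
          rw [hp', ← hc1, ← hc2, this.2.2.2.1]
        · rw [← hp, ← e.h_pass hr hc, ← e'.h_pass (er ▸ hr) (ec ▸ hc), ihx hx1]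
      · rw [hp', e.h_edge hr _ _ _ _ _ hp, e'.h_edge (er ▸ hr) _ _ _ _ _ hp']
    refine fun x h1 h2 => ⟨hfull x h1 h2, ?_⟩
    rcases hs x y h1 h2 h3 h4 with h | ⟨hx, -, hy, -⟩
    · rw [h]
    have er := hrow x y h1 h2 h3 h4
    have ec := hcol x y h1 h2 h3 h4
    by_cases hc : (z x y).col = inner
    · by_cases hr : (z x y).row = inner
      · obtain ⟨q, top, l, c, r, e, -⟩ := (hz.hr x y).h_comp hr hc
        rw [((hz.vr x y).v_comp hc hr _ _ _ _ _ e).2.2.2, ((hz'.vr x y).v_comp (ec ▸ hc) (er ▸ hr)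
          _ _ _ _ _ ((hfull x h1 h2).symm.trans e)).2.2.2]
      · rw [(hz.vr x y).v_pass hc hr, (hz'.vr x y).v_pass (ec ▸ hc) (er ▸ hr), (ihy hy x h1 h2).2]
    · rw [(hz.vr x y).v_none hc, (hz'.vr x y).v_none (ec ▸ hc)]
  intro x y h1 h2 h3 h4
  obtain ⟨k1, k2, k3, k4, k5⟩ := hskel x y h1 h2 h3 h4
  obtain ⟨k6, k7⟩ := hhv y h3 h4 x h1 h2
  exact tile_eq k1 k2 k3 k4 k5 (hb x y h1 h2 h3 h4) (hb' x y h1 h2 h3 h4) (hrow x y h1 h2 h3 h4)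
    (hcol x y h1 h2 h3 h4) k6 k7

theorem lv_add_pow_mul {r K : ℕ} (hr : r < K) (w x : ℤ) : Lv r (x + 5 ^ K * w) ↔ Lv r x := by
  have h1 : (5 : ℤ) ^ r ∣ 5 ^ K * w := (pow_dvd_pow 5 hr.le).mul_right w
  have h2 : (5 : ℤ) ^ (r + 1) ∣ 5 ^ K * w := (pow_dvd_pow 5 hr).mul_right w
  rw [Lv, Lv, dvd_add_left h1, dvd_add_left h2]

theorem div_add_pow_mul {r K : ℕ} (hr : r < K) (w x : ℤ) :
    (((x + 5 ^ K * w) / 5 ^ r : ℤ) : ZMod 5) = ((x / 5 ^ r : ℤ) : ZMod 5) := by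
  have := dig_pow_add hr w x
  rwa [add_comm] at this

theorem IsStd.shift_mul (hz : TValid M z) {K : ℕ} (hs : IsStd K z) (w w' : ℤ) :
    IsStd K fun x y => z (x + 5 ^ K * w) (y + 5 ^ K * w') where
  d_eq r hr x hx := by
    rw [← div_add_pow_mul hr w, ← hs.d_eq r hr _ ((lv_add_pow_mul hr w x).2 hx)]
    exact hz.d_const _ _ _
  e_eq r hr x hx := by
    rw [← div_add_pow_mul hr w', ← hs.e_eq r hr _ ((lv_add_pow_mul hr w' x).2 hx)]
    exact hz.e_const _ _ _
  A_eq r hr x y hx hy :=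
    hs.A_eq r hr _ _ ((lv_add_pow_mul hr w x).2 hx) ((lv_add_pow_mul hr w' y).2 hy)
  A_lt r hr x y hx hy := hs.A_lt r hr _ _ ((lv_add_pow_mul hr w x).2 hx)
    (dvd_add hy ((pow_dvd_pow 5 hr).mul_right _))
  A_gt r hr x y hx hy := hs.A_gt r hr _ _ (dvd_add hx ((pow_dvd_pow 5 hr).mul_right _))
    ((lv_add_pow_mul hr w' y).2 hy)
  R_eq r hr x y hy := by
    rw [← div_add_pow_mul hr w, ← hs.R_eq r hr _ _ ((lv_add_pow_mul hr w' y).2 hy)]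
  U_eq r hr x y hy := by
    rw [← div_add_pow_mul hr w', ← hs.U_eq r hr _ _ ((lv_add_pow_mul hr w x).2 hy)]

theorem exists_isStd_fin (hz : TValid M z) (K : ℕ) :
    ∃ X Y : Fin (5 ^ K), IsStd K fun x y => z (x + (X : ℕ)) (y + (Y : ℕ)) := by
  obtain ⟨X, Y, hs⟩ := hz.exists_isStd K
  have h5 : (0 : ℤ) < 5 ^ K := by positivity
  have key : ∀ X : ℤ, ∃ X' : Fin (5 ^ K), ((X' : ℕ) : ℤ) = X + 5 ^ K * (-(X / 5 ^ K)) := by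
    intro X
    have h1 := Int.emod_nonneg X h5.ne'
    have h2 := Int.emod_lt_of_pos X h5
    refine ⟨⟨(X % 5 ^ K).toNat, ?_⟩, ?_⟩
    · zify; rw [Int.toNat_of_nonneg h1]; exact h2
    · simp only [Int.toNat_of_nonneg h1]
      have := Int.mul_ediv_add_emod X (5 ^ K)
      linear_combination this
  obtain ⟨X', hX⟩ := key X
  obtain ⟨Y', hY⟩ := key Y
  refine ⟨X', Y', ?_⟩
  have := (IsStd.shift_mul (hz.shift X Y) hs (-(X / 5 ^ K)) (-(Y / 5 ^ K)))
  have he : (fun x y => z (x + (X' : ℕ)) (y + (Y' : ℕ))) = fun x y =>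
      z (x + 5 ^ K * (-(X / 5 ^ K)) + X) (y + 5 ^ K * (-(Y / 5 ^ K)) + Y) := by
    funext x y
    rw [hX, hY]
    congr 1 <;> ring
  rwa [he]

/-- Two standard tilings have the same skeleton away from the cross of high level. -/
theorem skel_eq_of_isStd (hz : TValid M z) (hz' : TValid M z') {K : ℕ} (hs : IsStd K z)
    (hs' : IsStd K z') {x y : ℤ} (hx : ¬ (5 : ℤ) ^ K ∣ x) (hy : ¬ (5 : ℤ) ^ K ∣ y) :
    (z x y).A = (z' x y).A ∧ (z x y).d = (z' x y).d ∧
        (z x y).e = (z' x y).e ∧ (z x y).R = (z' x y).R ∧ (z x y).U = (z' x y).U := by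
  obtain ⟨r, hr, hrx⟩ := not_dvd_exists_lv hx
  obtain ⟨s, hs1, hsy⟩ := not_dvd_exists_lv hy
  refine ⟨?_, ?_, ?_, ?_, ?_⟩
  · rcases lt_trichotomy r s with h | rfl | h
    · have hd := (pow_dvd_pow (5 : ℤ) h).trans hsy.1
      exact (hs.A_lt r hr x y hrx hd).trans (hs'.A_lt r hr x y hrx hd).symm
    · exact (hs.A_eq r hr x y hrx hsy).trans (hs'.A_eq r hr x y hrx hsy).symm
    · have hd := (pow_dvd_pow (5 : ℤ) h).trans hrx.1
      exact (hs.A_gt s hs1 x y hd hsy).trans (hs'.A_gt s hs1 x y hd hsy).symm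
  · rw [hz.d_const x y 0, hz'.d_const x y 0]
    exact (hs.d_eq r hr x hrx).trans (hs'.d_eq r hr x hrx).symm
  · rw [hz.e_const x 0 y, hz'.e_const x 0 y]
    exact (hs.e_eq s hs1 y hsy).trans (hs'.e_eq s hs1 y hsy).symm
  · exact (hs.R_eq s hs1 x y hsy).trans (hs'.R_eq s hs1 x y hsy).symm
  · exact (hs.U_eq r hr x y hrx).trans (hs'.U_eq r hr x y hrx).symm

/-- The number of patterns of size `5 ^ j` in valid tilings. -/
theorem ncard_patterns_le [Finite Q] [Finite C] (M : AM Q C) (j : ℕ) :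
    {p : Fin (5 ^ j) → Fin (5 ^ j) → Tile Q C | ∃ z, TValid M z ∧
      ∀ i i', p i i' = z (i : ℕ) (i' : ℕ)}.ncard ≤
      5 ^ j * 5 ^ j * Nat.card (Tile Q C) ^ (6 * 5 ^ j) := by
  classical
  set N := 5 ^ j with hN
  have hN0 : 0 < N := by positivity
  set S := {p : Fin N → Fin N → Tile Q C | ∃ z, TValid M z ∧ ∀ i i', p i i' = z (i : ℕ) (i' : ℕ)}
  choose z hz hp using fun p : S => p.2
  choose X Y hs using fun p : S => (hz p).exists_isStd_fin j
  let code : S → (Fin N × Fin N) × (Fin 6 × Fin N → Tile Q C) := fun p =>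
    ((X p, Y p), fun k => match k with
      | (0, i) => p.1 ⟨0, hN0⟩ i
      | (1, i) => p.1 ⟨N - 1, by omega⟩ i
      | (2, i) => p.1 i ⟨0, hN0⟩
      | (3, i) => p.1 i ⟨N - 1, by omega⟩
      | (4, i) => p.1 (X p) i
      | (5, i) => p.1 i (Y p))
  have hinj : Function.Injective code := by
    intro p p' he
    have hX : X p = X p' := congrArg (fun c => c.1.1) he
    have hY : Y p = Y p' := congrArg (fun c => c.1.2) he
    have h2 := congrArg Prod.snd he
    have e0 : ∀ i, p.1 ⟨0, hN0⟩ i = p'.1 ⟨0, hN0⟩ i := fun i => congrFun h2 (0, i)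
    have e1 : ∀ i, p.1 ⟨N - 1, by omega⟩ i = p'.1 ⟨N - 1, by omega⟩ i := fun i => congrFun h2 (1, i)
    have e2 : ∀ i, p.1 i ⟨0, hN0⟩ = p'.1 i ⟨0, hN0⟩ := fun i => congrFun h2 (2, i)
    have e3 : ∀ i, p.1 i ⟨N - 1, by omega⟩ = p'.1 i ⟨N - 1, by omega⟩ := fun i => congrFun h2 (3, i)
    have e4 : ∀ i, p.1 (X p) i = p'.1 (X p) i := fun i => by
      have := congrFun h2 (4, i)
      simpa [code, hX] using this
    have e5 : ∀ i, p.1 i (Y p) = p'.1 i (Y p) := fun i => by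
      have := congrFun h2 (5, i)
      simpa [code, hY] using this
    have main := determined (hz p) (hz p') (x₀ := 0) (x₁ := N) (y₀ := 0) (y₁ := N) (by
      intro x y h1 h2 h3 h4
      lift x to ℕ using h1
      lift y to ℕ using h3
      norm_cast at h2 h4
      have conv : z p x y = z p' x y ↔ p.1 ⟨x, h2⟩ ⟨y, h4⟩ = p'.1 ⟨x, h2⟩ ⟨y, h4⟩ := by
        rw [hp p, hp p']
      rw [conv]
      by_cases c0 : x = 0
      · subst c0; exact Or.inl (e0 _)
      by_cases c1 : x = N - 1
      · subst c1; exact Or.inl (e1 _)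
      by_cases c2 : y = 0
      · subst c2; exact Or.inl (e2 _)
      by_cases c3 : y = N - 1
      · subst c3; exact Or.inl (e3 _)
      by_cases c4 : x = X p
      · subst c4; exact Or.inl (e4 _)
      by_cases c5 : y = Y p
      · subst c5; exact Or.inl (e5 _)
      refine Or.inr ⟨by omega, by omega, by omega, by omega, ?_⟩
      have nd : ∀ (x : ℕ) (X : Fin N), x < N → x ≠ X → ¬ (5 : ℤ) ^ j ∣ (x : ℤ) - (X : ℕ) := by
        intro x X hx hne hd
        have h5 : (5 : ℤ) ^ j = N := by rw [hN]; push_cast; rfl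
        rw [h5] at hd
        have hX := X.2
        have := Int.eq_zero_of_abs_lt_dvd hd (by rw [abs_lt]; omega)
        omega
      have := skel_eq_of_isStd ((hz p).shift (X p : ℕ) (Y p : ℕ))
        ((hz p').shift (X p' : ℕ) (Y p' : ℕ)) (hs p) (hs p') (nd x (X p) h2 c4) (nd y (Y p) h4 c5)
      simpa [hX, hY] using this)
    apply Subtype.ext
    funext i i'
    rw [hp p, hp p']
    exact main _ _ (by omega) (by exact_mod_cast i.2) (by omega) (by exact_mod_cast i'.2)
  have := Nat.card_le_card_of_injective code hinj
  rw [Nat.card_coe_set_eq] at this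
  refine this.trans_eq ?_
  rw [Nat.card_prod, Nat.card_prod, Nat.card_fun, Nat.card_prod]
  simp

end TValid

end HEnt

namespace HEnt

section Levels

theorem exists_lv {x : ℤ} (hx : x ≠ 0) : ∃ r, Lv r x := by
  have : ¬ (5 : ℤ) ^ x.natAbs ∣ x := fun hd => by
    have h1 := Nat.le_of_dvd (Int.natAbs_pos.2 hx) (Int.natAbs_dvd_natAbs.2 hd)
    rw [Int.natAbs_pow] at h1
    exact absurd (Nat.lt_pow_self (n := x.natAbs) (show 1 < (5 : ℤ).natAbs by norm_num))
      (not_lt.2 h1)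
  obtain ⟨r, -, h⟩ := not_dvd_exists_lv this
  exact ⟨r, h⟩

open Classical in
/-- The `5`-adic level of an integer. -/
noncomputable def lev (x : ℤ) : ℕ := if h : ∃ r, Lv r x then Nat.find h else 0

theorem lev_spec {x : ℤ} (hx : x ≠ 0) : Lv (lev x) x := by
  classical
  rw [lev, dif_pos (exists_lv hx)]
  exact Nat.find_spec (exists_lv hx)

theorem Lv.ne_zero {r : ℕ} {x : ℤ} (h : Lv r x) : x ≠ 0 := by
  rintro rfl
  exact h.2 (dvd_zero _)

theorem Lv.lev_eq {r : ℕ} {x : ℤ} (h : Lv r x) : lev x = r := (lev_spec h.ne_zero).unique h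

theorem dig_sub_one_of_not_dvd {n : ℕ} {x : ℤ} (h : ¬ (5 : ℤ) ^ n ∣ x) :
    dig n (x - 1) = dig n x := by
  rw [dig, dig]
  congr 1
  have h5 : (0 : ℤ) < 5 ^ n := by positivity
  have h1 := Int.emod_nonneg x h5.ne'
  have h2 := Int.emod_lt_of_pos x h5
  have h3 : x % 5 ^ n ≠ 0 := fun hc => h (Int.dvd_of_emod_eq_zero hc)
  have h4 := Int.mul_ediv_add_emod x (5 ^ n)
  have : x - 1 = (x % 5 ^ n - 1) + 5 ^ n * (x / 5 ^ n) := by linarith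
  rw [this, Int.add_mul_ediv_left _ _ h5.ne', Int.ediv_eq_zero_of_lt (by omega) (by omega), zero_add]

theorem dig_sub_one_of_dvd {n : ℕ} {x : ℤ} (h : (5 : ℤ) ^ n ∣ x) :
    dig n x = dig n (x - 1) + 1 := by
  obtain ⟨q, rfl⟩ := h
  have h5 : (0 : ℤ) < 5 ^ n := by positivity
  have : (5 : ℤ) ^ n * q - 1 = (5 ^ n - 1) + 5 ^ n * (q - 1) := by ring
  have h0 : ((5 : ℤ) ^ n - 1) / 5 ^ n = 0 := Int.ediv_eq_zero_of_lt (by omega) (by omega)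
  rw [dig, dig, this, Int.add_mul_ediv_left _ _ h5.ne', h0, Int.mul_ediv_cancel_left _ h5.ne']
  push_cast; ring

theorem dig_of_dvd {n : ℕ} {x : ℤ} (h : (5 : ℤ) ^ (n + 1) ∣ x) : dig n x = 0 := by
  obtain ⟨q, rfl⟩ := h
  rw [dig, pow_succ, mul_assoc, Int.mul_ediv_cancel_left _ (by positivity)]
  exact zmod5_eq_zero_iff.2 (dvd_mul_right _ _)

theorem Lv.dig_ne {n : ℕ} {x : ℤ} (h : Lv n x) : dig n x ≠ 0 := by
  obtain ⟨⟨q, rfl⟩, h2⟩ := h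
  rw [dig, Int.mul_ediv_cancel_left _ (by positivity), Ne, zmod5_eq_zero_iff]
  intro hd
  exact h2 (by rw [pow_succ]; exact mul_dvd_mul_left _ hd)

/-- Leading digit, with a conventional value at `0`. -/
noncomputable def lead (x : ℤ) : ZMod 5 := if x = 0 then 3 else dig (lev x) x

theorem lead_ne (x : ℤ) : lead x ≠ 0 := by
  rw [lead]
  split_ifs with h
  · decide
  · exact (lev_spec h).dig_ne

theorem Lv.lead_eq {r : ℕ} {x : ℤ} (h : Lv r x) : lead x = dig r x := by
  rw [lead, if_neg h.ne_zero, h.lev_eq]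

/-- Comparison of levels, the level of `0` being infinite. -/
noncomputable def cmpLev (x y : ℤ) : Ordering :=
  if x = 0 then (if y = 0 then .eq else .gt) else if y = 0 then .lt else compare (lev x) (lev y)

/-- The digit of `x` at the level of `y`. -/
noncomputable def digAt (x y : ℤ) : ZMod 5 :=
  if y = 0 then (if x < 0 then 2 else 3) else dig (lev y) x

theorem Lv.digAt_eq {r : ℕ} {y : ℤ} (h : Lv r y) (x : ℤ) : digAt x y = dig r x := by
  rw [digAt, if_neg h.ne_zero, h.lev_eq]

theorem cmpLev_eq_lt {x y : ℤ} : cmpLev x y = .lt ↔ x ≠ 0 ∧ (y = 0 ∨ lev x < lev y) := by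
  unfold cmpLev
  by_cases hx : x = 0 <;> by_cases hy : y = 0 <;> simp [hx, hy, compare_lt_iff_lt]

theorem cmpLev_eq_eq {x y : ℤ} :
    cmpLev x y = .eq ↔ (x = 0 ∧ y = 0) ∨ (x ≠ 0 ∧ y ≠ 0 ∧ lev x = lev y) := by
  unfold cmpLev
  by_cases hx : x = 0 <;> by_cases hy : y = 0 <;> simp [hx, hy]

theorem cmpLev_swap (x y : ℤ) : cmpLev x y = (cmpLev y x).swap := by
  unfold cmpLev
  by_cases hx : x = 0 <;> by_cases hy : y = 0 <;> simp [hx, hy, Nat.compare_swap]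

theorem digAt_lt {x y : ℤ} (h : cmpLev x y = .lt) : digAt x y = digAt (x - 1) y := by
  obtain ⟨hx, h⟩ := cmpLev_eq_lt.1 h
  unfold digAt
  by_cases hy : y = 0
  · rw [if_pos hy, if_pos hy]
    by_cases h0 : x < 0
    · rw [if_pos h0, if_pos (by omega)]
    · rw [if_neg h0, if_neg (by omega)]
  · rw [if_neg hy, if_neg hy, dig_sub_one_of_not_dvd]
    intro hd
    exact (lev_spec hx).2 ((pow_dvd_pow 5 (h.resolve_left hy)).trans hd)

theorem digAt_eq {x y : ℤ} (h : cmpLev x y = .eq) :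
    digAt x y = lead x ∧ lead x = digAt (x - 1) y + 1 := by
  rcases cmpLev_eq_eq.1 h with ⟨rfl, rfl⟩ | ⟨hx, hy, h⟩
  · simp [digAt, lead]; decide
  · have hl := lev_spec hx
    rw [hl.lead_eq, (h ▸ lev_spec hy : Lv (lev x) y).digAt_eq,
      (h ▸ lev_spec hy : Lv (lev x) y).digAt_eq]
    exact ⟨rfl, dig_sub_one_of_dvd hl.1⟩

theorem digAt_gt {x y : ℤ} (h : cmpLev x y = .gt) : digAt x y = 0 ∧ digAt (x - 1) y = 4 := by
  have h' : cmpLev y x = .lt := by rw [cmpLev_swap, h]; rfl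
  obtain ⟨hy, h⟩ := cmpLev_eq_lt.1 h'
  have hd : (5 : ℤ) ^ (lev y + 1) ∣ x := by
    rcases h with rfl | h
    · exact dvd_zero _
    · by_cases hx : x = 0
      · rw [hx]; exact dvd_zero _
      · exact (pow_dvd_pow 5 h).trans (lev_spec hx).1
  have h0 := dig_of_dvd hd
  rw [(lev_spec hy).digAt_eq, (lev_spec hy).digAt_eq]
  refine ⟨h0, ?_⟩
  have := dig_sub_one_of_dvd ((pow_dvd_pow 5 (Nat.le_succ _)).trans hd)
  rw [h0] at this
  generalize dig (lev y) (x - 1) = u at this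
  revert u; decide

end Levels

section Segments

/-- The type of the crossing, at position `x`, met along the line indexed by `y`. -/
noncomputable def ctype (y x : ℤ) : Option Bool :=
  if digAt y x = 1 ∧ (lead x = 1 ∨ lead x = 2) then some (decide (lead x = 1)) else none

/-- The segment state of the `q`-th block of length `5 ^ m`. -/
def blockState (m : ℕ) (ct : ℤ → Option Bool) (q : ℤ) : Bool × Bool :=
  if q % 5 = 1 then inner
  else if q % 5 = 0 then ((ct (5 ^ m * q)).getD false, true)
  else (false, (ct (5 ^ m * (5 * (q / 5) + 5))).getD true)

theorem blockState_inner {m : ℕ} {ct : ℤ → Option Bool} {q : ℤ} :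
    blockState m ct q = inner ↔ q % 5 = 1 := by
  unfold blockState
  split_ifs with h1 h2
  · simp [h1]
  · simp [inner]; omega
  · simp [inner]; omega

theorem block_cases (m : ℕ) (x : ℤ) :
    (¬ (5 : ℤ) ^ m ∣ x ∧ (x - 1) / 5 ^ m = x / 5 ^ m) ∨
    (∃ q, x = 5 ^ m * q ∧ x / 5 ^ m = q ∧ (x - 1) / 5 ^ m = q - 1) := by
  have h5 : (0 : ℤ) < 5 ^ m := by positivity
  by_cases h : (5 : ℤ) ^ m ∣ x
  · obtain ⟨q, rfl⟩ := h
    refine Or.inr ⟨q, rfl, Int.mul_ediv_cancel_left _ h5.ne', ?_⟩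
    have : (5 : ℤ) ^ m * q - 1 = (5 ^ m - 1) + 5 ^ m * (q - 1) := by ring
    rw [this, Int.add_mul_ediv_left _ _ h5.ne', Int.ediv_eq_zero_of_lt (by omega) (by omega),
      zero_add]
  · refine Or.inl ⟨h, ?_⟩
    have h1 := Int.emod_nonneg x h5.ne'
    have h2 := Int.emod_lt_of_pos x h5
    have h3 : x % 5 ^ m ≠ 0 := fun hc => h (Int.dvd_of_emod_eq_zero hc)
    have h4 := Int.mul_ediv_add_emod x (5 ^ m)
    have : x - 1 = (x % 5 ^ m - 1) + 5 ^ m * (x / 5 ^ m) := by linarith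
    rw [this, Int.add_mul_ediv_left _ _ h5.ne', Int.ediv_eq_zero_of_lt (by omega) (by omega),
      zero_add]

theorem blockState_rules {m : ℕ} {ct : ℤ → Option Bool} (h0 : ∀ x, ¬ (5 : ℤ) ^ m ∣ x → ct x = none)
    (h1 : ∀ q, q % 5 = 1 → ct (5 ^ m * q) = some true)
    (h2 : ∀ q, q % 5 = 2 → ct (5 ^ m * q) = some false)
    (h3 : ∀ q, q % 5 = 3 ∨ q % 5 = 4 → ct (5 ^ m * q) = none) (x : ℤ) :
    (∀ b, ct x = some b → (blockState m ct ((x - 1) / 5 ^ m)).2 = b ∧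
      (blockState m ct (x / 5 ^ m)).1 = b) ∧
    (ct x = none → blockState m ct (x / 5 ^ m) = blockState m ct ((x - 1) / 5 ^ m)) := by
  rcases block_cases m x with ⟨hd, he⟩ | ⟨q, rfl, e1, e2⟩
  · rw [he, h0 x hd]; simp
  rw [e1, e2]
  have h5 : q % 5 = 0 ∨ q % 5 = 1 ∨ q % 5 = 2 ∨ q % 5 = 3 ∨ q % 5 = 4 := by omega
  rcases h5 with h | h | h | h | h
  · have ha : (q - 1) % 5 = 4 := by omega
    have hb : 5 * ((q - 1) / 5) + 5 = q := by omega
    simp only [blockState, h, ha, hb]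
    rcases ct (5 ^ m * q) with _ | b <;> simp
  · have ha : (q - 1) % 5 = 0 := by omega
    simp [blockState, h, ha, h1 q h, inner]
  · have ha : (q - 1) % 5 = 1 := by omega
    simp [blockState, h, ha, h2 q h, inner]
  · have ha : (q - 1) % 5 = 2 := by omega
    have hb : (q - 1) / 5 = q / 5 := by omega
    simp [blockState, h, ha, hb, h3 q (Or.inl h)]
  · have ha : (q - 1) % 5 = 3 := by omega
    have hb : (q - 1) / 5 = q / 5 := by omega
    simp [blockState, h, ha, hb, h3 q (Or.inr h)]

open Classical in
/-- The first position of a digit `1`, if any. -/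
noncomputable def rk (y : ℤ) : Option ℕ := if h : ∃ m, IsRank m y then some (Nat.find h) else none

theorem rk_eq_some {y : ℤ} {m : ℕ} : rk y = some m ↔ IsRank m y := by
  classical
  unfold rk
  split_ifs with h
  · have hf := Nat.find_spec h
    rw [Option.some.injEq]
    exact ⟨fun e => e ▸ hf, fun hm => hf.unique hm⟩
  · simp only [false_iff]
    exact fun hm => h ⟨m, hm⟩

theorem rk_eq_none {y : ℤ} (h : rk y = none) (n : ℕ) : dig n y ≠ 1 := by
  classical
  intro hn
  have he : ∃ n, dig n y = 1 := ⟨n, hn⟩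
  have := rk_eq_some.2 (⟨Nat.find_spec he, fun i hi => Nat.find_min he hi⟩ : IsRank (Nat.find he) y)
  rw [h] at this
  simp at this

/-- The segment state at position `x` of the line indexed by `y`. -/
noncomputable def segState (y x : ℤ) : Bool × Bool :=
  match rk y with
  | none => (true, true)
  | some m => blockState m (ctype y) (x / 5 ^ m)

theorem segState_of_rank {m : ℕ} {y : ℤ} (h : IsRank m y) (x : ℤ) :
    segState y x = blockState m (ctype y) (x / 5 ^ m) := by
  rw [segState, rk_eq_some.2 h]

theorem zmod5_intCast_iff {q : ℤ} {s : ℕ} (hs : s < 5) : ((q : ℤ) : ZMod 5) = (s : ℕ) ↔ q % 5 = s := by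
  rw [← Int.cast_natCast, ZMod.intCast_eq_intCast_iff, Int.ModEq]
  push_cast
  rw [Int.emod_eq_of_lt (a := (s : ℤ)) (by omega) (by omega)]

theorem segState_inner {y x : ℤ} : segState y x = inner ↔ ∃ m, IsRank m y ∧ dig m x = 1 := by
  rcases h : rk y with _ | m
  · rw [segState, h]
    refine iff_of_false (by simp [inner]) ?_
    rintro ⟨m, hm, -⟩
    exact rk_eq_none h m hm.1
  · have hm := rk_eq_some.1 h
    rw [segState_of_rank hm, blockState_inner]
    have key : dig m x = 1 ↔ x / 5 ^ m % 5 = 1 := by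
      rw [dig]; exact_mod_cast zmod5_intCast_iff (q := x / 5 ^ m) (s := 1) (by norm_num)
    rw [← key]
    exact ⟨fun hx => ⟨m, hm, hx⟩, fun ⟨m', hm', hx⟩ => hm.unique hm' ▸ hx⟩

theorem ctype_none_of_dig {y x : ℤ} (h : x ≠ 0 → dig (lev x) y ≠ 1) : ctype y x = none := by
  rw [ctype, if_neg]
  rintro ⟨h1, h2⟩
  by_cases hx : x = 0
  · subst hx
    revert h2
    rw [lead, if_pos rfl]; decide
  · rw [(lev_spec hx).digAt_eq] at h1
    exact h hx h1

theorem segState_rules (y x : ℤ) :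
    (∀ b, ctype y x = some b → (segState y (x - 1)).2 = b ∧ (segState y x).1 = b) ∧
    (ctype y x = none → segState y x = segState y (x - 1)) := by
  rcases h : rk y with _ | m
  · rw [ctype_none_of_dig fun _ => rk_eq_none h _, segState, segState, h]
    simp
  · have hm := rk_eq_some.1 h
    rw [segState_of_rank hm, segState_of_rank hm]
    have hq : ∀ q : ℤ, (q : ZMod 5) ≠ 0 → ctype y (5 ^ m * q) =
        if (q : ZMod 5) = 1 ∨ (q : ZMod 5) = 2 then some (decide ((q : ZMod 5) = 1)) else none := by
      intro q hq
      have hl := lv_pow_mul (m := m) hq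
      have : dig m (5 ^ m * q) = q := by
        rw [dig, Int.mul_ediv_cancel_left _ (by positivity)]
      rw [ctype, hl.digAt_eq, hl.lead_eq, this, hm.1]
      simp
    have h5 : ∀ (q : ℤ) (s : ℕ), s < 5 → q % 5 = s → (q : ZMod 5) = (s : ℕ) := fun q s hs h =>
      (zmod5_intCast_iff hs).2 h
    refine blockState_rules (ct := ctype y) (fun x hx => ctype_none_of_dig fun h0 => ?_) ?_ ?_ ?_ x
    · obtain ⟨r, hr, hl⟩ := not_dvd_exists_lv hx
      rw [hl.lev_eq]
      exact hm.2 r hr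
    · intro q h
      have := h5 q 1 (by norm_num) h
      rw [hq q (by rw [this]; decide), this]; decide
    · intro q h
      have := h5 q 2 (by norm_num) h
      rw [hq q (by rw [this]; decide), this]; decide
    · rintro q (h | h)
      · have := h5 q 3 (by norm_num) h
        rw [hq q (by rw [this]; decide), this]; decide
      · have := h5 q 4 (by norm_num) h
        rw [hq q (by rw [this]; decide), this]; decide

end Segments


section Positions

/-- The index of the last board position not exceeding `n`. -/
def idx (n : ℕ) : ℕ := Nat.findGreatest (fun t => fr t ≤ n) n

theorem le_fr (t : ℕ) : t ≤ fr t := fr_strictMono.le_apply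

theorem idx_eq {n t : ℕ} (h : fr t ≤ n) (h' : n < fr (t + 1)) : idx n = t := by
  rw [idx, Nat.findGreatest_eq_iff]
  refine ⟨(le_fr t).trans h, fun _ => h, fun k hk _ hc => ?_⟩
  have := fr_strictMono.monotone (show t + 1 ≤ k from hk)
  omega

theorem idx_spec (n : ℕ) : fr (idx n) ≤ n ∧ n < fr (idx n + 1) := by
  have h0 : fr 0 ≤ n := by rw [fr_zero]; omega
  refine ⟨Nat.findGreatest_spec (P := fun t => fr t ≤ n) (Nat.zero_le _) h0, ?_⟩
  by_contra! hc
  have := Nat.le_findGreatest (P := fun t => fr t ≤ n) ((le_fr _).trans hc) hc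
  rw [← idx] at this
  omega

theorem idx_fr (t : ℕ) : idx (fr t) = t := idx_eq le_rfl (fr_lt_succ t)

theorem idx_sub_one {n : ℕ} (h : ∀ t, fr t ≠ n) : idx (n - 1) = idx n := by
  have h1 := idx_spec n
  have h2 := h (idx n)
  exact idx_eq (by omega) (by omega)

/-- The offset of `x` in its block of length `5 ^ m`. -/
def off (m : ℕ) (x : ℤ) : ℕ := (x % 5 ^ m).toNat

/-- The board position of `x` in its block of length `5 ^ m`. -/
def bpos (m : ℕ) (x : ℤ) : ℕ := idx (off m x)

theorem off_spec (m : ℕ) (x : ℤ) : off m x < 5 ^ m ∧ x = 5 ^ m * (x / 5 ^ m) + off m x := by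
  have h5 : (0 : ℤ) < 5 ^ m := by positivity
  have h1 := Int.emod_nonneg x h5.ne'
  have h2 := Int.emod_lt_of_pos x h5
  rw [off]
  refine ⟨?_, ?_⟩
  · zify; rw [Int.toNat_of_nonneg h1]; exact h2
  · rw [Int.toNat_of_nonneg h1, Int.mul_ediv_add_emod]

theorem off_eq {m : ℕ} {x q : ℤ} {n : ℕ} (hn : n < 5 ^ m) (h : x = 5 ^ m * q + n) :
    off m x = n ∧ dig m x = q := by
  subst h
  refine ⟨?_, dig_pow_add_self q hn⟩
  rw [off, Int.mul_add_emod_self_left, Int.emod_eq_of_lt (by positivity) (by exact_mod_cast hn)]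
  simp

theorem off_sub_one {m : ℕ} {x : ℤ} (h : off m x ≠ 0) :
    off m (x - 1) = off m x - 1 ∧ dig m (x - 1) = dig m x := by
  obtain ⟨h1, h2⟩ := off_spec m x
  have := off_eq (m := m) (x := x - 1) (q := x / 5 ^ m) (n := off m x - 1) (by omega)
    (by rw [Nat.cast_sub (by omega)]; push_cast; linarith)
  exact this

theorem off_sub_one' {m : ℕ} {x : ℤ} (h : off m x = 0) :
    off m (x - 1) = 5 ^ m - 1 ∧ dig m x = dig m (x - 1) + 1 := by
  obtain ⟨h1, h2⟩ := off_spec m x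
  have h5 : 0 < 5 ^ m := by positivity
  rw [h] at h2
  refine ⟨(off_eq (m := m) (x := x - 1) (q := x / 5 ^ m - 1) (n := 5 ^ m - 1) (by omega) ?_).1,
    dig_sub_one_of_dvd ⟨x / 5 ^ m, by simpa using h2⟩⟩
  rw [Nat.cast_sub (by omega)]; push_cast; push_cast at h2; linarith

theorem isRank_iff {m : ℕ} {x : ℤ} (hx : dig m x = 1) : IsRank m x ↔ ∃ t < 4 ^ m, off m x = fr t := by
  obtain ⟨h1, h2⟩ := off_spec m x
  have hd : ∀ i < m, dig i x = dig i (off m x) := fun i hi => by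
    conv_lhs => rw [h2]
    exact dig_pow_add hi _ _
  constructor
  · intro h
    obtain ⟨t, ht, he⟩ := exists_fr_eq_of_lt h1 fun i hi => by rw [← hd i hi]; exact h.2 i hi
    exact ⟨t, ht, he.symm⟩
  · rintro ⟨t, ht, he⟩
    refine ⟨hx, fun i hi => ?_⟩
    rw [hd i hi, he]
    exact dig_fr i t

theorem bpos_of_isRank {m : ℕ} {x : ℤ} (h : IsRank m x) :
    bpos m x < 4 ^ m ∧ off m x = fr (bpos m x) := by
  obtain ⟨t, ht, he⟩ := (isRank_iff h.1).1 h
  rw [bpos, he, idx_fr]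
  exact ⟨ht, rfl⟩

theorem bpos_pass {m : ℕ} {x : ℤ} (hx : dig m x = 1) (h : ¬ IsRank m x) :
    dig m (x - 1) = 1 ∧ bpos m (x - 1) = bpos m x := by
  rw [isRank_iff hx] at h
  push Not at h
  have hfr : ∀ t, fr t ≠ off m x := fun t ht => by
    refine h t ?_ ht.symm
    by_contra! hc
    have := fr_strictMono.monotone hc
    rw [fr_pow] at this
    have := (off_spec m x).1
    omega
  have h0 : off m x ≠ 0 := fun h0 => hfr 0 (by rw [fr_zero, h0])
  obtain ⟨h1, h2⟩ := off_sub_one h0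
  rw [h2, bpos, h1, idx_sub_one hfr]
  exact ⟨hx, rfl⟩

theorem bpos_first {m : ℕ} {x : ℤ} (h : IsRank m x) (h' : dig m (x - 1) ≠ 1) : off m x = 0 := by
  by_contra h0
  exact h' ((off_sub_one h0).2.trans h.1)

theorem bpos_next {m : ℕ} {x : ℤ} (h : IsRank m x) (h' : dig m (x - 1) = 1) :
    bpos m x = bpos m (x - 1) + 1 := by
  have h0 : off m x ≠ 0 := fun h0 => by
    have := (off_sub_one' h0).2
    rw [h.1, h'] at this
    exact absurd this (by decide)
  obtain ⟨ht, he⟩ := bpos_of_isRank h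
  have hpos : bpos m x ≠ 0 := fun hc => h0 (by rw [he, hc, fr_zero])
  obtain ⟨t, ht'⟩ := Nat.exists_eq_succ_of_ne_zero hpos
  rw [ht', bpos, (off_sub_one h0).1, he, ht']
  have := fr_lt_succ t
  rw [idx_eq (t := t) (by rw [Nat.succ_eq_add_one]; omega) (by rw [Nat.succ_eq_add_one]; omega)]

theorem bpos_last {m : ℕ} {x : ℤ} (h : dig m (x - 1) = 1) (h' : dig m x ≠ 1) :
    bpos m (x - 1) + 1 = 4 ^ m := by
  have h0 : off m x = 0 := by
    by_contra h0
    exact h' ((off_sub_one h0).2 ▸ h)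
  have h4 : 0 < 4 ^ m := by positivity
  have h5 : 0 < 5 ^ m := by positivity
  rw [bpos, (off_sub_one' h0).1, idx_eq (t := 4 ^ m - 1)]
  · omega
  · have := fr_lt_pow (show 4 ^ m - 1 < 4 ^ m by omega)
    omega
  · rw [Nat.sub_add_cancel h4, fr_pow]
    omega

theorem lev_of_bpos_zero {m : ℕ} {x : ℤ} (h : IsRank m x) (h0 : bpos m x = 0) : Lv m x := by
  obtain ⟨-, h1⟩ := bpos_of_isRank h
  obtain ⟨-, h2⟩ := off_spec m x
  rw [h1, h0, fr_zero] at h2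
  rw [show x = 5 ^ m * (x / 5 ^ m) by simpa using h2]
  refine lv_pow_mul ?_
  rw [← dig, h.1]
  decide

theorem lev_of_bpos_pos {m : ℕ} {x : ℤ} (h : IsRank m x) (h0 : bpos m x ≠ 0) :
    padicValNat 5 (fr (bpos m x)) < m ∧ Lv (padicValNat 5 (fr (bpos m x))) x := by
  obtain ⟨h3, h1⟩ := bpos_of_isRank h
  obtain ⟨-, h2⟩ := off_spec m x
  rw [h1] at h2
  obtain ⟨h4, h5⟩ := TValid.lv_board h3 h0
  refine ⟨h4, ?_⟩
  have h6 : x = 5 ^ m + fr (bpos m x) + 5 ^ m * (x / 5 ^ m - 1) := by linear_combination h2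
  have h7 := (TValid.lv_add_pow_mul h4 (x / 5 ^ m - 1) _).2 h5
  rwa [← h6] at h7

end Positions

section Run

variable {Q C : Type}

/-- The neighbours of a cell of the array and the cell itself, as seen on a board of width `W`. -/
def AM.obs (M : AM Q C) (W : ℕ) (c : Q × (ℕ → C)) (t : ℕ) : Q × C × Option C × C × C :=
  (c.1, c.2 0, if t = 0 then none else some (c.2 (t - 1)), c.2 t,
    if t + 1 < W then c.2 (t + 1) else M.blank)

/-- The run of the automaton on a board of width `W`. -/
def AM.trun (M : AM Q C) (W : ℕ) (σ : ℕ → ZMod 5) : ℕ → Q × (ℕ → C)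
  | 0 => (M.q0, fun i => M.ini (σ i))
  | s + 1 => (M.next (AM.trun M W σ s).1 ((AM.trun M W σ s).2 0), fun t =>
      M.upd (M.obs W (AM.trun M W σ s) t).1 (M.obs W (AM.trun M W σ s) t).2.1
        (M.obs W (AM.trun M W σ s) t).2.2.1 (M.obs W (AM.trun M W σ s) t).2.2.2.1
        (M.obs W (AM.trun M W σ s) t).2.2.2.2)

theorem AM.trun_eq (M : AM Q C) (W : ℕ) (σ : ℕ → ZMod 5) (s : ℕ) (hs : s ≤ W) :
    (M.trun W σ s).1 = (M.run σ s).1 ∧ ∀ t, t + s < W → (M.trun W σ s).2 t = (M.run σ s).2 t := by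
  induction s with
  | zero => exact ⟨rfl, fun _ _ => rfl⟩
  | succ s ih =>
    obtain ⟨h1, h2⟩ := ih (by omega)
    rw [AM.run_succ, AM.step, AM.trun]
    refine ⟨?_, fun t ht => ?_⟩
    · simp only [h1, h2 0 (by omega)]
    · simp only [AM.obs, h1, h2 0 (by omega), h2 t (by omega), h2 (t + 1) (by omega),
        if_pos (show t + 1 < W by omega)]
      split_ifs with h0
      · rfl
      · rw [h2 (t - 1) (by omega)]

end Run

section Config

variable {Q C : Type} (M : AM Q C) (a : ℕ → ZMod 5)

/-- The symbol of a line. -/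
noncomputable def levSym (x : ℤ) : ZMod 5 := if x = 0 then 0 else a (lev x)

/-- The signal carried along rows. -/
noncomputable def rowSig (x y : ℤ) : Option (Q × C × Option C × C × C) :=
  (rk y).bind fun m => if dig m x = 1 then
    some (M.obs (4 ^ m) (M.trun (4 ^ m) (strm a) (bpos m y)) (bpos m x)) else none

/-- The signal carried along columns. -/
noncomputable def colSig (x y : ℤ) : Option (Q × C) :=
  (rk x).bind fun m => if dig m y = 1 then
    some ((M.trun (4 ^ m) (strm a) (bpos m y + 1)).1,
      (M.trun (4 ^ m) (strm a) (bpos m y + 1)).2 (bpos m x)) else none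

theorem rowSig_eq {m : ℕ} {x y : ℤ} (hy : IsRank m y) (hx : dig m x = 1) : rowSig M a x y =
    some (M.obs (4 ^ m) (M.trun (4 ^ m) (strm a) (bpos m y)) (bpos m x)) := by
  rw [rowSig, rk_eq_some.2 hy, Option.bind_some, if_pos hx]

theorem rowSig_none {x y : ℤ} (h : segState y x ≠ inner) : rowSig M a x y = none := by
  rw [Ne, segState_inner] at h
  rcases hr : rk y with _ | m
  · rw [rowSig, hr, Option.bind_none]
  · rw [rowSig, hr, Option.bind_some, if_neg fun hc => h ⟨m, rk_eq_some.1 hr, hc⟩]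

theorem colSig_eq {m : ℕ} {x y : ℤ} (hx : IsRank m x) (hy : dig m y = 1) : colSig M a x y =
    some ((M.trun (4 ^ m) (strm a) (bpos m y + 1)).1,
      (M.trun (4 ^ m) (strm a) (bpos m y + 1)).2 (bpos m x)) := by
  rw [colSig, rk_eq_some.2 hx, Option.bind_some, if_pos hy]

theorem colSig_none {x y : ℤ} (h : segState x y ≠ inner) : colSig M a x y = none := by
  rw [Ne, segState_inner] at h
  rcases hr : rk x with _ | m
  · rw [colSig, hr, Option.bind_none]
  · rw [colSig, hr, Option.bind_some, if_neg fun hc => h ⟨m, rk_eq_some.1 hr, hc⟩]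

theorem dig_ne_of_segState {m : ℕ} {x y : ℤ} (hy : IsRank m y) (h : segState y x ≠ inner) :
    dig m x ≠ 1 := fun hc => h (segState_inner.2 ⟨m, hy, hc⟩)

theorem isRank_of_inner {m : ℕ} {x y : ℤ} (hy : IsRank m y) (hx : dig m x = 1)
    (h : segState x y = inner) : IsRank m x := by
  obtain ⟨m', h1, h2⟩ := segState_inner.1 h
  rcases lt_trichotomy m m' with hlt | rfl | hlt
  · exact absurd hx (h1.2 m hlt)
  · exact h1
  · exact absurd h2 (hy.2 m' hlt)

/-- The tiling encoding a stream. -/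
noncomputable def config (x y : ℤ) : Tile Q C where
  A := cmpLev x y
  d := lead x
  e := lead y
  R := digAt x y
  U := digAt y x
  b := levSym a x
  b' := levSym a y
  row := segState y x
  col := segState x y
  h := rowSig M a x y
  v := colSig M a x y

theorem config_hr (x y : ℤ) : HRule M (config M a (x - 1) y) (config M a x y) where
  d_ne := lead_ne x
  lt_R h := digAt_lt h
  eq_R h := digAt_eq h
  gt_R h := digAt_gt h
  e_eq := rfl
  b'_eq := rfl
  b_eq h := by
    change levSym a x = levSym a y
    rcases cmpLev_eq_eq.1 h with ⟨rfl, rfl⟩ | ⟨hx, hy, h⟩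
    · rfl
    · rw [levSym, levSym, if_neg hx, if_neg hy, h]
  cross h1 h2 := by
    have : ctype y x = some (decide (lead x = 1)) := by
      rw [ctype, if_pos ⟨h1, h2⟩]
    exact (segState_rules y x).1 _ this
  pass h := (segState_rules y x).2 (by rw [ctype]; exact if_neg h)
  h_none h := rowSig_none M a h
  h_pass hr hc := by
    obtain ⟨m, hm, hx⟩ := segState_inner.1 hr
    have hn : ¬ IsRank m x := fun h => hc (segState_inner.2 ⟨m, h, hm.1⟩)
    obtain ⟨h1, h2⟩ := bpos_pass hx hn
    change rowSig M a x y = rowSig M a (x - 1) y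
    rw [rowSig_eq M a hm hx, rowSig_eq M a hm h1, h2]
  h_comp hr hc := by
    obtain ⟨m, hm, hx⟩ := segState_inner.1 hr
    have hxm := isRank_of_inner hm hx hc
    refine ⟨_, _, _, _, _, rowSig_eq M a hm hx, fun h => ?_, fun q₁ top₁ l₁ c₁ r₁ h => ?_⟩
    · have hx1 : dig m (x - 1) ≠ 1 := fun hc => by
        have := (rowSig_eq M a hm hc).symm.trans h
        simp at this
      have h0 : bpos m x = 0 := by
        rw [bpos, bpos_first hxm hx1]; simpa [fr_zero] using idx_fr 0
      rw [h0]
      exact ⟨rfl, rfl⟩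
    · have hx1 : dig m (x - 1) = 1 := by
        by_contra hc
        have := (rowSig_none M a (x := x - 1) (y := y) fun h' => by
          obtain ⟨m', hm', h'⟩ := segState_inner.1 h'
          exact hc (hm.unique hm' ▸ h')).symm.trans h
        simp at this
      have h' := (rowSig_eq M a hm hx1).symm.trans h
      simp only [AM.obs, Option.some.injEq, Prod.mk.injEq] at h'
      obtain ⟨rfl, rfl, rfl, rfl, rfl⟩ := h'
      have hn := bpos_next hxm hx1
      have hlt := (bpos_of_isRank hxm).1
      rw [hn] at hlt ⊢
      simp [hlt]
  h_edge hr q top l c r h := by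
    have hin : segState y (x - 1) = inner := by
      by_contra hc
      have := (rowSig_none M a hc).symm.trans h
      simp at this
    obtain ⟨m, hm, hx⟩ := segState_inner.1 hin
    have hl := bpos_last hx (dig_ne_of_segState hm hr)
    have h' := (rowSig_eq M a hm hx).symm.trans h
    simp only [AM.obs, Option.some.injEq, Prod.mk.injEq] at h'
    rw [← h'.2.2.2.2, if_neg (by omega)]

theorem config_vr (ha : ∀ s, (M.run (strm a) s).1 ∉ M.rej) (x y : ℤ) :
    VRule M (config M a x (y - 1)) (config M a x y) where
  e_ne := lead_ne y
  gt_U h := digAt_lt (x := y) (y := x) (by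
    rw [cmpLev_swap]; rw [show cmpLev x y = .gt from h]; rfl)
  eq_U h := digAt_eq (x := y) (y := x) (by
    rw [cmpLev_swap]; rw [show cmpLev x y = .eq from h]; rfl)
  lt_U h := digAt_gt (x := y) (y := x) (by
    rw [cmpLev_swap]; rw [show cmpLev x y = .lt from h]; rfl)
  d_eq := rfl
  b_eq := rfl
  cross h1 h2 := by
    have : ctype x y = some (decide (lead y = 1)) := by
      rw [ctype, if_pos ⟨h1, h2⟩]
    exact (segState_rules x y).1 _ this
  pass h := (segState_rules x y).2 (by rw [ctype]; exact if_neg h)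
  v_none h := colSig_none M a h
  v_pass hr hc := by
    obtain ⟨m, hm, hx⟩ := segState_inner.1 hr
    have hn : ¬ IsRank m y := fun h => hc (segState_inner.2 ⟨m, h, hm.1⟩)
    obtain ⟨h1, h2⟩ := bpos_pass hx hn
    change colSig M a x y = colSig M a x (y - 1)
    rw [colSig_eq M a hm hx, colSig_eq M a hm h1, h2]
  v_comp hc hr q top l c r h := by
    obtain ⟨m, hm, hx⟩ := segState_inner.1 hr
    have hxm := isRank_of_inner hm hx hc
    have h' := (rowSig_eq M a hm hx).symm.trans h
    simp only [AM.obs, Option.some.injEq, Prod.mk.injEq] at h'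
    obtain ⟨rfl, rfl, rfl, rfl, rfl⟩ := h'
    have hlt := (bpos_of_isRank hm).1
    refine ⟨fun h => ?_, fun q₁ c₁ h => ?_, ?_, colSig_eq M a hxm hm.1⟩
    · have hy1 : dig m (y - 1) ≠ 1 := fun hc => by
        have := (colSig_eq M a hxm hc).symm.trans h
        simp at this
      have h0 : bpos m y = 0 := by
        rw [bpos, bpos_first hm hy1]; simpa [fr_zero] using idx_fr 0
      rw [h0]
      refine ⟨rfl, ?_⟩
      change M.ini (strm a (bpos m x)) = M.ini (if cmpLev x y = .eq then 0 else levSym a x)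
      have hly := lev_of_bpos_zero hm h0
      congr 1
      by_cases hx0 : bpos m x = 0
      · have hlx := lev_of_bpos_zero hxm hx0
        rw [hx0, strm, if_pos rfl, if_pos]
        exact cmpLev_eq_eq.2 (Or.inr ⟨hlx.ne_zero, hly.ne_zero, hlx.lev_eq.trans hly.lev_eq.symm⟩)
      · obtain ⟨h1, h2⟩ := lev_of_bpos_pos hxm hx0
        rw [strm, if_neg hx0, if_neg, levSym, if_neg h2.ne_zero, h2.lev_eq]
        rw [cmpLev_eq_eq, h2.lev_eq, hly.lev_eq]
        rintro (⟨h, -⟩ | ⟨-, -, h⟩)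
        · exact h2.ne_zero h
        · omega
    · have hy1 : dig m (y - 1) = 1 := by
        by_contra hc
        have := (colSig_none M a (x := x) (y := y - 1) fun h' => by
          obtain ⟨m', hm', h'⟩ := segState_inner.1 h'
          exact hc (hxm.unique hm' ▸ h')).symm.trans h
        simp at this
      have h' := (colSig_eq M a hxm hy1).symm.trans h
      simp only [Option.some.injEq, Prod.mk.injEq] at h'
      rw [bpos_next hm hy1]
      exact h'
    · rw [(M.trun_eq _ _ _ hlt.le).1]
      exact ha _

theorem config_valid (ha : ∀ s, (M.run (strm a) s).1 ∉ M.rej) : TValid M (config M a) where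
  hr := config_hr M a
  vr := config_vr M a ha

theorem config_free {x : ℤ} {n : ℕ} (h : Free a n x) (y : ℤ) :
    (config M a x y).d.val ≤ (config M a x y).b.val := by
  obtain ⟨r, -, hl, h⟩ := h
  change (lead x).val ≤ (levSym a x).val
  rw [hl.lead_eq, levSym, if_neg hl.ne_zero, hl.lev_eq]
  exact h

end Config

end HEnt

namespace HEnt

section Primrec

variable {α : Type*} [Primcodable α]

theorem primrec_sum_range {f : α → ℕ} {g : α → ℕ → ℕ} (hf : Primrec f) (hg : Primrec₂ g) :
    Primrec fun a => ∑ r ∈ Finset.range (f a), g a r := by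
  refine (Primrec.nat_rec' (h := fun a p => p.2 + g a p.1) hf (Primrec.const 0)
    (Primrec.nat_add.comp (Primrec.snd.comp Primrec.snd)
      (hg.comp Primrec.fst (Primrec.fst.comp Primrec.snd)))).of_eq fun a => ?_
  generalize f a = n
  induction n with
  | zero => simp
  | succ n ih => rw [Finset.sum_range_succ, ← ih]

theorem primrec_pow : Primrec₂ ((· ^ ·) : ℕ → ℕ → ℕ) :=
  Primrec₂.unpaired'.1 Nat.Primrec.pow

end Primrec

/-- The expansion read off from a reversed initial segment of a stream, scaled by `5 ^ w.length`. -/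
def expansion (w : List ℕ) : ℕ :=
  ∑ r ∈ Finset.range w.length,
    if 4 ^ r < w.length then w.getD (w.length - 1 - 4 ^ r) 0 * 5 ^ (w.length - r - 1) else 0

theorem primrec_expansion : Primrec expansion := by
  have hl : Primrec fun p : List ℕ × ℕ => p.1.length := Primrec.list_length.comp Primrec.fst
  have hp : Primrec fun p : List ℕ × ℕ => 4 ^ p.2 := primrec_pow.comp (Primrec.const 4) Primrec.snd
  refine primrec_sum_range Primrec.list_length (Primrec.ite (Primrec.nat_lt.comp hp hl)
    (Primrec.nat_mul.comp ((Primrec.list_getD 0).comp Primrec.fst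
      (Primrec.nat_sub.comp (Primrec.nat_sub.comp hl (Primrec.const 1)) hp)) ?_)
      (Primrec.const 0))
  exact primrec_pow.comp (Primrec.const 5)
    (Primrec.nat_sub.comp (Primrec.nat_sub.comp hl Primrec.snd) (Primrec.const 1))

/-- A reversed initial segment of a stream is excessive if its expansion exceeds `N / D`. -/
def Excessive (N D : ℕ → ℕ) (w : List ℕ) : Prop :=
  N w.length * 5 ^ w.length < expansion w * D w.length

theorem computablePred_excessive {N D : ℕ → ℕ} (hN : Computable N) (hD : Computable D) :
    ComputablePred (Excessive N D) := by
  refine ⟨fun w => inferInstanceAs (Decidable (_ < _)), ?_⟩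
  have hl : Computable fun w : List ℕ => w.length := Primrec.list_length.to_comp
  have hp : Computable fun w : List ℕ => 5 ^ w.length :=
    (primrec_pow.comp (Primrec.const 5) Primrec.list_length).to_comp
  exact (Primrec.nat_lt.decide.to_comp.comp
    (Primrec.nat_mul.to_comp.comp (hN.comp hl) hp)
    (Primrec.nat_mul.to_comp.comp primrec_expansion.to_comp (hD.comp hl)))

end HEnt

namespace HEnt

section Digits

/-- The first `j` base-`5` digits of the expansion `0.a₀a₁…`, as a natural number. -/
def digitSum (a : ℕ → ZMod 5) (j : ℕ) : ℕ := ∑ r ∈ Finset.range j, (a r).val * 5 ^ (j - 1 - r)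

theorem digitSum_succ (a : ℕ → ZMod 5) (j : ℕ) :
    digitSum a (j + 1) = 5 * digitSum a j + (a j).val := by
  rw [digitSum, Finset.sum_range_succ, digitSum, Finset.mul_sum]
  congr 1
  · refine Finset.sum_congr rfl fun r hr => ?_
    have := Finset.mem_range.1 hr
    rw [show j + 1 - 1 - r = (j - 1 - r) + 1 by omega, pow_succ]
    ring
  · simp

theorem digitSum_mul_le (a : ℕ → ZMod 5) {j T : ℕ} (h : j ≤ T) :
    digitSum a j * 5 ^ (T - j) = ∑ r ∈ Finset.range j, (a r).val * 5 ^ (T - r - 1) := by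
  rw [digitSum, Finset.sum_mul]
  refine Finset.sum_congr rfl fun r hr => ?_
  have := Finset.mem_range.1 hr
  rw [mul_assoc, ← pow_add]
  congr 2
  omega

theorem getD_initRev (σ : ℕ → ZMod 5) {T i : ℕ} (h : i < T) :
    (initRev σ T).getD (T - 1 - i) 0 = (σ i).val := by
  have h1 : T - 1 - i < T := by omega
  rw [initRev, List.getD_eq_getElem _ _ (by simpa using h1)]
  simp only [List.getElem_reverse, List.length_map, List.length_range, List.getElem_map,
    List.getElem_range]
  congr 2
  omega

theorem length_initRev (σ : ℕ → ZMod 5) (T : ℕ) : (initRev σ T).length = T := by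
  simp [initRev]

theorem expansion_initRev (a : ℕ → ZMod 5) (T : ℕ) : expansion (initRev (strm a) T) =
    ∑ r ∈ Finset.range T, if 4 ^ r < T then (a r).val * 5 ^ (T - r - 1) else 0 := by
  rw [expansion, length_initRev]
  refine Finset.sum_congr rfl fun r _ => ?_
  split_ifs with h
  · rw [getD_initRev _ h, strm_pow]
  · rfl

variable {N D : ℕ → ℕ} {θ : ℝ} {a : ℕ → ZMod 5}

theorem digitSum_le_of_not_excessive (hD : ∀ n, 0 < D n)
    (hlim : Filter.Tendsto (fun n => (N n : ℝ) / D n) Filter.atTop (nhds θ))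
    (ha : ∀ T, ¬ Excessive N D (initRev (strm a) (T + 1))) (j : ℕ) :
    (digitSum a j : ℝ) ≤ θ * 5 ^ j := by
  rw [← div_le_iff₀ (by positivity)]
  refine ge_of_tendsto hlim ?_
  filter_upwards [Filter.eventually_gt_atTop (4 ^ j)] with T hT
  have hjT : j < T := (Nat.lt_pow_self (by norm_num)).trans hT
  have h := ha (T - 1)
  rw [Nat.sub_add_cancel (by omega), Excessive, length_initRev, not_lt,
    expansion_initRev] at h
  have h1 : digitSum a j * 5 ^ (T - j) ≤
      ∑ r ∈ Finset.range T, if 4 ^ r < T then (a r).val * 5 ^ (T - r - 1) else 0 := by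
    rw [digitSum_mul_le a hjT.le]
    calc _ = ∑ r ∈ Finset.range j, if 4 ^ r < T then (a r).val * 5 ^ (T - r - 1) else 0 := by
          refine Finset.sum_congr rfl fun r hr => ?_
          rw [if_pos ((Nat.pow_le_pow_right (by norm_num) (Finset.mem_range.1 hr).le).trans_lt hT)]
      _ ≤ _ := Finset.sum_le_sum_of_subset (Finset.range_mono hjT.le)
  have h2 : digitSum a j * 5 ^ (T - j) * D T ≤ N T * 5 ^ T :=
    (Nat.mul_le_mul_right _ h1).trans h
  have hDT : (0 : ℝ) < D T := by exact_mod_cast hD T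
  rw [div_le_div_iff₀ (by positivity) hDT]
  have h3 : (digitSum a j : ℝ) * 5 ^ (T - j) * D T ≤ N T * 5 ^ T := by exact_mod_cast h2
  rw [show T = (T - j) + j by omega, pow_add, show (T - j) + j = T by omega] at h3
  have h4 : (0 : ℝ) < 5 ^ (T - j) := by positivity
  refine le_of_mul_le_mul_left ?_ h4
  linarith

/-- The base-`5` digits of a real number. -/
noncomputable def digits5 (θ : ℝ) (r : ℕ) : ZMod 5 := (⌊θ * 5 ^ (r + 1)⌋₊ : ℕ)

theorem digitSum_digits5 (h1 : θ < 1) (j : ℕ) :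
    digitSum (digits5 θ) j = ⌊θ * 5 ^ j⌋₊ := by
  induction j with
  | zero => simp [digitSum, Nat.floor_eq_zero.2 h1]
  | succ j ih =>
    rw [digitSum_succ, ih, digits5, ZMod.val_natCast]
    have h2 : ⌊θ * 5 ^ j⌋₊ = ⌊θ * 5 ^ (j + 1)⌋₊ / 5 := by
      rw [show θ * 5 ^ j = θ * 5 ^ (j + 1) / 5 by ring, Nat.floor_div_ofNat]
    rw [h2]
    exact Nat.div_add_mod _ 5

theorem not_excessive_digits5 (h0 : 0 ≤ θ) (h1 : θ < 1) (hD : ∀ n, 0 < D n)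
    (hle : ∀ n, θ ≤ (N n : ℝ) / D n) (T : ℕ) :
    ¬ Excessive N D (initRev (strm (digits5 θ)) T) := by
  rw [Excessive, length_initRev, not_lt, expansion_initRev]
  have h2 : (∑ r ∈ Finset.range T,
      if 4 ^ r < T then (digits5 θ r).val * 5 ^ (T - r - 1) else 0) ≤ ⌊θ * 5 ^ T⌋₊ := by
    rw [← digitSum_digits5 h1, ← mul_one (digitSum _ _), ← pow_zero 5, ← Nat.sub_self T,
      digitSum_mul_le _ le_rfl]
    exact Finset.sum_le_sum fun r _ => by split_ifs <;> simp
  refine (Nat.mul_le_mul_right _ h2).trans ?_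
  have h3 : (⌊θ * 5 ^ T⌋₊ : ℝ) ≤ θ * 5 ^ T := Nat.floor_le (by positivity)
  have hDT : (0 : ℝ) < D T := by exact_mod_cast hD T
  have h4 := (le_div_iff₀ hDT).1 (hle T)
  have : ((⌊θ * 5 ^ T⌋₊ : ℕ) : ℝ) * D T ≤ N T * 5 ^ T := by
    calc _ ≤ θ * 5 ^ T * D T := by gcongr
      _ = θ * D T * 5 ^ T := by ring
      _ ≤ _ := by gcongr
  exact_mod_cast this

end Digits

section Count

variable {Q C : Type} {M : AM Q C} {z : ℤ → ℤ → Tile Q C} {a : ℕ → ZMod 5}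

/-- The tiles in free cells. -/
def freeTiles (Q C : Type) : Set (Tile Q C) := {t | t.d.val ≤ t.b.val}

/-- The number of cells of the window `[0, n)²` whose symbol lies in `E`. -/
noncomputable def cellCount {S : Type*} (E : Set S) (z : ℤ → ℤ → S) (n : ℕ) : ℕ :=
  {p : Fin n × Fin n | z (p.1 : ℕ) (p.2 : ℕ) ∈ E}.ncard

theorem ncard_fin_eq_card (n : ℕ) (P : ℤ → Prop) [DecidablePred P] (X : ℤ) :
    {i : Fin n | P ((i : ℕ) - X)}.ncard = ((Finset.Ico (-X) (-X + n)).filter P).card := by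
  rw [← Set.ncard_coe_finset]
  refine Set.ncard_congr (fun i _ => ((i : ℕ) : ℤ) - X) ?_ ?_ ?_
  · intro i hi
    have := i.2
    simp only [Finset.coe_filter, Finset.mem_Ico, Set.mem_ofPred_eq]
    exact ⟨⟨by omega, by omega⟩, hi⟩
  · intro i j _ _ h
    apply Fin.ext
    omega
  · intro x hx
    simp only [Finset.coe_filter, Finset.mem_Ico, Set.mem_ofPred_eq] at hx
    refine ⟨⟨(x + X).toNat, by omega⟩, ?_, ?_⟩
    · simp only [Set.mem_ofPred_eq]
      rw [show (((x + X).toNat : ℕ) : ℤ) - X = x by omega]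
      exact hx.2
    · simp only
      omega

theorem exists_cellCount_le (h : TValid M z) : ∃ a : ℕ → ZMod 5,
    (∀ s, (M.run (strm a) s).1 ∉ M.rej) ∧
    ∀ j, cellCount (freeTiles Q C) z (5 ^ j) ≤ (digitSum a j + 1) * 5 ^ j := by
  classical
  obtain ⟨a, h1, h2⟩ := h.exists_digits
  refine ⟨a, h2, fun j => ?_⟩
  obtain ⟨X, Y, hs, hb⟩ := h1 j
  have hsub : {p : Fin (5 ^ j) × Fin (5 ^ j) | z (p.1 : ℕ) (p.2 : ℕ) ∈ freeTiles Q C} ⊆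
      ({i : Fin (5 ^ j) | Free a j ((i : ℕ) - X)} ∪
        {i : Fin (5 ^ j) | (5 : ℤ) ^ j ∣ ((i : ℕ) - X)}) ×ˢ Set.univ := by
    rintro ⟨i, i'⟩ hp
    refine ⟨?_, trivial⟩
    by_cases hd : (5 : ℤ) ^ j ∣ ((i : ℕ) - X)
    · exact Or.inr hd
    left
    obtain ⟨r, hr, hl⟩ := not_dvd_exists_lv hd
    refine ⟨r, hr, hl, ?_⟩
    have h3 := hs.d_eq r hr _ hl
    have h4 := hb r hr _ ((i' : ℕ) - Y) hl
    have h5 : (z (((i : ℕ) : ℤ) - X + X) (((i' : ℕ) : ℤ) - Y + Y)).d =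
        (z (((i : ℕ) : ℤ) - X + X) (0 + Y)).d := h.d_const _ _ _
    rw [sub_add_cancel, sub_add_cancel] at h4 h5
    dsimp only at h3
    rw [sub_add_cancel] at h3
    rw [← h4, ← h3, ← h5]
    exact hp
  refine (Set.ncard_le_ncard hsub (Set.toFinite _)).trans ?_
  rw [Set.ncard_prod, Set.ncard_univ, Nat.card_fin]
  refine Nat.mul_le_mul_right _ ((Set.ncard_union_le _ _).trans (add_le_add ?_ ?_))
  · rw [ncard_fin_eq_card (5 ^ j) (Free a j) X]
    push_cast
    rw [card_free a le_rfl, digitSum]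
  · rw [Set.ncard_le_one (Set.toFinite _)]
    intro i hi i' hi'
    have h3 := dvd_sub hi hi'
    rw [sub_sub_sub_cancel_right] at h3
    apply Fin.ext
    have := i.2
    have := i'.2
    have h4 := Int.eq_zero_of_abs_lt_dvd h3 (by
      rw [abs_lt]
      have : ((5 ^ j : ℕ) : ℤ) = 5 ^ j := by push_cast; rfl
      constructor <;> omega)
    omega

theorem le_cellCount_config (M : AM Q C) (a : ℕ → ZMod 5) (j : ℕ) :
    digitSum a j * 5 ^ j ≤ cellCount (freeTiles Q C) (config M a) (5 ^ j) := by
  classical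
  have hsub : {i : Fin (5 ^ j) | Free a j ((i : ℕ) - 0)} ×ˢ (Set.univ : Set (Fin (5 ^ j))) ⊆
      {p : Fin (5 ^ j) × Fin (5 ^ j) |
        config M a (p.1 : ℕ) (p.2 : ℕ) ∈ freeTiles Q C} := by
    rintro ⟨i, i'⟩ ⟨hi, -⟩
    rw [Set.mem_ofPred_eq, sub_zero] at hi
    exact config_free M a hi _
  have h1 := Set.ncard_le_ncard hsub (Set.toFinite _)
  rw [Set.ncard_prod, Set.ncard_univ, Nat.card_fin, ncard_fin_eq_card (5 ^ j) (Free a j) 0] at h1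
  push_cast at h1
  rw [card_free a le_rfl] at h1
  exact h1

end Count

section Interface

open Filter Topology

/-- The configurations with prescribed horizontal and vertical adjacency relations. -/
def Adj {S : Type*} (HR VR : S → S → Prop) : Set (ℤ → ℤ → S) :=
  {z | (∀ x y, HR (z (x - 1) y) (z x y)) ∧ ∀ x y, VR (z x (y - 1)) (z x y)}

/-- The number of patterns on the window `[0, n)²`. -/
noncomputable def sqCount {S : Type*} (Z : Set (ℤ → ℤ → S)) (n : ℕ) : ℕ :=
  {p : Fin n → Fin n → S | ∃ z ∈ Z, ∀ i i', p i i' = z (i : ℕ) (i' : ℕ)}.ncard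

theorem tendsto_window_bound (t : ℝ) : Tendsto (fun j : ℕ =>
    ((2 * j * Real.logb 2 5 + 6 * 5 ^ j * t) / (5 ^ j * 5 ^ j : ℝ))) atTop (𝓝 0) := by
  have h1 : Tendsto (fun j : ℕ => (j : ℝ) * (1 / 5) ^ j) atTop (𝓝 0) :=
    tendsto_self_mul_const_pow_of_lt_one (by norm_num) (by norm_num)
  have h2 : Tendsto (fun j : ℕ => ((1 : ℝ) / 5) ^ j) atTop (𝓝 0) :=
    tendsto_pow_atTop_nhds_zero_of_lt_one (by norm_num) (by norm_num)
  have h3 := ((h1.mul h2).const_mul (2 * Real.logb 2 5)).add (h2.const_mul (6 * t))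
  simp only [mul_zero, add_zero] at h3
  refine h3.congr fun j => ?_
  rw [one_div, inv_pow]
  field_simp

theorem exists_adjacency {N D : ℕ → ℕ} {θ : ℝ} (hN : Computable N) (hDc : Computable D)
    (hD : ∀ n, 0 < D n) (hle : ∀ n, θ ≤ (N n : ℝ) / D n)
    (hlim : Tendsto (fun n => (N n : ℝ) / D n) atTop (𝓝 θ)) (h0 : 0 ≤ θ) (h1 : θ < 1) :
    ∃ (S : Type) (_ : Finite S) (HR VR : S → S → Prop) (E : Set S),
      (∀ ε > 0, ∀ n₀ : ℕ, ∃ n ≥ n₀, 0 < n ∧ (sqCount (Adj HR VR) n : ℝ) ≤ 2 ^ (ε * (n : ℝ) ^ 2) ∧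
        ∀ z ∈ Adj HR VR, (cellCount E z n : ℝ) ≤ (θ + ε) * (n : ℝ) ^ 2) ∧
      ∃ z ∈ Adj HR VR, ∀ ε > 0, ∀ n₀ : ℕ, ∃ n ≥ n₀, 0 < n ∧
        (θ - ε) * (n : ℝ) ^ 2 ≤ cellCount E z n := by
  obtain ⟨Q, C, _, _, M, hM⟩ := exists_am (Excessive N D) (computablePred_excessive hN hDc)
  have hAdj : ∀ z, z ∈ Adj (HRule M) (VRule M) ↔ TValid M z :=
    fun z => ⟨fun h => ⟨h.1, h.2⟩, fun h => ⟨h.hr, h.vr⟩⟩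
  have hpos : ∀ j : ℕ, (0 : ℝ) < 5 ^ j := fun j => by positivity
  have hsmall : ∀ ε > (0 : ℝ), ∀ᶠ j : ℕ in atTop, (1 : ℝ) ≤ ε * 5 ^ j := fun ε hε =>
    ((tendsto_pow_atTop_atTop_of_one_lt (by norm_num : (1 : ℝ) < 5)).const_mul_atTop
      hε).eventually_ge_atTop 1
  refine ⟨Tile Q C, inferInstance, HRule M, VRule M, freeTiles Q C, fun ε hε n₀ => ?_,
    config M (digits5 θ), ?_, fun ε hε n₀ => ?_⟩
  · set t := Real.logb 2 (Nat.card (Tile Q C)) with ht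
    obtain ⟨j, hj1, hj2, hj3⟩ := ((hsmall ε hε).and
      (((tendsto_window_bound t).eventually_le_const hε).and (eventually_ge_atTop n₀))).exists
    refine ⟨5 ^ j, hj3.trans (Nat.lt_pow_self (by norm_num)).le, by positivity, ?_,
      fun z hz => ?_⟩
    · have h2 := TValid.ncard_patterns_le M j
      have h3 : (sqCount (Adj (HRule M) (VRule M)) (5 ^ j) : ℝ) ≤
          5 ^ j * 5 ^ j * (Nat.card (Tile Q C) : ℝ) ^ (6 * 5 ^ j) := by
        simp only [sqCount, hAdj]
        exact_mod_cast h2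
      rw [div_le_iff₀ (by positivity)] at hj2
      refine h3.trans ?_
      rcases Nat.eq_zero_or_pos (Nat.card (Tile Q C)) with hc | hc
      · rw [hc]
        simp only [Nat.cast_zero]
        rw [zero_pow (by positivity), mul_zero]
        positivity
      · have hc' : (0 : ℝ) < Nat.card (Tile Q C) := by exact_mod_cast hc
        rw [← Real.logb_le_iff_le_rpow (by norm_num) (by positivity),
          Real.logb_mul (by positivity) (by positivity), Real.logb_mul (by positivity)
          (by positivity), Real.logb_pow, Real.logb_pow, ← ht]
        push_cast
        calc _ = 2 * j * Real.logb 2 5 + 6 * 5 ^ j * t := by ring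
          _ ≤ _ := hj2
          _ = _ := by ring
    · obtain ⟨a, ha, h2⟩ := exists_cellCount_le ((hAdj z).1 hz)
      have h3 := digitSum_le_of_not_excessive hD hlim ((hM (strm a)).1 ha) j
      have h4 : (cellCount (freeTiles Q C) z (5 ^ j) : ℝ) ≤ (digitSum a j + 1) * 5 ^ j := by
        exact_mod_cast h2 j
      refine h4.trans ?_
      push_cast
      calc _ ≤ (θ * 5 ^ j + ε * 5 ^ j) * 5 ^ j := by gcongr
        _ = _ := by ring
  · rw [hAdj]
    refine config_valid M _ ((hM _).2 fun T => not_excessive_digits5 h0 h1 hD hle _)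
  · obtain ⟨j, hj1, hj2⟩ := ((hsmall ε hε).and (eventually_ge_atTop n₀)).exists
    refine ⟨5 ^ j, hj2.trans (Nat.lt_pow_self (by norm_num)).le, by positivity, ?_⟩
    have h2 : (digitSum (digits5 θ) j : ℝ) * 5 ^ j ≤
        cellCount (freeTiles Q C) (config M (digits5 θ)) (5 ^ j) := by
      exact_mod_cast le_cellCount_config M (digits5 θ) j
    refine le_trans ?_ h2
    rw [digitSum_digits5 h1]
    have h3 := (Nat.lt_floor_add_one (θ * 5 ^ j)).le
    push_cast
    calc _ = (θ * 5 ^ j - ε * 5 ^ j) * 5 ^ j := by ring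
      _ ≤ _ := by gcongr; linarith

end Interface

end HEnt

namespace HEnt

open Filter Topology

section Paths

variable {V : Type*} (E : V → V → Prop)

/-- Paths with `n` vertices inside a set `S` of vertices. -/
def pathsIn (S : Set V) (n : ℕ) : Set (Fin n → V) :=
  {p | (∀ i, p i ∈ S) ∧ ∀ (i : ℕ) (h : i + 1 < n), E (p ⟨i, by omega⟩) (p ⟨i + 1, h⟩)}

/-- Closed paths of length `i` at the vertex `v`. -/
def loopsAt (v : V) (i : ℕ) : Set (Fin (i + 1) → V) :=
  {p | p ∈ pathsIn E Set.univ (i + 1) ∧ p 0 = v ∧ p (Fin.last i) = v}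

theorem exists_lastVisit {S : Set V} {n : ℕ} {p : Fin (n + 1) → V} (hp : p ∈ pathsIn E S (n + 1)) :
    ∃ v ∈ S, ∃ (i : ℕ) (hi : i < n + 1),
      (fun t : Fin (i + 1) => p ⟨t, by omega⟩) ∈ loopsAt E v i ∧
      (fun t : Fin (n - i) => p ⟨i + 1 + t, by omega⟩) ∈ pathsIn E (S \ {v}) (n - i) := by
  classical
  set P : ℕ → Prop := fun i => ∃ h : i < n + 1, p ⟨i, h⟩ = p 0 with hP
  have h0 : P 0 := ⟨by omega, rfl⟩
  obtain ⟨hi, hpi⟩ := Nat.findGreatest_spec (P := P) (Nat.zero_le n) h0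
  set i := Nat.findGreatest P n
  refine ⟨p 0, hp.1 _, i, hi, ⟨⟨fun _ => trivial, fun t ht => hp.2 t (by omega)⟩, rfl, hpi⟩,
    fun t => ⟨hp.1 _, fun h => ?_⟩, fun t ht => ?_⟩
  · exact Nat.findGreatest_is_greatest (P := P) (n := n) (k := i + 1 + t)
      (by omega) (by omega) ⟨by omega, h⟩
  · exact hp.2 (i + 1 + t) (by omega)

theorem ncard_pathsIn_succ_le [Finite V] (S : Set V) (n : ℕ) : (pathsIn E S (n + 1)).ncard ≤
    ∑ v ∈ S.toFinite.toFinset, ∑ i ∈ Finset.range (n + 1),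
      (loopsAt E v i).ncard * (pathsIn E (S \ {v}) (n - i)).ncard := by
  classical
  set A : V → ℕ → Set (Fin (n + 1) → V) := fun v i => {p | ∃ (hi : i < n + 1),
      (fun t : Fin (i + 1) => p ⟨t, by omega⟩) ∈ loopsAt E v i ∧
      (fun t : Fin (n - i) => p ⟨i + 1 + t, by omega⟩) ∈ pathsIn E (S \ {v}) (n - i)} with hA
  have hcov : pathsIn E S (n + 1) ⊆
      ⋃ v ∈ S.toFinite.toFinset, ⋃ i ∈ Finset.range (n + 1), A v i := by
    intro p hp
    obtain ⟨v, hv, i, hi, h⟩ := exists_lastVisit E hp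
    simp only [Set.mem_iUnion]
    exact ⟨v, by simpa using hv, i, by simpa using hi, hi, h⟩
  refine (Set.ncard_le_ncard hcov (Set.toFinite _)).trans ?_
  refine (Finset.set_ncard_biUnion_le _ _).trans (Finset.sum_le_sum fun v _ => ?_)
  refine (Finset.set_ncard_biUnion_le _ _).trans (Finset.sum_le_sum fun i hi => ?_)
  have hi' := Finset.mem_range.1 hi
  rw [← Set.ncard_prod]
  refine Set.ncard_le_ncard_of_injOn
    (fun p => ((fun t : Fin (i + 1) => p ⟨t, by omega⟩),
      (fun t : Fin (n - i) => p ⟨i + 1 + t, by omega⟩))) ?_ ?_ (Set.toFinite _)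
  · rintro p ⟨_, h1, h2⟩
    exact ⟨h1, h2⟩
  · rintro p - p' - h
    rw [Prod.mk.injEq] at h
    funext ⟨t, ht⟩
    by_cases hti : t < i + 1
    · exact congrFun h.1 ⟨t, hti⟩
    · have := congrFun h.2 ⟨t - (i + 1), by omega⟩
      simp only [show i + 1 + (t - (i + 1)) = t by omega] at this
      exact this

theorem ncard_pathsIn_le [Finite V] {C L : ℝ} (hC : 1 ≤ C) (hL : 1 ≤ L)
    (h : ∀ v i, ((loopsAt E v i).ncard : ℝ) ≤ C * L ^ i) (S : Set V) (n : ℕ) :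
    ((pathsIn E S n).ncard : ℝ) ≤ ((Nat.card V + 1) * C * (n + 1)) ^ S.ncard * L ^ n := by
  obtain ⟨s, hs⟩ : ∃ s, s = S.ncard := ⟨_, rfl⟩
  rw [← hs]
  have hone : ∀ x : ℝ, 0 ≤ x → 1 ≤ (Nat.card V + 1) * C * (x + 1) := fun x hx => by
    have : (0 : ℝ) ≤ Nat.card V := by positivity
    nlinarith [mul_nonneg this (zero_le_one.trans hC), mul_nonneg (mul_nonneg this
      (zero_le_one.trans hC)) hx]
  induction s generalizing S n with
  | zero =>
    rw [eq_comm, Set.ncard_eq_zero] at hs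
    have : (pathsIn E S n).ncard ≤ 1 := by
      rw [Set.ncard_le_one (Set.toFinite _)]
      intro p hp p' hp'
      funext i
      have := hp.1 i
      simp [hs] at this
    have h1 : (1 : ℝ) ≤ L ^ n := one_le_pow₀ hL
    rw [pow_zero, one_mul]
    exact le_trans (by exact_mod_cast this) h1
  | succ s ih =>
    cases n with
    | zero =>
      have : (pathsIn E S 0).ncard ≤ 1 := by
        rw [Set.ncard_le_one (Set.toFinite _)]
        intro p hp p' hp'
        exact Subsingleton.elim _ _
      rw [pow_zero, mul_one]
      refine le_trans (by exact_mod_cast this) (one_le_pow₀ (hone _ (by positivity)))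
    | succ n =>
      have h1 : ((pathsIn E S (n + 1)).ncard : ℝ) ≤
          ∑ v ∈ S.toFinite.toFinset, ∑ i ∈ Finset.range (n + 1),
          ((loopsAt E v i).ncard : ℝ) * ((pathsIn E (S \ {v}) (n - i)).ncard : ℝ) := by
        exact_mod_cast ncard_pathsIn_succ_le E S n
      set B : ℝ := (Nat.card V + 1) * C * ((n + 1 : ℕ) + 1) with hB
      have hB1 : 1 ≤ B := hone _ (by positivity)
      have h2 : ∀ v ∈ S.toFinite.toFinset, ∀ i ∈ Finset.range (n + 1),
          ((loopsAt E v i).ncard : ℝ) * ((pathsIn E (S \ {v}) (n - i)).ncard : ℝ) ≤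
          C * B ^ s * L ^ n := by
        intro v hv i hi
        have hi' : i ≤ n := Nat.lt_succ_iff.1 (Finset.mem_range.1 hi)
        have hv' : v ∈ S := by simpa using hv
        have h3 := ih (S \ {v}) (n - i) (by rw [Set.ncard_sdiff_singleton_of_mem hv', ← hs]; rfl)
        have h4 : ((Nat.card V + 1) * C * (((n - i : ℕ) : ℝ) + 1)) ≤ B := by
          rw [hB]
          gcongr
          omega
        calc _ ≤ (C * L ^ i) * (B ^ s * L ^ (n - i)) := by
              refine mul_le_mul (h v i) (h3.trans ?_) (by positivity) (by positivity)
              gcongr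
          _ = C * B ^ s * (L ^ i * L ^ (n - i)) := by ring
          _ = _ := by rw [← pow_add, Nat.add_sub_cancel' hi']
      refine (h1.trans (Finset.sum_le_sum fun v hv => Finset.sum_le_sum (h2 v hv))).trans ?_
      rw [Finset.sum_const, Finset.sum_const, ← Set.ncard_eq_toFinset_card, Finset.card_range,
        nsmul_eq_mul, nsmul_eq_mul]
      have h5 : (S.ncard : ℝ) ≤ Nat.card V + 1 := by
        have := Set.ncard_le_card S
        exact_mod_cast this.trans (Nat.le_succ _)
      have h6 : L ^ n ≤ L ^ (n + 1) := pow_le_pow_right₀ hL (Nat.le_succ n)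
      calc (S.ncard : ℝ) * (((n + 1 : ℕ) : ℝ) * (C * B ^ s * L ^ n))
          ≤ (Nat.card V + 1) * (((n + 1 : ℕ) + 1 : ℝ) * (C * B ^ s * L ^ (n + 1))) := by
            gcongr
            linarith
        _ = B ^ (s + 1) * L ^ (n + 1) := by rw [pow_succ, hB]; ring

end Paths

section Windows

variable {A : Type*} {m : ℕ} {P : Set (Fin m → A)}

/-- The window of width `m` of a sequence at a position. -/
def windowAt (m : ℕ) (x : ℤ → A) (i : ℤ) : Fin m → A := fun t => x (i + (t : ℕ))

/-- The sequences all of whose windows of width `m` lie in `P`. -/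
def WindowSFT (P : Set (Fin m → A)) : Set (ℤ → A) := {x | ∀ i, windowAt m x i ∈ P}

theorem exists_windowSFT {H : Set (ℤ → A)} (hH : IsSFT1 H) :
    ∃ (m : ℕ) (_ : 0 < m) (P : Set (Fin m → A)), H = WindowSFT P := by
  obtain ⟨F, rfl⟩ := hH
  refine ⟨F.sup List.length + 1, Nat.succ_pos _,
    {v | ∃ x ∈ SFT1 F, ∀ t : Fin _, v t = x (t : ℕ)}, ?_⟩
  ext x
  constructor
  · intro hx i
    refine ⟨fun j => x (i + j), ?_, fun t => rfl⟩
    rintro w hw ⟨j, hj⟩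
    refine hx w hw ⟨i + j, fun n h => ?_⟩
    rw [← hj n h, add_assoc]
  · rintro h w hw ⟨j, hj⟩
    obtain ⟨y, hy, hyx⟩ := h j
    have hlen : w.length ≤ F.sup List.length := Finset.le_sup hw
    refine hy w hw ⟨0, fun n hn => ?_⟩
    rw [← hj n hn, zero_add]
    exact (hyx ⟨n, by omega⟩).symm

theorem WindowSFT.shift {x : ℤ → A} (hx : x ∈ WindowSFT P) (c : ℤ) :
    (fun i => x (i + c)) ∈ WindowSFT P := fun i => by
  have := hx (i + c)
  refine (congrArg (· ∈ P) ?_).mp this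
  funext t
  change x _ = x _
  congr 1
  ring

/-- The periodic points of period `l` whose first window is `a`. -/
def loopPoints (P : Set (Fin m → A)) (a : Fin m → A) (l : ℕ) : Set (ℤ → A) :=
  {x | x ∈ WindowSFT P ∧ (∀ i, x (i + l) = x i) ∧ windowAt m x 0 = a}

theorem periodic_add_mul {x : ℤ → A} {l : ℕ} (h : ∀ i, x (i + l) = x i) (i c : ℤ) :
    x (i + l * c) = x i := by
  have : Function.Periodic x (l : ℤ) := h
  rw [mul_comm]
  exact this.int_mul c i

theorem periodic_emod {x : ℤ → A} {l : ℕ} (h : ∀ i, x (i + l) = x i) (i : ℤ) :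
    x (i % l) = x i := by
  rw [← periodic_add_mul h (i % l) (i / l), Int.emod_add_mul_ediv]

theorem finite_periodic [Finite A] {l : ℕ} (hl : 0 < l) :
    {x : ℤ → A | ∀ i, x (i + l) = x i}.Finite := by
  refine Set.Finite.of_finite_image (f := fun x (t : Fin l) => x (t : ℕ)) (Set.toFinite _) ?_
  intro x hx y hy hxy
  funext i
  have h1 := Int.emod_nonneg i (show (l : ℤ) ≠ 0 by omega)
  have h2 := Int.emod_lt_of_pos i (show (0 : ℤ) < l by omega)
  have h3 := congrFun hxy ⟨(i % l).toNat, by omega⟩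
  simp only [Int.toNat_of_nonneg h1] at h3
  rw [← periodic_emod hx, ← periodic_emod hy, h3]

theorem finite_loopPoints [Finite A] (a : Fin m → A) {l : ℕ} (hl : 0 < l) :
    (loopPoints P a l).Finite := (finite_periodic hl).subset fun _ h => h.2.1

theorem loopPoints_apply {a : Fin m → A} {l : ℕ} {x : ℤ → A} (h : x ∈ loopPoints P a l) (q : ℤ)
    (t : Fin m) : x (l * q + (t : ℕ)) = a t := by
  rw [add_comm, periodic_add_mul h.2.1, ← h.2.2, windowAt, zero_add]

theorem concat_mem {a : Fin m → A} {l : ℕ} (hl : 0 < l) {B : ℤ → ℤ → A}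
    (hB : ∀ q, B q ∈ loopPoints P a l) : (fun i => B (i / l) i) ∈ WindowSFT P := by
  intro i
  have hl' : (0 : ℤ) < l := by omega
  have key : windowAt m (fun i => B (i / l) i) i = windowAt m (B (i / l)) i := by
    funext t
    have ht := t.2
    change B ((i + (t : ℕ)) / l) (i + (t : ℕ)) = B (i / l) (i + (t : ℕ))
    have h1 := Int.emod_add_mul_ediv i l
    have h2 := Int.emod_nonneg i hl'.ne'
    have h3 := Int.emod_lt_of_pos i hl'
    by_cases hc : i % l + (t : ℕ) < l
    · have : (i + (t : ℕ)) / l = i / l := by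
        rw [show i + ((t : ℕ) : ℤ) = (i % l + (t : ℕ)) + l * (i / l) by linarith,
          Int.add_mul_ediv_left _ _ hl'.ne', Int.ediv_eq_zero_of_lt (by omega) hc, zero_add]
      rw [this]
    · set s : ℕ := (i % l + (t : ℕ) - l).toNat with hs
      have hs' : (s : ℤ) = i % l + (t : ℕ) - l := Int.toNat_of_nonneg (by omega)
      have hi : i + ((t : ℕ) : ℤ) = l * (i / l + 1) + (s : ℕ) := by rw [hs']; linarith
      rw [hi, loopPoints_apply (hB _) _ ⟨s, by omega⟩, loopPoints_apply (hB _) _ ⟨s, by omega⟩]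
  rw [key]
  exact (hB _).1 i

/-- The transition relation between overlapping windows. -/
def windowStep (P : Set (Fin m → A)) (v v' : Fin m → A) : Prop :=
  v ∈ P ∧ ∀ (t : ℕ) (h : t + 1 < m), v' ⟨t, by omega⟩ = v ⟨t + 1, h⟩

theorem ncard_loopsAt_le [Finite A] (hm : 0 < m) (a : Fin m → A) {l : ℕ} (hl : 0 < l) :
    (loopsAt (windowStep P) a l).ncard ≤ (loopPoints P a l).ncard := by
  have hl' : (0 : ℤ) < l := by omega
  have hlt : ∀ i : ℤ, (i % l).toNat < l + 1 := fun i => by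
    have h2 := Int.emod_nonneg i hl'.ne'
    have h3 := Int.emod_lt_of_pos i hl'
    omega
  set g : (Fin (l + 1) → Fin m → A) → ℤ → Fin m → A := fun p i => p ⟨(i % l).toNat, hlt i⟩ with hg
  have hstep : ∀ p ∈ loopsAt (windowStep P) a l, ∀ i, windowStep P (g p i) (g p (i + 1)) := by
    rintro p ⟨h1, h2, h3⟩ i
    have h4 := Int.emod_nonneg i hl'.ne'
    have h5 := Int.emod_lt_of_pos i hl'
    have h6 := h1.2 (i % l).toNat (by omega)
    convert h6 using 1
    by_cases hc : i % l + 1 < l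
    · simp only [hg]
      congr 2
      rw [← Int.emod_add_emod, Int.emod_eq_of_lt (by omega) hc]
      omega
    · have h7 : i % l + 1 = l := by omega
      simp only [hg, ← Int.emod_add_emod, h7, Int.emod_self]
      rw [show (⟨(i % l).toNat + 1, by omega⟩ : Fin (l + 1)) = Fin.last l by
        apply Fin.ext; simp; omega, h3]
      exact h2
  have hval : ∀ p ∈ loopsAt (windowStep P) a l, ∀ (t : ℕ) (ht : t < m) (i : ℤ),
      g p (i + t) ⟨0, hm⟩ = g p i ⟨t, ht⟩ := by
    intro p hp t
    induction t with
    | zero => intro ht i; simp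
    | succ t ih =>
      intro ht i
      rw [show i + ((t + 1 : ℕ) : ℤ) = (i + 1) + t by push_cast; ring, ih (by omega)]
      exact (hstep p hp i).2 t ht
  have hwin : ∀ p ∈ loopsAt (windowStep P) a l, ∀ i,
      windowAt m (fun i => g p i ⟨0, hm⟩) i = g p i := fun p hp i => by
    funext t
    exact hval p hp t t.2 i
  refine Set.ncard_le_ncard_of_injOn (fun p i => g p i ⟨0, hm⟩) ?_ ?_ (finite_loopPoints a hl)
  · intro p hp
    refine ⟨fun i => ?_, fun i => ?_, ?_⟩
    · rw [hwin p hp]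
      exact (hstep p hp i).1
    · simp [hg]
    · rw [hwin p hp]
      simpa [hg] using hp.2.1
  · intro p hp p' hp' h
    have h1 : g p = g p' := by
      funext i
      rw [← hwin p hp, ← hwin p' hp']
      exact congrFun (congrArg (windowAt m) h) i
    funext ⟨t, ht⟩
    by_cases hc : t < l
    · have h2 := congrFun h1 t
      simp only [hg] at h2
      convert h2 using 3 <;>
      · rw [Int.emod_eq_of_lt (by omega) (by omega)]; simp
    · have h2 : (⟨t, ht⟩ : Fin (l + 1)) = Fin.last l := by
        apply Fin.ext
        simp
        omega
      rw [h2, hp.2.2, hp'.2.2]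

theorem wordCount_eq {H : Set (ℤ → A)} (hH : ∀ x ∈ H, ∀ c : ℤ, (fun i => x (i + c)) ∈ H) (n : ℕ) :
    wordCount H n = {p : Fin n → A | ∃ x ∈ H, ∀ i : Fin n, x (i : ℕ) = p i}.ncard := by
  rw [wordCount, ← Set.ncard_image_of_injective _ List.ofFn_injective]
  congr 1
  ext w
  constructor
  · rintro ⟨rfl, x, hx, j, hj⟩
    refine ⟨w.get, ⟨_, hH x hx j, fun i => ?_⟩, List.ofFn_get w⟩
    rw [← hj i i.2, add_comm]
  · rintro ⟨p, ⟨x, hx, hp⟩, rfl⟩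
    refine ⟨by simp, x, hx, 0, fun t ht => ?_⟩
    rw [zero_add]
    have := hp ⟨t, by simpa using ht⟩
    simpa using this

theorem wordCount_le [Finite A] (hm : 0 < m) (n : ℕ) : wordCount (WindowSFT P) (n + m) ≤
    (pathsIn (windowStep P) Set.univ (n + 1)).ncard := by
  rw [wordCount_eq fun x hx c => WindowSFT.shift hx c]
  refine Set.ncard_le_ncard_of_injOn
    (fun w => fun (i : Fin (n + 1)) (t : Fin m) => w ⟨i + t, by omega⟩) ?_ ?_ (Set.toFinite _)
  · rintro w ⟨x, hx, hw⟩
    refine ⟨fun _ => trivial, fun i hi => ⟨?_, fun t ht => ?_⟩⟩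
    · convert hx i using 1
      funext t
      exact (hw _).symm.trans (by simp [windowAt])
    · exact congrArg w (Fin.ext (by simp only; omega))
  · intro w _ w' _ h
    funext ⟨i, hi⟩
    by_cases hc : i < n + 1
    · simpa using congrFun (congrFun h ⟨i, hc⟩) ⟨0, hm⟩
    · have := congrFun (congrFun h ⟨n, by omega⟩) ⟨i - n, by omega⟩
      simp only [show n + (i - n) = i by omega] at this
      exact this

end Windows

section Entropy

theorem le_of_forall_mul_le {a b c d : ℝ} {k : ℝ} (hk : 0 < k)
    (h : ∀ n : ℕ, a * n ≤ b * n + c + d * Real.logb 2 (k * (n + 2))) : a ≤ b := by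
  have h1 : Tendsto (fun n : ℕ => Real.log ((n : ℝ) + 2) / ((n : ℝ) + 2)) atTop (𝓝 0) :=
    (Real.isLittleO_log_id_atTop.tendsto_div_nhds_zero).comp
      (tendsto_atTop_add_const_right _ 2 tendsto_natCast_atTop_atTop)
  have h2 : Tendsto (fun n : ℕ => ((n : ℝ) + 2)⁻¹) atTop (𝓝 0) :=
    tendsto_inv_atTop_zero.comp (tendsto_atTop_add_const_right _ 2 tendsto_natCast_atTop_atTop)
  have h3 := (h2.const_mul (c + 2 * a - 2 * b + d * (Real.log k / Real.log 2))).add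
    (h1.const_mul (d / Real.log 2))
  simp only [mul_zero, add_zero] at h3
  have h4 := h3.const_add b
  rw [add_zero] at h4
  refine ge_of_tendsto' h4 fun n => ?_
  have h5 : (0 : ℝ) < (n : ℝ) + 2 := by positivity
  have h6 := h n
  rw [Real.logb, Real.log_mul hk.ne' h5.ne'] at h6
  rw [← sub_nonneg]
  have : b + ((c + 2 * a - 2 * b + d * (Real.log k / Real.log 2)) * ((n : ℝ) + 2)⁻¹ +
      d / Real.log 2 * (Real.log ((n : ℝ) + 2) / ((n : ℝ) + 2))) - a =
      (b * n + c + d * ((Real.log k + Real.log ((n : ℝ) + 2)) / Real.log 2) - a * n) /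
        ((n : ℝ) + 2) := by
    field_simp
    ring
  rw [this]
  exact div_nonneg (by linarith) h5.le

variable {A : Type*} {m : ℕ} {P : Set (Fin m → A)}

theorem entropy1_nonneg_terms (H : Set (ℤ → A)) (n : ℕ) :
    0 ≤ Real.logb 2 (wordCount H (n + 1)) / ((n : ℝ) + 1) := by
  refine div_nonneg ?_ (by positivity)
  rcases Nat.eq_zero_or_pos (wordCount H (n + 1)) with h | h
  · simp [h]
  · exact Real.logb_nonneg (by norm_num) (by exact_mod_cast h)

theorem entropy1_mul_le (H : Set (ℤ → A)) {n : ℕ} (hn : 0 < n) :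
    entropy1 H * n ≤ Real.logb 2 (wordCount H n) := by
  obtain ⟨n, rfl⟩ := Nat.exists_eq_add_of_lt hn
  rw [zero_add]
  have h1 : entropy1 H ≤ Real.logb 2 (wordCount H (n + 1)) / ((n : ℝ) + 1) :=
    ciInf_le ⟨0, by rintro _ ⟨n, rfl⟩; exact entropy1_nonneg_terms H n⟩ n
  rw [le_div_iff₀ (by positivity)] at h1
  exact_mod_cast h1

theorem entropy1_nonneg (H : Set (ℤ → A)) : 0 ≤ entropy1 H :=
  le_ciInf fun n => entropy1_nonneg_terms H n

theorem exists_loopPoints [Finite A] (hm : 0 < m) {h : ℝ} (h0 : 0 ≤ h) (hh : h < entropy1 (WindowSFT P)) :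
    ∃ (a : Fin m → A) (l : ℕ), 0 < l ∧ (2 : ℝ) ^ (h * l) < (loopPoints P a l).ncard := by
  by_contra! hcon
  refine hh.not_ge ?_
  set C : ℝ := 1 + Nat.card (Fin m → A) with hC
  have hC1 : 1 ≤ C := by rw [hC]; linarith [Nat.cast_nonneg (α := ℝ) (Nat.card (Fin m → A))]
  have hL : (1 : ℝ) ≤ 2 ^ h := Real.one_le_rpow (by norm_num) h0
  have hloop : ∀ (v : Fin m → A) i, ((loopsAt (windowStep P) v i).ncard : ℝ) ≤ C * (2 ^ h) ^ i := by
    intro v i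
    rcases Nat.eq_zero_or_pos i with rfl | hi
    · have h1 : (loopsAt (windowStep P) v 0).ncard ≤ 1 := by
        rw [Set.ncard_le_one (Set.toFinite _)]
        rintro p ⟨-, hp, -⟩ p' ⟨-, hp', -⟩
        funext t
        rw [show t = 0 from Fin.ext (by omega), hp, hp']
      rw [pow_zero, mul_one]
      exact le_trans (by exact_mod_cast h1) hC1
    · have h1 : ((loopsAt (windowStep P) v i).ncard : ℝ) ≤ (loopPoints P v i).ncard := by
        exact_mod_cast ncard_loopsAt_le hm v hi
      refine (h1.trans (hcon v i hi)).trans ?_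
      rw [Real.rpow_mul (by norm_num), Real.rpow_natCast]
      exact le_mul_of_one_le_left (by positivity) hC1
  set d := (Set.univ : Set (Fin m → A)).ncard
  set B : ℝ := (Nat.card (Fin m → A) + 1) * C with hB
  have hB0 : 0 < B := by positivity
  refine le_of_forall_mul_le (c := h) (d := d) hB0 fun n => ?_
  have h1 : ((wordCount (WindowSFT P) (n + m) : ℕ) : ℝ) ≤
      (B * (n + 2)) ^ d * (2 ^ h) ^ (n + 1) := by
    have h2 := ncard_pathsIn_le (windowStep P) hC1 hL hloop Set.univ (n + 1)
    refine le_trans (by exact_mod_cast wordCount_le hm n) (h2.trans (le_of_eq ?_))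
    push_cast
    ring
  have h2 := entropy1_mul_le (WindowSFT P) (n := n + m) (by omega)
  have hE := entropy1_nonneg (WindowSFT P)
  have h3 : entropy1 (WindowSFT P) * n ≤ entropy1 (WindowSFT P) * ((n + m : ℕ) : ℝ) := by
    push_cast
    nlinarith [mul_nonneg hE (Nat.cast_nonneg (α := ℝ) m)]
  rcases Nat.eq_zero_or_pos (wordCount (WindowSFT P) (n + m)) with hw | hw
  · rw [hw] at h2
    simp only [Nat.cast_zero, Real.logb_zero] at h2
    have h5 : 0 ≤ Real.logb 2 (B * (n + 2)) := Real.logb_nonneg (by norm_num) (by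
      have : (0 : ℝ) ≤ Nat.card (Fin m → A) := by positivity
      have : (0 : ℝ) ≤ n := by positivity
      have : 1 ≤ B := by rw [hB]; nlinarith
      nlinarith)
    have : 0 ≤ h * n := by positivity
    have : 0 ≤ d * Real.logb 2 (B * (n + 2)) := by positivity
    linarith
  · have h4 := Real.logb_le_logb_of_le (b := 2) (by norm_num) (by exact_mod_cast hw) h1
    rw [Real.logb_mul (by positivity) (by positivity), Real.logb_pow, Real.logb_pow,
      Real.logb_rpow (by norm_num) (by norm_num)] at h4
    push_cast at h4
    linarith

theorem exists_blocks [Finite A] (hm : 0 < m) {h : ℝ} (h0 : 0 ≤ h) (hh : h < entropy1 (WindowSFT P)) :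
    ∃ (l q : ℕ) (W : Fin (2 ^ q) → ℤ → A), 0 < l ∧ h * l < q ∧ Function.Injective W ∧
      (∀ c i, W c (i + l) = W c i) ∧
      ∀ B : ℤ → Fin (2 ^ q), (fun i => W (B (i / l)) i) ∈ WindowSFT P := by
  obtain ⟨h', hh1, hh2⟩ := exists_between hh
  obtain ⟨a, l, hl, hcard⟩ := exists_loopPoints hm (h0.trans hh1.le) hh2
  have hl' : (0 : ℝ) < l := by exact_mod_cast hl
  obtain ⟨r, hr⟩ := exists_nat_gt (1 / ((h' - h) * l))
  have hpos : 0 < (h' - h) * l := mul_pos (by linarith) hl'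
  rw [div_lt_iff₀ hpos] at hr
  have hr0 : 0 < r := by
    rcases Nat.eq_zero_or_pos r with rfl | h
    · norm_num at hr
    · exact h
  set q := ⌊h' * l * r⌋₊ with hq
  have hr' : (0 : ℝ) < r := by exact_mod_cast hr0
  have hq1 : (q : ℝ) ≤ h' * l * r := Nat.floor_le (by have := h0.trans hh1.le; positivity)
  have hq2 : h' * l * r < q + 1 := Nat.lt_floor_add_one _
  set L := (loopPoints P a l).ncard with hL
  have hqL : 2 ^ q ≤ L ^ r := by
    have h1 : (2 : ℝ) ^ q ≤ (L : ℝ) ^ r := by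
      calc (2 : ℝ) ^ q = 2 ^ (q : ℝ) := (Real.rpow_natCast _ _).symm
        _ ≤ 2 ^ (h' * l * r) := Real.rpow_le_rpow_of_exponent_le (by norm_num) hq1
        _ = (2 ^ (h' * l)) ^ r := by rw [Real.rpow_mul (by norm_num), Real.rpow_natCast]
        _ ≤ _ := by gcongr
    exact_mod_cast h1
  have hfin := finite_loopPoints (P := P) a hl
  have hcardW : Nat.card (Fin r → loopPoints P a l) = L ^ r := by
    rw [Nat.card_fun, Nat.card_fin, Nat.card_coe_set_eq]
  have := hfin.to_subtype
  have := Fintype.ofFinite (Fin r → loopPoints P a l)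
  obtain ⟨e⟩ : Nonempty (Fin (2 ^ q) ↪ (Fin r → loopPoints P a l)) := by
    rw [Function.Embedding.nonempty_iff_card_le, Fintype.card_fin, ← Nat.card_eq_fintype_card,
      hcardW]
    exact hqL
  have hidx : ∀ i : ℤ, ((i / l) % r).toNat < r := fun i => by
    have := Int.emod_nonneg (i / l) (show (r : ℤ) ≠ 0 by omega)
    have := Int.emod_lt_of_pos (i / l) (show (0 : ℤ) < r by omega)
    omega
  have hdiv : ∀ i : ℤ, i / ((l * r : ℕ) : ℤ) = i / l / r := fun i => by
    push_cast
    rw [Int.ediv_ediv_of_nonneg (by omega)]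
  refine ⟨l * r, q, fun c i => (e c ⟨_, hidx i⟩ : ℤ → A) i, Nat.mul_pos hl hr0, ?_, ?_, ?_, ?_⟩
  · push_cast
    linarith
  · intro c c' hcc
    refine e.injective ?_
    funext ⟨t, ht⟩
    apply Subtype.ext
    funext i
    have h1 := Int.emod_nonneg i (show (l : ℤ) ≠ 0 by omega)
    have h2 := Int.emod_lt_of_pos i (show (0 : ℤ) < l by omega)
    have h3 : (⟨_, hidx (i % l + l * t)⟩ : Fin r) = ⟨t, ht⟩ := by
      apply Fin.ext
      simp only
      rw [Int.add_mul_ediv_left _ _ (by omega), Int.ediv_eq_zero_of_lt h1 h2, zero_add,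
        Int.emod_eq_of_lt (by omega) (by omega), Int.toNat_natCast]
    have h4 := congrFun hcc (i % l + l * t)
    simp only [h3] at h4
    rw [periodic_add_mul (e c _).2.2.1, periodic_add_mul (e c' _).2.2.1,
      periodic_emod (e c _).2.2.1, periodic_emod (e c' _).2.2.1] at h4
    exact h4
  · intro c i
    have h1 : (i + ((l * r : ℕ) : ℤ)) / l = i / l + r := by
      push_cast
      rw [Int.add_mul_ediv_left _ _ (by omega)]
    simp only [h1, Int.add_emod_right]
    push_cast
    exact periodic_add_mul (e c _).2.2.1 _ _
  · intro B
    have hj : ∀ j : ℤ, (j % r).toNat < r := fun j => by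
      have := Int.emod_nonneg j (show (r : ℤ) ≠ 0 by omega)
      have := Int.emod_lt_of_pos j (show (0 : ℤ) < r by omega)
      omega
    simp only [hdiv]
    exact concat_mem (a := a) hl (B := fun j => (e (B (j / r)) ⟨_, hj j⟩ : ℤ → A))
      fun j => (e _ _).2

end Entropy

end HEnt

namespace HEnt

/-- The data of an encoding of the symbols `S` by square cells of side `l * t` whose rows are
concatenations of words of length `l` over `A`. -/
structure Enc (A S : Type*) where
  l : ℕ
  t : ℕ
  b : ℕ
  q : ℕ
  W : Fin (2 ^ q) → ℤ → A
  code : S → ℕ → Bool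
  R : Finset ℕ
  E : Set S
  l_pos : 0 < l
  two_le_t : 2 ≤ t
  two_le_b : 2 ≤ b
  q_pos : 0 < q
  b_dvd : b ∣ l * t
  b_lt : 2 * b < l * t
  W_inj : Function.Injective W
  W_per : ∀ c i, W c (i + l) = W c i
  code_inj : ∀ σ σ', (∀ j < t, code σ j = code σ' j) → σ = σ'
  R_spec : ∀ r ∈ R, 2 * b ≤ r ∧ ¬ b ∣ r ∧ r < l * t

namespace Enc

variable {A S : Type*} (e : Enc A S)

/-- The side of a cell. -/
def K : ℕ := e.l * e.t

/-- The default word. -/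
def u : Fin (2 ^ e.q) := ⟨0, by positivity⟩

/-- The distinguished word. -/
def v : Fin (2 ^ e.q) := ⟨1, Nat.one_lt_two_pow e.q_pos.ne'⟩

theorem v_ne_u : e.v ≠ e.u := fun h => by simpa [v, u] using congrArg Fin.val h

open Classical in
/-- The word in row `r` and block `j` of a cell encoding `σ`, filled with `w` if it is free. -/
noncomputable def cellIdx (σ : S) (w : Fin (2 ^ e.q)) (j r : ℤ) : Fin (2 ^ e.q) :=
  if r = e.b + 1 then (if e.code σ j.toNat then e.v else e.u)
  else if r.toNat ∈ e.R ∧ σ ∈ e.E then w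
  else if (e.b : ℤ) ∣ r ∧ r ≠ e.b ∧ j = 0 then e.v else e.u

/-- The configuration encoding `z` with filling `f`. -/
noncomputable def cfg (z : ℤ → ℤ → S) (f : ℤ → ℤ → Fin (2 ^ e.q)) (p : ℤ × ℤ) : A :=
  e.W (e.cellIdx (z (p.1 / e.l / e.t) (p.2 / e.K)) (f (p.1 / e.l) p.2) (p.1 / e.l % e.t)
    (p.2 % e.K)) p.1

/-- The structural row. -/
def sRow (i : ℤ) : A := e.W (if i / e.l % e.t = 0 then e.v else e.u) i

/-- The marker occurs at the position `(p, p')`. -/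
def Mk (x : ℤ × ℤ → A) (p p' : ℤ) : Prop :=
  ∀ i : ℤ, 0 ≤ i → i < e.K → x (p + i, p') = e.sRow i ∧
    ∀ r : ℤ, 1 ≤ r → r ≤ e.b → x (p + i, p' + r) = e.W e.u i

/-- The cell at position `(p, p')` encodes `σ`. -/
def Cell (x : ℤ × ℤ → A) (p p' : ℤ) (σ : S) : Prop :=
  ∃ g : ℤ → ℤ → Fin (2 ^ e.q), ∀ i r : ℤ, 0 ≤ i → i < e.K → 0 ≤ r → r < e.K →
    x (p + i, p' + r) = e.W (e.cellIdx σ (g (i / e.l) r) (i / e.l) r) i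

/-- The local rule at the origin. -/
def Rule (HR VR : S → S → Prop) (x : ℤ × ℤ → A) : Prop :=
  (∃ i j : ℤ, 0 ≤ i ∧ i < e.K ∧ 0 ≤ j ∧ j < e.K ∧ e.Mk x i j) ∧
  (e.Mk x 0 0 → (e.Mk x e.K 0 ∧ e.Mk x (-e.K) 0 ∧ e.Mk x 0 e.K ∧ e.Mk x 0 (-e.K)) ∧
    (∃ σ, e.Cell x 0 0 σ) ∧
    (∀ σ σ', e.Cell x 0 0 σ → e.Cell x e.K 0 σ' → HR σ σ') ∧
    ∀ σ σ', e.Cell x 0 0 σ → e.Cell x 0 e.K σ' → VR σ σ')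

theorem K_pos : 0 < e.K := Nat.mul_pos e.l_pos (by have := e.two_le_t; omega)

theorem K_cast : (e.K : ℤ) = e.l * e.t := by simp [K]

theorem two_l_le : 2 * (e.l : ℤ) ≤ e.K := by
  rw [K_cast]
  have := e.two_le_t
  have := e.l_pos
  nlinarith

theorem b_lt_K : 2 * (e.b : ℤ) < e.K := by
  have := e.b_lt
  rw [K]
  omega

theorem b_dvd_K : (e.b : ℤ) ∣ e.K := Int.natCast_dvd_natCast.2 e.b_dvd

theorem W_mul (c : Fin (2 ^ e.q)) (i j : ℤ) : e.W c (i + e.l * j) = e.W c i :=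
  periodic_add_mul (e.W_per c) i j

theorem W_K (c : Fin (2 ^ e.q)) (i j : ℤ) : e.W c (i + e.K * j) = e.W c i := by
  rw [K_cast, mul_assoc, W_mul]

theorem sRow_K (i j : ℤ) : e.sRow (i + e.K * j) = e.sRow i := by
  have hl := e.l_pos
  rw [sRow, sRow, W_K, K_cast, mul_assoc, Int.add_mul_ediv_left _ _ (by omega),
    Int.add_mul_emod_self_left]

theorem W_eq_of_block {c c' : Fin (2 ^ e.q)} {j d : ℤ}
    (h : ∀ i : ℤ, 0 ≤ i → i < e.l → e.W c (e.l * j + i) = e.W c' (d + (e.l * j + i))) :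
    ∀ i, e.W c i = e.W c' (d + i) := by
  intro i
  have hl := e.l_pos
  have h1 := h (i % e.l) (Int.emod_nonneg _ (by omega)) (Int.emod_lt_of_pos _ (by omega))
  rw [add_comm, W_mul, ← add_assoc, W_mul, periodic_emod (e.W_per c)] at h1
  rw [h1]
  have h2 := e.W_mul c' (d + i % e.l) (i / e.l)
  rw [add_assoc, Int.emod_add_mul_ediv] at h2
  exact h2.symm

theorem sRow_of_lt {i : ℤ} (h0 : 0 ≤ i) (h : i < e.l) : e.sRow i = e.W e.v i := by
  rw [sRow, Int.ediv_eq_zero_of_lt h0 h]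
  simp

theorem sRow_of_ge {i : ℤ} (h0 : e.l ≤ i) (h : i < e.K) : e.sRow i = e.W e.u i := by
  have hl := e.l_pos
  have h1 : 1 ≤ i / e.l := (Int.le_ediv_iff_mul_le (by omega)).2 (by omega)
  have h2 : i / e.l < e.t := Int.ediv_lt_of_lt_mul (by omega) (by rw [mul_comm, ← K_cast]; exact h)
  rw [sRow, Int.emod_eq_of_lt (by omega) h2, if_neg (by omega)]

theorem W_u_ne : ∃ i : ℤ, 0 ≤ i ∧ i < e.l ∧ e.W e.v i ≠ e.W e.u i := by
  by_contra! h
  refine e.v_ne_u (e.W_inj (funext fun i => ?_))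
  have := e.W_eq_of_block (c := e.v) (c' := e.u) (j := 0) (d := 0)
    (fun i h0 h1 => by simpa using h i h0 h1) i
  simpa using this

theorem not_sRow_eq (c : ℤ) : ¬ ∀ i, e.sRow i = e.W e.u (c + i) := by
  intro h
  have hl := e.l_pos
  have h2 := e.two_l_le
  have h1 := e.W_eq_of_block (c := e.u) (c' := e.u) (j := 1) (d := c) fun i h0 h1 => by
    rw [← h, sRow_of_ge] <;> omega
  obtain ⟨i, h3, h4, h5⟩ := e.W_u_ne
  rw [← e.sRow_of_lt h3 h4, h, ← h1] at h5
  exact h5 rfl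

theorem forall_of_window {f g : ℤ → A} {K : ℕ} (hK : 0 < K) (hf : ∀ i j, f (i + K * j) = f i)
    (hg : ∀ i j, g (i + K * j) = g i) (h : ∀ i : ℤ, 0 ≤ i → i < K → f i = g i) (i : ℤ) : f i = g i := by
  have h1 := h (i % K) (Int.emod_nonneg _ (by omega)) (Int.emod_lt_of_pos _ (by omega))
  rwa [← hf _ (i / K), ← hg _ (i / K), Int.emod_add_mul_ediv] at h1

theorem dvd_of_sRow_eq {c : ℤ} (h : ∀ i, e.sRow (c + i) = e.sRow i)
    (hu : ∀ i, e.W e.u (c + i) = e.W e.u i) : (e.K : ℤ) ∣ c := by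
  classical
  have hK := e.K_pos
  have h2 := e.two_l_le
  set D : ℤ → Prop := fun i => e.sRow i ≠ e.W e.u i with hD
  have hDK : ∀ i j, D (i + e.K * j) ↔ D i := fun i j => by simp only [hD, sRow_K, W_K]
  have hDc : ∀ i, D (c + i) ↔ D i := fun i => by simp only [hD, h, hu]
  have hDl : ∀ i : ℤ, 0 ≤ i → i < e.K → D i → i < e.l := fun i h0 h1 h3 => by
    by_contra hc
    exact h3 (e.sRow_of_ge (by omega) h1)
  obtain ⟨i₀, h3, h4, h5⟩ := e.W_u_ne
  obtain ⟨d, hd, hmax⟩ := ((Finset.Ico (0 : ℤ) e.l).filter D).exists_max_image id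
    ⟨i₀, by simp [hD, h3, h4, e.sRow_of_lt h3 h4, h5]⟩
  simp only [Finset.mem_filter, Finset.mem_Ico, id] at hd hmax
  obtain ⟨⟨hd0, hd1⟩, hdD⟩ := hd
  by_contra hc
  set c' := c % e.K with hc'
  have hc0 : 0 < c' := by
    have h6 := Int.emod_nonneg c (show (e.K : ℤ) ≠ 0 by omega)
    have h7 : c % e.K ≠ 0 := fun h => hc (Int.dvd_of_emod_eq_zero h)
    omega
  have hc1 : c' < e.K := Int.emod_lt_of_pos _ (by omega)
  have hcc : c = c' + e.K * (c / e.K) := (Int.emod_add_mul_ediv _ _).symm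
  by_cases hs : d + c' < e.K
  · have h6 : D (d + c') := by
      rw [← hDK _ (c / e.K), add_assoc, ← hcc, add_comm]
      exact (hDc d).2 hdD
    have := hmax _ ⟨⟨by omega, hDl _ (by omega) hs h6⟩, h6⟩
    omega
  · have h6 : D (d + (e.K - c')) := by
      rw [← hDc, ← hDK _ (-(c / e.K) - 1)]
      rw [show c + (d + (e.K - c')) + e.K * (-(c / e.K) - 1) = d by linear_combination hcc]
      exact hdD
    have := hmax _ ⟨⟨by omega, hDl _ (by omega) (by omega) h6⟩, h6⟩
    omega

variable {e} {z : ℤ → ℤ → S} {f : ℤ → ℤ → Fin (2 ^ e.q)}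

theorem b_add_one_not_dvd : ¬ (e.b : ℤ) ∣ e.b + 1 := fun h => by
  have h1 := (Int.dvd_add_right (dvd_refl (e.b : ℤ))).1 h
  have h2 := Int.le_of_dvd one_pos h1
  have := e.two_le_b
  omega

theorem cellIdx_of_dvd (σ : S) (w : Fin (2 ^ e.q)) (j : ℤ) {r : ℤ} (h0 : 0 ≤ r)
    (h : (e.b : ℤ) ∣ r) (hr : r ≠ e.b) : e.cellIdx σ w j r = if j = 0 then e.v else e.u := by
  have h1 : r ≠ e.b + 1 := by rintro rfl; exact b_add_one_not_dvd h
  have h2 : r.toNat ∉ e.R := fun h2 => (e.R_spec _ h2).2.1 (by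
    rwa [← Int.natCast_dvd_natCast, Int.toNat_of_nonneg h0])
  simp [cellIdx, h1, h2, h, hr]

theorem cellIdx_of_le (σ : S) (w : Fin (2 ^ e.q)) (j : ℤ) {r : ℤ} (h0 : 1 ≤ r)
    (h : r ≤ e.b) : e.cellIdx σ w j r = e.u := by
  have h1 : r ≠ e.b + 1 := by omega
  have h2 : r.toNat ∉ e.R := fun h2 => by
    have := (e.R_spec _ h2).1
    have := e.two_le_b
    omega
  have h3 : ¬ ((e.b : ℤ) ∣ r ∧ r ≠ e.b ∧ j = 0) := fun h3 => by
    have := Int.le_of_dvd (by omega) h3.1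
    omega
  simp only [cellIdx, h1, h2, h3, false_and, if_false]

theorem cfg_of_dvd {p : ℤ × ℤ} (h : (e.b : ℤ) ∣ p.2 % e.K) (hr : p.2 % e.K ≠ e.b) :
    e.cfg z f p = e.sRow p.1 := by
  have hK := e.K_pos
  rw [cfg, cellIdx_of_dvd _ _ _ (Int.emod_nonneg _ (by omega)) h hr, sRow]

theorem cfg_of_le {p : ℤ × ℤ} (h0 : 1 ≤ p.2 % e.K) (h : p.2 % e.K ≤ e.b) :
    e.cfg z f p = e.W e.u p.1 := by
  rw [cfg, cellIdx_of_le _ _ _ h0 h]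

theorem Mk.dvd {p p' : ℤ} (h : e.Mk (e.cfg z f) p p') : (e.K : ℤ) ∣ p ∧ (e.K : ℤ) ∣ p' := by
  have hK := e.K_pos
  have hb := e.two_le_b
  have hbK := e.b_lt_K
  have hW : ∀ c d i j, e.W c (d + (i + e.K * j)) = e.W c (d + i) := fun c d i j => by
    rw [← add_assoc, W_K]
  have hS : ∀ d i j, e.sRow (d + (i + e.K * j)) = e.sRow (d + i) := fun d i j => by
    rw [← add_assoc, sRow_K]
  have hm0 := Int.emod_nonneg p' (show (e.K : ℤ) ≠ 0 by omega)
  have hm1 := Int.emod_lt_of_pos p' (show (0 : ℤ) < e.K by omega)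
  -- a multiple of `b` among the next `b` rows
  obtain ⟨r, hr1, hr2, hrd⟩ : ∃ r : ℤ, 1 ≤ r ∧ r ≤ e.b ∧ (e.b : ℤ) ∣ p' + r := by
    have h1 := Int.emod_nonneg p' (show (e.b : ℤ) ≠ 0 by omega)
    have h2 := Int.emod_lt_of_pos p' (show (0 : ℤ) < e.b by omega)
    refine ⟨e.b - p' % e.b, by omega, by omega, ⟨p' / e.b + 1, ?_⟩⟩
    linear_combination -Int.emod_add_mul_ediv p' e.b
  have hrd' : (e.b : ℤ) ∣ (p' + r) % e.K := by
    rw [Int.emod_def]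
    exact dvd_sub hrd (e.b_dvd_K.mul_right _)
  have hrb : (p' + r) % e.K = e.b := by
    by_contra hne
    refine e.not_sRow_eq (-p) fun i => ?_
    have h1 := forall_of_window (f := fun i => e.sRow (p + i)) (g := fun i => e.W e.u i) hK
      (fun i j => hS _ _ _) (fun i j => e.W_K _ _ _) (fun i h0 h1 => by
        rw [← (h i h0 h1).2 r hr1 hr2, cfg_of_dvd hrd' hne]) (-p + i)
    simpa using h1
  have hp' : p' % e.K = e.b - r := by
    have h1 : (p' % e.K + r) % e.K = e.b := by rw [Int.emod_add_emod, hrb]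
    by_cases hc : p' % e.K + r < e.K
    · rw [Int.emod_eq_of_lt (by omega) hc] at h1
      omega
    · rw [Int.emod_eq_sub_self_emod, Int.emod_eq_of_lt (by omega) (by omega)] at h1
      omega
  have hp0 : p' % e.K = 0 := by
    by_contra hne
    refine e.not_sRow_eq p fun i => ?_
    exact forall_of_window (f := fun i => e.sRow i) (g := fun i => e.W e.u (p + i)) hK
      (fun i j => e.sRow_K _ _) (fun i j => hW _ _ _ _) (fun i h0 h1 => by
        rw [← (h i h0 h1).1, cfg_of_le (by simp only; omega) (by simp only; omega)]) i
  refine ⟨e.dvd_of_sRow_eq (fun i => ?_) (fun i => ?_), Int.dvd_of_emod_eq_zero hp0⟩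
  · exact forall_of_window (f := fun i => e.sRow (p + i)) (g := fun i => e.sRow i) hK
      (fun i j => hS _ _ _) (fun i j => e.sRow_K _ _) (fun i h0 h1 => by
        rw [← (h i h0 h1).1, cfg_of_dvd (by rw [hp0]; exact dvd_zero _) (by simp only; omega)]) i
  · have h1 : (p' + 1) % e.K = 1 := by
      rw [← Int.emod_add_emod, hp0, zero_add, Int.emod_eq_of_lt (by omega) (by omega)]
    exact forall_of_window (f := fun i => e.W e.u (p + i)) (g := fun i => e.W e.u i) hK
      (fun i j => hW _ _ _ _) (fun i j => e.W_K _ _ _) (fun i h0 h2 => by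
        rw [← (h i h0 h2).2 1 le_rfl (by omega), cfg_of_le] <;> simp only [h1] <;> omega) i

theorem mk_cfg (X Y : ℤ) : e.Mk (e.cfg z f) (e.K * X) (e.K * Y) := by
  have hK := e.K_pos
  have hbK := e.b_lt_K
  have hb := e.two_le_b
  intro i h0 h1
  refine ⟨?_, fun r hr0 hr1 => ?_⟩
  · rw [cfg_of_dvd (by simp) (by simp; omega), add_comm, sRow_K]
  · have h2 : (e.K * Y + r) % e.K = r := by
      rw [Int.mul_add_emod_self_left, Int.emod_eq_of_lt (by omega) (by omega)]
    rw [cfg_of_le (by simp only [h2]; omega) (by simp only [h2]; omega), add_comm, W_K]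

theorem block_div {X i : ℤ} (h0 : 0 ≤ i) (h1 : i < e.K) :
    (e.K * X + i) / e.l / e.t = X ∧ (e.K * X + i) / e.l % e.t = i / e.l ∧
      (e.K * X + i) / e.l = e.t * X + i / e.l := by
  have hl := e.l_pos
  have ht := e.two_le_t
  have h2 : 0 ≤ i / e.l := Int.ediv_nonneg h0 (by omega)
  have h3 : i / e.l < e.t := Int.ediv_lt_of_lt_mul (by omega) (by rw [mul_comm, ← K_cast]; exact h1)
  have h4 : (e.K * X + i) / e.l = e.t * X + i / e.l := by
    rw [K_cast, mul_assoc, add_comm, Int.add_mul_ediv_left _ _ (by omega), add_comm]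
  refine ⟨?_, ?_, h4⟩
  · rw [h4, add_comm, Int.add_mul_ediv_left _ _ (by omega), Int.ediv_eq_zero_of_lt h2 h3, zero_add]
  · rw [h4, Int.mul_add_emod_self_left, Int.emod_eq_of_lt h2 h3]

theorem cfg_apply (X Y : ℤ) {i r : ℤ} (h0 : 0 ≤ i) (h1 : i < e.K) (h2 : 0 ≤ r) (h3 : r < e.K) :
    e.cfg z f (e.K * X + i, e.K * Y + r) =
      e.W (e.cellIdx (z X Y) (f (e.t * X + i / e.l) (e.K * Y + r)) (i / e.l) r) i := by
  have hK := e.K_pos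
  obtain ⟨h4, h5, h6⟩ := block_div (e := e) (X := X) h0 h1
  rw [cfg]
  simp only
  rw [h4, h5, h6, Int.mul_add_emod_self_left, Int.emod_eq_of_lt h2 h3, add_comm (_ * Y),
    Int.add_mul_ediv_left _ _ (by omega), Int.ediv_eq_zero_of_lt h2 h3, zero_add,
    add_comm (e.K * X), W_K]

theorem cell_cfg (X Y : ℤ) : e.Cell (e.cfg z f) (e.K * X) (e.K * Y) (z X Y) :=
  ⟨fun j r => f (e.t * X + j) (e.K * Y + r), fun _ _ h0 h1 h2 h3 => cfg_apply X Y h0 h1 h2 h3⟩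

theorem Cell.unique {x : ℤ × ℤ → A} {p p' : ℤ} {σ σ' : S} (h : e.Cell x p p' σ)
    (h' : e.Cell x p p' σ') : σ = σ' := by
  obtain ⟨g, hg⟩ := h
  obtain ⟨g', hg'⟩ := h'
  have hl := e.l_pos
  have hbK := e.b_lt_K
  have hb := e.two_le_b
  refine e.code_inj _ _ fun j hj => ?_
  have key := e.W_eq_of_block (c := if e.code σ j then e.v else e.u)
    (c' := if e.code σ' j then e.v else e.u) (j := j) (d := 0) fun i h0 h1 => by
      have hdiv : ((e.l : ℤ) * j + i) / e.l = j := by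
        rw [add_comm, Int.add_mul_ediv_left _ _ (by omega), Int.ediv_eq_zero_of_lt h0 h1, zero_add]
      have hlt : (e.l : ℤ) * j + i < e.K := by
        rw [K_cast]
        nlinarith
      have h2 := (hg (e.l * j + i) (e.b + 1) (by positivity) hlt (by omega) (by omega)).symm.trans
        (hg' (e.l * j + i) (e.b + 1) (by positivity) hlt (by omega) (by omega))
      simp only [cellIdx, if_true, hdiv, Int.toNat_natCast] at h2
      rw [zero_add]
      exact h2
  have h3 := e.W_inj (funext fun i => by simpa using key i)
  have hvu := e.v_ne_u
  cases hc : e.code σ j <;> cases hc' : e.code σ' j <;> simp [hc, hc', hvu, hvu.symm] at h3 ⊢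

theorem mk_shift {x : ℤ × ℤ → A} {p p' : ℤ} (c : ℤ × ℤ) :
    e.Mk (fun v => x (v + c)) p p' ↔ e.Mk x (p + c.1) (p' + c.2) := by
  simp only [Mk, Prod.add_def, add_right_comm]

theorem cell_shift {x : ℤ × ℤ → A} {p p' : ℤ} {σ : S} (c : ℤ × ℤ) :
    e.Cell (fun v => x (v + c)) p p' σ ↔ e.Cell x (p + c.1) (p' + c.2) σ := by
  simp only [Cell, Prod.add_def, add_right_comm]

variable {HR VR : S → S → Prop}

theorem rule_cfg (hz : z ∈ Adj HR VR) (c : ℤ × ℤ) : e.Rule HR VR fun v => e.cfg z f (v + c) := by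
  have hK := e.K_pos
  refine ⟨⟨(-c.1) % e.K, (-c.2) % e.K, Int.emod_nonneg _ (by omega), Int.emod_lt_of_pos _ (by omega),
    Int.emod_nonneg _ (by omega), Int.emod_lt_of_pos _ (by omega), ?_⟩, fun h => ?_⟩
  · rw [mk_shift]
    convert mk_cfg (e := e) (z := z) (f := f) (-((-c.1) / e.K)) (-((-c.2) / e.K)) using 1
    · linear_combination Int.emod_add_mul_ediv (-c.1) e.K
    · linear_combination Int.emod_add_mul_ediv (-c.2) e.K
  · rw [mk_shift] at h
    obtain ⟨⟨X, hX⟩, ⟨Y, hY⟩⟩ := h.dvd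
    rw [zero_add] at hX hY
    simp only [mk_shift, cell_shift, zero_add, hX, hY]
    have h1 : ∀ X : ℤ, (e.K : ℤ) + e.K * X = e.K * (X + 1) := fun X => by ring
    have h2 : ∀ X : ℤ, -(e.K : ℤ) + e.K * X = e.K * (X - 1) := fun X => by ring
    simp only [h1, h2]
    refine ⟨⟨mk_cfg _ _, mk_cfg _ _, mk_cfg _ _, mk_cfg _ _⟩, ⟨_, cell_cfg _ _⟩,
      fun σ σ' h h' => ?_, fun σ σ' h h' => ?_⟩
    · rw [h.unique (cell_cfg _ _), h'.unique (cell_cfg _ _)]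
      simpa using hz.1 (X + 1) Y
    · rw [h.unique (cell_cfg _ _), h'.unique (cell_cfg _ _)]
      simpa using hz.2 X (Y + 1)

theorem exists_cfg_of_rule {x : ℤ × ℤ → A} (h : ∀ c : ℤ × ℤ, e.Rule HR VR fun v => x (v + c)) :
    ∃ (c : ℤ × ℤ) (z : ℤ → ℤ → S) (f : ℤ → ℤ → Fin (2 ^ e.q)), 0 ≤ c.1 ∧ c.1 < e.K ∧ 0 ≤ c.2 ∧
      c.2 < e.K ∧ z ∈ Adj HR VR ∧ ∀ p, x p = e.cfg z f (p + c) := by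
  have hK := e.K_pos
  have ht := e.two_le_t
  have hl := e.l_pos
  have hK0 : (e.K : ℤ) ≠ 0 := by omega
  obtain ⟨i, j, hi0, hi1, hj0, hj1, hm⟩ := (h (-(e.K : ℤ) + 1, -(e.K : ℤ) + 1)).1
  rw [mk_shift] at hm
  simp only at hm
  set a := i + (-(e.K : ℤ) + 1) with ha
  set b := j + (-(e.K : ℤ) + 1) with hb
  have hR : ∀ p p', e.Mk x p p' → _ := fun p p' hp => (h (p, p')).2 (by rw [mk_shift]; simpa using hp)
  simp only [mk_shift, cell_shift, zero_add] at hR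
  have hX : ∀ X : ℤ, e.Mk x (a + e.K * X) b := fun X => by
    induction X with
    | zero => simpa using hm
    | succ n ih =>
      convert (hR _ _ ih).1.1 using 1
      ring
    | pred n ih =>
      convert (hR _ _ ih).1.2.1 using 1
      ring
  have hXY : ∀ X Y : ℤ, e.Mk x (a + e.K * X) (b + e.K * Y) := fun X Y => by
    induction Y with
    | zero => simpa using hX X
    | succ n ih =>
      convert (hR _ _ ih).1.2.2.1 using 1
      ring
    | pred n ih =>
      convert (hR _ _ ih).1.2.2.2 using 1
      ring
  choose z hz using fun X Y => (hR _ _ (hXY X Y)).2.1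
  choose g hg using hz
  refine ⟨(-a, -b), z, fun c y => g (c / e.t) (y / e.K) (c % e.t) (y % e.K), by simp; omega,
    by simp; omega, by simp; omega, by simp; omega, ⟨fun X Y => ?_, fun X Y => ?_⟩, fun p => ?_⟩
  · refine (hR _ _ (hXY (X - 1) Y)).2.2.1 _ _ ⟨_, hg _ _⟩ ?_
    have h1 : e.Cell x (a + e.K * X) (b + e.K * Y) (z X Y) := ⟨_, hg X Y⟩
    convert h1 using 1
    ring
  · refine (hR _ _ (hXY X (Y - 1))).2.2.2 _ _ ⟨_, hg _ _⟩ ?_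
    have h1 : e.Cell x (a + e.K * X) (b + e.K * Y) (z X Y) := ⟨_, hg X Y⟩
    convert h1 using 1
    ring
  · have h1 : p + (-a, -b) = (e.K * ((p.1 - a) / e.K) + (p.1 - a) % e.K,
        e.K * ((p.2 - b) / e.K) + (p.2 - b) % e.K) := by
      rw [Int.mul_ediv_add_emod, Int.mul_ediv_add_emod]
      rfl
    have h2 := Int.emod_nonneg (p.1 - a) hK0
    have h3 := Int.emod_nonneg (p.2 - b) hK0
    have h4 := Int.emod_lt_of_pos (p.1 - a) (show (0 : ℤ) < e.K by omega)
    have h5 := Int.emod_lt_of_pos (p.2 - b) (show (0 : ℤ) < e.K by omega)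
    have h6 := hg ((p.1 - a) / e.K) ((p.2 - b) / e.K) _ _ h2 h4 h3 h5
    obtain ⟨h7, h8, h9⟩ := block_div (e := e) (X := (p.1 - a) / e.K) h2 h4
    rw [h1, cfg_apply _ _ h2 h4 h3 h5]
    rw [h9] at h7 h8
    rw [h7, h8, Int.mul_add_emod_self_left, Int.emod_emod_of_dvd _ (dvd_refl _),
      Int.mul_ediv_add_emod, ← h6]
    congr 1
    ext
    · simp only
      linear_combination -Int.emod_add_mul_ediv (p.1 - a) e.K
    · simp only
      linear_combination -Int.emod_add_mul_ediv (p.2 - b) e.K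

end Enc

end HEnt

namespace HEnt

section PatternCount

variable {A : Type*}

theorem entropy2_term_nonneg (X : Set (ℤ × ℤ → A)) (n : ℕ) :
    0 ≤ Real.logb 2 (patCount2 X (n + 1) (n + 1)) / ((n : ℝ) + 1) ^ 2 := by
  refine div_nonneg ?_ (by positivity)
  rcases Nat.eq_zero_or_pos (patCount2 X (n + 1) (n + 1)) with h | h
  · simp [h]
  · exact Real.logb_nonneg (by norm_num) (by exact_mod_cast h)

theorem entropy2_nonneg (X : Set (ℤ × ℤ → A)) : 0 ≤ entropy2 X :=
  le_ciInf fun n => entropy2_term_nonneg X n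

theorem entropy2_mul_le (X : Set (ℤ × ℤ → A)) {n : ℕ} (hn : 0 < n) :
    entropy2 X * (n : ℝ) ^ 2 ≤ Real.logb 2 (patCount2 X n n) := by
  obtain ⟨n, rfl⟩ := Nat.exists_eq_add_of_lt hn
  rw [zero_add]
  have h1 : entropy2 X ≤ Real.logb 2 (patCount2 X (n + 1) (n + 1)) / ((n : ℝ) + 1) ^ 2 :=
    ciInf_le ⟨0, by rintro _ ⟨n, rfl⟩; exact entropy2_term_nonneg X n⟩ n
  rw [le_div_iff₀ (by positivity)] at h1
  exact_mod_cast h1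

variable [Finite A] {X : Set (ℤ × ℤ → A)}

theorem patCount2_pos (hX : X.Nonempty) (m n : ℕ) : 0 < patCount2 X m n := by
  obtain ⟨x, hx⟩ := hX
  exact (Set.ncard_pos (Set.toFinite _)).2 ⟨fun i j => x ((i : ℤ), (j : ℤ)), x, hx, fun _ _ => rfl⟩

theorem patCount2_le_pow (hX : ∀ x ∈ X, ∀ c : ℤ × ℤ, (fun v => x (v + c)) ∈ X) {M N r : ℕ}
    (hN : 0 < N) (hM : M ≤ r * N) : patCount2 X M M ≤ patCount2 X N N ^ r ^ 2 := by
  classical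
  set P := {p : Fin N → Fin N → A | ∃ x ∈ X, ∀ (i : Fin N) (j : Fin N),
    x ((i : ℤ), (j : ℤ)) = p i j}
  set Q := {p : Fin M → Fin M → A | ∃ x ∈ X, ∀ (i : Fin M) (j : Fin M),
    x ((i : ℤ), (j : ℤ)) = p i j}
  have h1 : Nat.card (Fin r × Fin r → P) = patCount2 X N N ^ r ^ 2 := by
    rw [Nat.card_fun, Nat.card_eq_fintype_card (α := Fin r × Fin r)]
    simp only [Fintype.card_prod, Fintype.card_fin, ← sq]
    rfl
  have h2 : Nat.card Q = patCount2 X M M := rfl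
  rw [← h1, ← h2]
  choose x hx hxp using fun p : Q => p.2
  refine Nat.card_le_card_of_injective (fun (p : Q) (c : Fin r × Fin r) => (⟨fun i j =>
    x p ((i : ℤ) + (c.1 * N : ℕ), (j : ℤ) + (c.2 * N : ℕ)),
    _, hX _ (hx p) (((c.1 * N : ℕ) : ℤ), ((c.2 * N : ℕ) : ℤ)), fun i j => rfl⟩ : P)) ?_
  intro p p' h
  ext i j
  have hd : ∀ i : Fin M, (i : ℕ) / N < r := fun i =>
    (Nat.div_lt_iff_lt_mul hN).2 (i.2.trans_le hM)
  have h3 := congrFun (congrFun (congrArg Subtype.val (congrFun h (⟨i / N, hd i⟩, ⟨j / N, hd j⟩)))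
    ⟨i % N, Nat.mod_lt _ hN⟩) ⟨j % N, Nat.mod_lt _ hN⟩
  simp only [← Nat.cast_add, Nat.mod_add_div'] at h3
  rwa [hxp, hxp] at h3

theorem le_entropy2 (hX : ∀ x ∈ X, ∀ c : ℤ × ℤ, (fun v => x (v + c)) ∈ X) (hne : X.Nonempty)
    {a : ℝ}
    (h : ∀ n₀ : ℕ, ∃ n ≥ n₀, a * (n : ℝ) ^ 2 ≤ Real.logb 2 (patCount2 X n n)) :
    a ≤ entropy2 X := by
  refine le_ciInf fun n => ?_
  set L := Real.logb 2 (patCount2 X (n + 1) (n + 1)) with hL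
  have hL0 : 0 ≤ L := Real.logb_nonneg (by norm_num) (by exact_mod_cast patCount2_pos hne _ _)
  rw [le_div_iff₀ (by positivity)]
  have hn1 : (0 : ℝ) < (n : ℝ) + 1 := by positivity
  refine le_of_forall_pos_le_add fun ε hε => ?_
  obtain ⟨n₀, hn₀⟩ := exists_nat_gt (3 * ((n : ℝ) + 1) * L / ε + n + 1)
  obtain ⟨m, hm, h1⟩ := h n₀
  have hm' : 3 * ((n : ℝ) + 1) * L / ε + n + 1 < m := hn₀.trans_le (by exact_mod_cast hm)
  have h0 : 0 ≤ 3 * ((n : ℝ) + 1) * L / ε := by positivity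
  set r := m / (n + 1) + 1 with hr
  have hr1 : m ≤ r * (n + 1) := (Nat.lt_mul_of_div_lt (Nat.lt_succ_self _) n.succ_pos).le.trans
    (by rw [hr])
  have hr2 : (r : ℝ) * (n + 1) ≤ m + (n + 1) := by
    have := Nat.div_mul_le_self m (n + 1)
    have h3 : r * (n + 1) ≤ m + (n + 1) := by rw [hr, Nat.add_mul]; omega
    exact_mod_cast h3
  have h2 : Real.logb 2 (patCount2 X m m) ≤ (r : ℝ) ^ 2 * L := by
    rw [hL, ← Nat.cast_pow, ← Real.logb_pow]
    exact Real.logb_le_logb_of_le (by norm_num) (by exact_mod_cast patCount2_pos hne _ _)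
      (by exact_mod_cast patCount2_le_pow hX n.succ_pos hr1)
  have hm0 : (0 : ℝ) < m := by linarith
  have h3 : 3 * ((n : ℝ) + 1) * L ≤ ε * m := by
    have : 3 * ((n : ℝ) + 1) * L / ε ≤ m := by linarith
    rwa [div_le_iff₀ hε, mul_comm (m : ℝ)] at this
  have h4 : (a * ((n : ℝ) + 1) ^ 2) * (m : ℝ) ^ 2 ≤ ((m : ℝ) + (n + 1)) ^ 2 * L := by
    calc (a * ((n : ℝ) + 1) ^ 2) * (m : ℝ) ^ 2 = (a * (m : ℝ) ^ 2) * ((n : ℝ) + 1) ^ 2 := by ring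
      _ ≤ ((r : ℝ) ^ 2 * L) * ((n : ℝ) + 1) ^ 2 := by exact mul_le_mul_of_nonneg_right (h1.trans h2) (by positivity)
      _ = ((r : ℝ) * (n + 1)) ^ 2 * L := by ring
      _ ≤ _ := by gcongr
  have h5 : ((m : ℝ) + (n + 1)) ^ 2 * L ≤ (L + ε) * (m : ℝ) ^ 2 := by
    have h6 : ((n : ℝ) + 1) * L * (n + 1) ≤ ((n : ℝ) + 1) * L * m := by
      gcongr
      linarith
    nlinarith
  exact le_of_mul_le_mul_right (h4.trans h5) (by positivity)

theorem patCount2_le_wordCount {H : Set (ℤ → A)}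
    (hH : ∀ x ∈ H, ∀ c : ℤ, (fun i => x (i + c)) ∈ H)
    (hX : ∀ x ∈ X, ∀ j : ℤ, (fun i => x (i, j)) ∈ H) (n : ℕ) :
    patCount2 X n n ≤ wordCount H n ^ n := by
  rw [wordCount_eq hH]
  set P := {p : Fin n → A | ∃ x ∈ H, ∀ i : Fin n, x (i : ℕ) = p i}
  set Q := {p : Fin n → Fin n → A | ∃ x ∈ X, ∀ (i : Fin n) (j : Fin n),
    x ((i : ℤ), (j : ℤ)) = p i j}
  have h1 : Nat.card (Fin n → P) = P.ncard ^ n := by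
    rw [Nat.card_fun, Nat.card_eq_fintype_card (α := Fin n), Fintype.card_fin]
    rfl
  rw [← h1]
  refine Nat.card_le_card_of_injective (fun (p : Q) (j : Fin n) => (⟨fun i => p.1 i j, ?_⟩ : P))
    fun p p' h => ?_
  · obtain ⟨x, hx, hp⟩ := p.2
    exact ⟨_, hX x hx j, fun i => hp i j⟩
  · ext i j
    exact congrFun (congrArg Subtype.val (congrFun h j)) i

theorem patCount2_rows {H : Set (ℤ → A)}
    (hH : ∀ x ∈ H, ∀ c : ℤ, (fun i => x (i + c)) ∈ H) (hne : H.Nonempty)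
    (hX : ∀ x : ℤ × ℤ → A, (∀ j : ℤ, (fun i => x (i, j)) ∈ H) → x ∈ X) (n : ℕ) :
    wordCount H n ^ n ≤ patCount2 X n n := by
  classical
  rw [wordCount_eq hH]
  set P := {p : Fin n → A | ∃ x ∈ H, ∀ i : Fin n, x (i : ℕ) = p i}
  set Q := {p : Fin n → Fin n → A | ∃ x ∈ X, ∀ (i : Fin n) (j : Fin n),
    x ((i : ℤ), (j : ℤ)) = p i j}
  have h1 : Nat.card (Fin n → P) = P.ncard ^ n := by
    rw [Nat.card_fun, Nat.card_eq_fintype_card (α := Fin n), Fintype.card_fin]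
    rfl
  rw [← h1]
  obtain ⟨y, hy⟩ := hne
  choose x hx hxp using fun p : P => p.2
  refine Nat.card_le_card_of_injective (fun (g : Fin n → P) => (⟨fun i j => (g j).1 i,
    fun v => if h : 0 ≤ v.2 ∧ v.2 < n then x (g ⟨v.2.toNat, by omega⟩) v.1 else y v.1,
    hX _ fun j => ?_, fun i j => ?_⟩ : Q)) fun g g' h => ?_
  · by_cases hj : 0 ≤ j ∧ j < n
    · simpa only [hj, and_self, dite_true] using hx (g ⟨j.toNat, by omega⟩)
    · simpa only [hj, dite_false] using hy
  · simp [hxp]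
  · ext j i
    exact congrFun (congrFun (congrArg Subtype.val h) i) j

theorem entropy2_le_entropy1 {H : Set (ℤ → A)}
    (hH : ∀ x ∈ H, ∀ c : ℤ, (fun i => x (i + c)) ∈ H)
    (hX : ∀ x ∈ X, ∀ j : ℤ, (fun i => x (i, j)) ∈ H) (hne : X.Nonempty) :
    entropy2 X ≤ entropy1 H := by
  refine le_ciInf fun n => ?_
  have h1 := entropy2_mul_le X n.succ_pos
  have h2 : Real.logb 2 (patCount2 X (n + 1) (n + 1)) ≤
      (n + 1 : ℕ) * Real.logb 2 (wordCount H (n + 1)) := by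
    rw [← Real.logb_pow]
    exact Real.logb_le_logb_of_le (by norm_num) (by exact_mod_cast patCount2_pos hne _ _)
      (by exact_mod_cast patCount2_le_wordCount hH hX (n + 1))
  have h3 : (0 : ℝ) < (n : ℝ) + 1 := by positivity
  rw [le_div_iff₀ h3]
  push_cast [Nat.succ_eq_add_one] at h1 h2
  nlinarith

theorem entropy1_le_entropy2 {H : Set (ℤ → A)}
    (hH : ∀ x ∈ H, ∀ c : ℤ, (fun i => x (i + c)) ∈ H) (hne : H.Nonempty)
    (hX : ∀ x : ℤ × ℤ → A, (∀ j : ℤ, (fun i => x (i, j)) ∈ H) → x ∈ X) :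
    entropy1 H ≤ entropy2 X := by
  refine le_ciInf fun n => ?_
  have h1 := entropy1_mul_le H n.succ_pos
  have hpos : 0 < wordCount H (n + 1) := by
    rw [wordCount_eq hH]
    obtain ⟨y, hy⟩ := hne
    exact (Set.ncard_pos (Set.toFinite _)).2 ⟨fun i => y (i : ℕ), y, hy, fun _ => rfl⟩
  have h2 : (n + 1 : ℕ) * Real.logb 2 (wordCount H (n + 1)) ≤
      Real.logb 2 (patCount2 X (n + 1) (n + 1)) := by
    rw [← Real.logb_pow]
    exact Real.logb_le_logb_of_le (by norm_num) (by positivity)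
      (by exact_mod_cast patCount2_rows hH hne hX (n + 1))
  have h3 : (0 : ℝ) < (n : ℝ) + 1 := by positivity
  rw [le_div_iff₀ (by positivity)]
  push_cast [Nat.succ_eq_add_one] at h1 h2
  nlinarith

end PatternCount

section LocalRule

variable {A : Type*}

theorem exists_forbidden [Finite A] (B : Finset (ℤ × ℤ)) (Ψ : (ℤ × ℤ → A) → Prop)
    (hΨ : ∀ x y, (∀ u ∈ B, x u = y u) → Ψ x → Ψ y) :
    ∃ F : Finset (Pattern2 A), ∀ x, (∀ p ∈ F, ¬ p.OccursIn x) ↔ ∀ v, Ψ fun u => x (u + v) := by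
  classical
  let bad := {g : B → A // ∃ x, ¬ Ψ x ∧ ∀ u : B, x u = g u}
  choose y hy hyg using fun g : bad => g.2
  refine ⟨(Set.finite_range fun g : bad => (⟨B, y g⟩ : Pattern2 A)).toFinset, fun x => ?_⟩
  simp only [Set.Finite.mem_toFinset, Set.mem_range, forall_exists_index,
    forall_apply_eq_imp_iff, Pattern2.OccursIn, not_exists]
  constructor
  · intro h v
    by_contra hc
    refine h ⟨fun u : B => x (u + v), _, hc, fun u => rfl⟩ v fun u hu => ?_
    exact (hyg ⟨fun u : B => x (u + v), _, hc, fun u => rfl⟩ ⟨u, hu⟩).symm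
  · intro h g v hg
    exact hy g (hΨ _ _ hg (h v))

end LocalRule

end HEnt

namespace HEnt

namespace Enc

variable {A S : Type*} {e : Enc A S} {HR VR : S → S → Prop}

theorem Mk.congr {x y : ℤ × ℤ → A} {K : ℤ} (hK : (e.K : ℤ) = K)
    (h : ∀ u : ℤ × ℤ, -K ≤ u.1 → u.1 < 2 * K → -K ≤ u.2 → u.2 < 2 * K → x u = y u)
    {p p' : ℤ} (hp0 : -K ≤ p) (hp1 : p ≤ K) (hp0' : -K ≤ p') (hp1' : p' ≤ K)
    (hm : e.Mk x p p') : e.Mk y p p' := by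
  have hb := e.b_lt_K
  intro i h0 h1
  refine ⟨?_, fun r hr0 hr1 => ?_⟩
  · rw [← (hm i h0 h1).1, h] <;> simp only <;> omega
  · rw [← (hm i h0 h1).2 r hr0 hr1, h] <;> simp only <;> omega

theorem Cell.congr {x y : ℤ × ℤ → A} {K : ℤ} (hK : (e.K : ℤ) = K)
    (h : ∀ u : ℤ × ℤ, -K ≤ u.1 → u.1 < 2 * K → -K ≤ u.2 → u.2 < 2 * K → x u = y u)
    {p p' : ℤ} {σ : S} (hp0 : -K ≤ p) (hp1 : p ≤ K) (hp0' : -K ≤ p') (hp1' : p' ≤ K)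
    (hm : e.Cell x p p' σ) : e.Cell y p p' σ := by
  obtain ⟨g, hg⟩ := hm
  refine ⟨g, fun i r h0 h1 h2 h3 => ?_⟩
  rw [← hg i r h0 h1 h2 h3, h] <;> simp only <;> omega

theorem Rule.congr {x y : ℤ × ℤ → A} {K : ℤ} (hK : (e.K : ℤ) = K)
    (h : ∀ u : ℤ × ℤ, -K ≤ u.1 → u.1 < 2 * K → -K ≤ u.2 → u.2 < 2 * K → x u = y u)
    (hx : e.Rule HR VR x) : e.Rule HR VR y := by
  have hKp := e.K_pos
  have h' : ∀ u : ℤ × ℤ, -K ≤ u.1 → u.1 < 2 * K → -K ≤ u.2 → u.2 < 2 * K → y u = x u :=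
    fun u h1 h2 h3 h4 => (h u h1 h2 h3 h4).symm
  have hM : ∀ {p p'}, -K ≤ p → p ≤ K → -K ≤ p' → p' ≤ K → (e.Mk y p p' ↔ e.Mk x p p') :=
    fun h1 h2 h3 h4 => ⟨Mk.congr hK h' h1 h2 h3 h4, Mk.congr hK h h1 h2 h3 h4⟩
  have hC : ∀ {p p' σ}, -K ≤ p → p ≤ K → -K ≤ p' → p' ≤ K → (e.Cell y p p' σ ↔ e.Cell x p p' σ) :=
    fun h1 h2 h3 h4 => ⟨Cell.congr hK h' h1 h2 h3 h4, Cell.congr hK h h1 h2 h3 h4⟩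
  obtain ⟨⟨i, j, hi0, hi1, hj0, hj1, hm⟩, hr⟩ := hx
  refine ⟨⟨i, j, hi0, hi1, hj0, hj1, (hM ?_ ?_ ?_ ?_).2 hm⟩, ?_⟩
  iterate 4 omega
  have a1 : -K ≤ 0 := by omega
  have a2 : 0 ≤ K := by omega
  have a3 : -K ≤ K := by omega
  rw [hK] at hr ⊢
  rw [hM a1 a2 a1 a2, hM a3 le_rfl a1 a2, hM le_rfl a3 a1 a2, hM a1 a2 a3 le_rfl,
    hM a1 a2 le_rfl a3]
  simpa only [hC a1 a2 a1 a2, hC a3 le_rfl a1 a2, hC a1 a2 a3 le_rfl] using hr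

variable (e) in
/-- The subshift of the encodings. -/
def space (HR VR : S → S → Prop) : Set (ℤ × ℤ → A) :=
  {x | ∃ (c : ℤ × ℤ) (z : ℤ → ℤ → S) (f : ℤ → ℤ → Fin (2 ^ e.q)), 0 ≤ c.1 ∧ c.1 < e.K ∧ 0 ≤ c.2 ∧
      c.2 < e.K ∧ z ∈ Adj HR VR ∧ ∀ p, x p = e.cfg z f (p + c)}

theorem exists_XHF_eq [Finite A] {H : Set (ℤ → A)}
    (hH : ∀ x ∈ H, ∀ c : ℤ, (fun i => x (i + c)) ∈ H)
    (hW : ∀ B : ℤ → Fin (2 ^ e.q), (fun i => e.W (B (i / e.l)) i) ∈ H) :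
    ∃ F : Finset (Pattern2 A), XHF H F = e.space HR VR := by
  obtain ⟨F, hF⟩ := exists_forbidden (A := A)
    (Finset.Ico (-(e.K : ℤ)) (2 * e.K) ×ˢ Finset.Ico (-(e.K : ℤ)) (2 * e.K)) (e.Rule HR VR)
    fun x y h hx => hx.congr rfl fun u h1 h2 h3 h4 => h u (by simp [h1, h2, h3, h4])
  refine ⟨F, Set.ext fun x => ?_⟩
  constructor
  · intro hx
    exact exists_cfg_of_rule ((hF x).1 hx.2)
  · rintro ⟨c, z, f, -, -, -, -, hz, hx⟩
    obtain rfl : x = fun p => e.cfg z f (p + c) := funext hx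
    refine ⟨fun j => ?_, (hF _).2 fun v => ?_⟩
    · exact hH _ (hW fun b => e.cellIdx (z (b / e.t) ((j + c.2) / e.K)) (f b (j + c.2)) (b % e.t)
        ((j + c.2) % e.K)) c.1
    · simpa only [add_assoc] using rule_cfg hz (v + c)

theorem space_shift : ∀ x ∈ e.space HR VR, ∀ v : ℤ × ℤ, (fun u => x (u + v)) ∈ e.space HR VR := by
  rintro x ⟨c, z, f, -, -, -, -, hz, hx⟩ v
  refine exists_cfg_of_rule fun u => ?_
  obtain rfl : x = fun p => e.cfg z f (p + c) := funext hx
  simpa only [add_assoc] using rule_cfg hz (u + (v + c))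

variable (e) in
/-- The free slots in the `n × n` cells of `z`. -/
abbrev Slot (z : ℤ → ℤ → S) (n : ℕ) : Type :=
  {p : Fin n × Fin n // z (p.1 : ℕ) (p.2 : ℕ) ∈ e.E} × Fin e.t × e.R

/-- The block column and the row of a slot. -/
def Slot.addr {z : ℤ → ℤ → S} {n : ℕ} (s : e.Slot z n) : ℤ × ℤ :=
  (e.t * (s.1.1.1 : ℕ) + (s.2.1 : ℕ), e.K * (s.1.1.2 : ℕ) + (s.2.2 : ℕ))

theorem Slot.addr_injective {z : ℤ → ℤ → S} {n : ℕ} :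
    Function.Injective (Slot.addr : e.Slot z n → ℤ × ℤ) := by
  have key : ∀ {K a b c d : ℕ}, b < K → d < K → (K : ℤ) * a + b = K * c + d → a = c ∧ b = d := by
    intro K a b c d hb hd h
    have h1 : K * a + b = K * c + d := by exact_mod_cast h
    have h2 : a = c := by
      have := congrArg (· / K) h1
      simpa [Nat.mul_add_div (show 0 < K by omega), Nat.div_eq_of_lt hb, Nat.div_eq_of_lt hd]
        using this
    subst h2
    exact ⟨rfl, by omega⟩
  rintro ⟨⟨⟨X, Y⟩, h⟩, j, r⟩ ⟨⟨⟨X', Y'⟩, h'⟩, j', r'⟩ hs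
  simp only [addr, Prod.mk.injEq] at hs
  obtain ⟨h1, h2⟩ := key j.2 j'.2 hs.1
  obtain ⟨h3, h4⟩ := key (e.R_spec _ r.2).2.2 (e.R_spec _ r'.2).2.2 hs.2
  simp only [Prod.mk.injEq, Subtype.mk.injEq]
  exact ⟨⟨Fin.ext h1, Fin.ext h3⟩, Fin.ext h2, Subtype.ext h4⟩

/-- The filling determined by the contents of the slots. -/
noncomputable def fill {z : ℤ → ℤ → S} {n : ℕ} (g : e.Slot z n → Fin (2 ^ e.q)) (c y : ℤ) :
    Fin (2 ^ e.q) :=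
  Function.extend Slot.addr g (fun _ => e.u) (c, y)

theorem card_slot (z : ℤ → ℤ → S) (n : ℕ) :
    Nat.card (e.Slot z n) = cellCount e.E z n * (e.t * e.R.card) := by
  simp only [Nat.card_prod, Nat.card_eq_fintype_card (α := Fin _), Fintype.card_fin,
    Nat.card_eq_fintype_card (α := e.R), Fintype.card_coe]
  rfl

theorem card_fillings (z : ℤ → ℤ → S) (n : ℕ) :
    Nat.card (e.Slot z n → Fin (2 ^ e.q)) = 2 ^ (e.q * (cellCount e.E z n * (e.t * e.R.card))) := by
  rw [Nat.card_fun, card_slot, Nat.card_eq_fintype_card, Fintype.card_fin, ← pow_mul]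

theorem cfg_congr {z z' : ℤ → ℤ → S} {f : ℤ → ℤ → Fin (2 ^ e.q)} {n : ℕ}
    (h : ∀ i j : Fin n, z (i : ℕ) (j : ℕ) = z' (i : ℕ) (j : ℕ)) {p : ℤ × ℤ} (h0 : 0 ≤ p.1)
    (h1 : p.1 < n * e.K) (h2 : 0 ≤ p.2) (h3 : p.2 < n * e.K) :
    e.cfg z f p = e.cfg z' (fill fun s : e.Slot z' n => f s.addr.1 s.addr.2) p := by
  have hK : (0 : ℤ) < e.K := by exact_mod_cast e.K_pos
  have hl : (0 : ℤ) < e.l := by exact_mod_cast e.l_pos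
  obtain ⟨X, hX⟩ : ∃ X : ℕ, p.1 / e.K = X := ⟨_, (Int.toNat_of_nonneg (Int.ediv_nonneg h0 hK.le)).symm⟩
  obtain ⟨Y, hY⟩ : ∃ Y : ℕ, p.2 / e.K = Y := ⟨_, (Int.toNat_of_nonneg (Int.ediv_nonneg h2 hK.le)).symm⟩
  have hXn : X < n := by
    have := Int.ediv_lt_of_lt_mul hK h1
    omega
  have hYn : Y < n := by
    have := Int.ediv_lt_of_lt_mul hK h3
    omega
  have hi0 := Int.emod_nonneg p.1 hK.ne'
  have hi1 := Int.emod_lt_of_pos p.1 hK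
  have hr0 := Int.emod_nonneg p.2 hK.ne'
  have hr1 := Int.emod_lt_of_pos p.2 hK
  have hp : p = ((e.K : ℤ) * X + p.1 % e.K, (e.K : ℤ) * Y + p.2 % e.K) := by
    rw [← hX, ← hY, Int.mul_ediv_add_emod, Int.mul_ediv_add_emod]
  rw [hp, cfg_apply _ _ hi0 hi1 hr0 hr1, cfg_apply _ _ hi0 hi1 hr0 hr1, h ⟨X, hXn⟩ ⟨Y, hYn⟩]
  congr 1
  simp only [cellIdx]
  split_ifs with ha hb hc
  · rfl
  · rfl
  · have hj0 : 0 ≤ p.1 % e.K / e.l := Int.ediv_nonneg hi0 hl.le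
    have hj1 : p.1 % e.K / e.l < e.t := Int.ediv_lt_of_lt_mul hl (by
      rw [mul_comm, ← K_cast]
      exact hi1)
    let s : e.Slot z' n := (⟨(⟨X, hXn⟩, ⟨Y, hYn⟩), hc.2⟩, ⟨(p.1 % e.K / e.l).toNat, by omega⟩,
      ⟨_, hc.1⟩)
    have hs : ((e.t : ℤ) * X + p.1 % e.K / e.l, (e.K : ℤ) * Y + p.2 % e.K) = s.addr := by
      simp only [s, Slot.addr, Int.toNat_of_nonneg hj0, Int.toNat_of_nonneg hr0]
    rw [fill, hs, Slot.addr_injective.extend_apply, ← hs]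
  · rfl
  · rfl

theorem cfg_fill {z : ℤ → ℤ → S} {n : ℕ} (g : e.Slot z n → Fin (2 ^ e.q)) (s : e.Slot z n) {i : ℤ}
    (h0 : 0 ≤ i) (h1 : i < e.l) :
    e.cfg z (fill g) ((e.K : ℤ) * (s.1.1.1 : ℕ) + (e.l * (s.2.1 : ℕ) + i),
      (e.K : ℤ) * (s.1.1.2 : ℕ) + (s.2.2 : ℕ)) = e.W (g s) (e.l * (s.2.1 : ℕ) + i) := by
  have hl : (0 : ℤ) < e.l := by exact_mod_cast e.l_pos
  have hR := e.R_spec _ s.2.2.2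
  have hb := e.two_le_b
  have hj : ((s.2.1 : ℕ) : ℤ) < e.t := by exact_mod_cast s.2.1.2
  have hlt : (e.l : ℤ) * (s.2.1 : ℕ) + i < e.K := by
    rw [K_cast]
    nlinarith
  have hr : ((s.2.2 : ℕ) : ℤ) < e.K := by
    rw [K]
    exact_mod_cast hR.2.2
  rw [cfg_apply _ _ (by positivity) hlt (by positivity) hr]
  have hdiv : ((e.l : ℤ) * (s.2.1 : ℕ) + i) / e.l = (s.2.1 : ℕ) := by
    rw [add_comm, Int.add_mul_ediv_left _ _ (by omega), Int.ediv_eq_zero_of_lt h0 h1, zero_add]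
  rw [hdiv, cellIdx, if_neg (by omega), Int.toNat_natCast, if_pos ⟨s.2.2.2, s.1.2⟩]
  congr 1
  exact Slot.addr_injective.extend_apply g _ s

end Enc

end HEnt

namespace HEnt

namespace Enc

variable {A S : Type*} {e : Enc A S} {HR VR : S → S → Prop}

theorem pow_le_patCount2 [Finite A] [Finite S] {z : ℤ → ℤ → S} (hz : z ∈ Adj HR VR) (n : ℕ) :
    2 ^ (e.q * (cellCount e.E z n * (e.t * e.R.card))) ≤
      patCount2 (e.space HR VR) (n * e.K) (n * e.K) := by
  have hK : (0 : ℤ) < e.K := by exact_mod_cast e.K_pos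
  set Q := {p : Fin (n * e.K) → Fin (n * e.K) → A | ∃ x ∈ e.space HR VR,
    ∀ (i : Fin (n * e.K)) (j : Fin (n * e.K)), x ((i : ℤ), (j : ℤ)) = p i j}
  rw [← card_fillings (e := e) z n]
  refine Nat.card_le_card_of_injective (fun g : e.Slot z n → Fin (2 ^ e.q) =>
    (⟨fun i j => e.cfg z (fill g) ((i : ℕ), (j : ℕ)), e.cfg z (fill g),
      ⟨0, z, fill g, le_rfl, hK, le_rfl, hK, hz, fun p => by rw [add_zero]⟩,
      fun i j => rfl⟩ : Q)) fun g g' h => funext fun s => e.W_inj (funext fun i => ?_)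
  have key := e.W_eq_of_block (c := g s) (c' := g' s) (j := (s.2.1 : ℕ)) (d := 0) fun i h0 h1 => by
    obtain ⟨i, rfl⟩ := Int.eq_ofNat_of_zero_le h0
    have hR := (e.R_spec _ s.2.2.2).2.2
    have h2 : e.l * (s.2.1 : ℕ) + i < e.K := by
      have := s.2.1.2
      rw [K]
      have h1 : i < e.l := by exact_mod_cast h1
      nlinarith
    have h3 : ∀ (X : Fin n) (j : ℕ), j < e.K → e.K * (X : ℕ) + j < n * e.K := fun X j hj => by
      have := X.2
      nlinarith
    have h4 := congrFun (congrFun (congrArg Subtype.val h) ⟨_, h3 s.1.1.1 _ h2⟩)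
      ⟨_, h3 s.1.1.2 _ hR⟩
    simp only at h4
    push_cast at h4
    rw [zero_add]
    rwa [cfg_fill g s h0 h1, cfg_fill g' s h0 h1] at h4
  simpa using key i

theorem patCount2_le [Finite A] [Finite S] {n M : ℕ}
    (hM : ∀ z ∈ Adj HR VR, cellCount e.E z (n + 1) ≤ M) :
    patCount2 (e.space HR VR) (n * e.K) (n * e.K) ≤
      e.K ^ 2 * sqCount (Adj HR VR) (n + 1) * 2 ^ (e.q * (M * (e.t * e.R.card))) := by
  classical
  set P := {p : Fin (n + 1) → Fin (n + 1) → S | ∃ z ∈ Adj HR VR, ∀ i i', p i i' = z (i : ℕ) (i' : ℕ)}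
    with hP
  set Q := {p : Fin (n * e.K) → Fin (n * e.K) → A | ∃ x ∈ e.space HR VR,
    ∀ (i : Fin (n * e.K)) (j : Fin (n * e.K)), x ((i : ℤ), (j : ℤ)) = p i j} with hQ
  choose z hz hzp using fun p : P => p.2
  let Φ (a : (Fin e.K × Fin e.K) × P) (g : e.Slot (z a.2) (n + 1) → Fin (2 ^ e.q)) :
      Fin (n * e.K) → Fin (n * e.K) → A :=
    fun i j => e.cfg (z a.2) (fill g) (((i : ℕ) : ℤ) + (a.1.1 : ℕ), ((j : ℕ) : ℤ) + (a.1.2 : ℕ))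
  have hsub : Q ⊆ ⋃ a, Set.range (Φ a) := by
    rintro p ⟨x, ⟨⟨c, d⟩, w, f, h0, h1, h2, h3, hw, hx⟩, hp⟩
    obtain ⟨c, rfl⟩ := Int.eq_ofNat_of_zero_le h0
    obtain ⟨d, rfl⟩ := Int.eq_ofNat_of_zero_le h2
    simp only [Nat.cast_lt] at h1 h3
    let a : (Fin e.K × Fin e.K) × P := ((⟨c, h1⟩, ⟨d, h3⟩), ⟨_, w, hw, fun i i' => rfl⟩)
    refine Set.mem_iUnion.2 ⟨a, fun s => f s.addr.1 s.addr.2, ?_⟩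
    funext i j
    have hlt : ∀ {i c : ℕ}, i < n * e.K → c < e.K → ((i : ℤ) + c) < ((n + 1 : ℕ) : ℤ) * e.K :=
      fun hi hc => by
        push_cast
        rw [add_mul, one_mul]
        exact_mod_cast add_lt_add hi hc
    rw [← hp, hx]
    exact (cfg_congr (n := n + 1) (fun i j => hzp a.2 i j) (p := (((i : ℕ) : ℤ) + c, ((j : ℕ) : ℤ) + d))
      (by positivity) (hlt i.2 h1) (by positivity) (hlt j.2 h3)).symm
  have hcard : Nat.card ((Fin e.K × Fin e.K) × P) = e.K ^ 2 * sqCount (Adj HR VR) (n + 1) := by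
    rw [Nat.card_prod, Nat.card_prod, Nat.card_eq_fintype_card, Fintype.card_fin, ← sq]
    rfl
  have hfin : Finite ((Fin e.K × Fin e.K) × P) := inferInstance
  have := Fintype.ofFinite ((Fin e.K × Fin e.K) × P)
  calc Q.ncard ≤ (⋃ a, Set.range (Φ a)).ncard := Set.ncard_le_ncard hsub (Set.toFinite _)
    _ = (Finset.univ.biUnion fun a => (Set.toFinite (Set.range (Φ a))).toFinset).card := by
      rw [← Set.ncard_coe_finset]
      simp
    _ ≤ Finset.univ.card * 2 ^ (e.q * (M * (e.t * e.R.card))) := by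
      refine Finset.card_biUnion_le_card_mul _ _ _ fun a _ => ?_
      rw [← Set.ncard_eq_toFinset_card]
      calc (Set.range (Φ a)).ncard ≤ Nat.card (e.Slot (z a.2) (n + 1) → Fin (2 ^ e.q)) := by
            rw [← Set.image_univ, ← Set.ncard_univ]
            exact Set.ncard_image_le (Set.toFinite _)
        _ ≤ _ := by
          rw [card_fillings]
          gcongr
          · norm_num
          · exact hM _ (hz _)
    _ = _ := by rw [Finset.card_univ, ← Nat.card_eq_fintype_card, hcard]

theorem le_of_frequently_quadratic {a b C : ℝ} (ha : 0 ≤ a)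
    (h : ∀ n₀ : ℕ, ∃ n ≥ n₀, a * ((n : ℝ) - 1) ^ 2 ≤ C + b * (n : ℝ) ^ 2) : a ≤ b := by
  refine le_of_forall_pos_le_add fun ε hε => ?_
  obtain ⟨n₀, hn₀⟩ := exists_nat_gt ((|C| + 2 * a) / ε + 1)
  obtain ⟨n, hn, h1⟩ := h n₀
  have hn' : (|C| + 2 * a) / ε + 1 < n := hn₀.trans_le (by exact_mod_cast hn)
  have h0 : 0 ≤ (|C| + 2 * a) / ε := by positivity
  have h2 : |C| + 2 * a ≤ ε * n := by
    have : (|C| + 2 * a) / ε ≤ n := by linarith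
    rwa [div_le_iff₀ hε, mul_comm (n : ℝ)] at this
  have hn1 : (1 : ℝ) ≤ n := by linarith
  have h3 : C ≤ |C| * n := (le_abs_self C).trans (le_mul_of_one_le_right (abs_nonneg _) hn1)
  have h4 : a * (n : ℝ) ^ 2 ≤ (b + ε) * (n : ℝ) ^ 2 := by nlinarith
  exact le_of_mul_le_mul_right h4 (by positivity)

theorem entropy2_space [Finite A] [Finite S] {θ : ℝ}
    (hup : ∀ ε > 0, ∀ n₀ : ℕ, ∃ n ≥ n₀, 0 < n ∧ (sqCount (Adj HR VR) n : ℝ) ≤ 2 ^ (ε * (n : ℝ) ^ 2) ∧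
      ∀ z ∈ Adj HR VR, (cellCount e.E z n : ℝ) ≤ (θ + ε) * (n : ℝ) ^ 2)
    {z : ℤ → ℤ → S} (hz : z ∈ Adj HR VR)
    (hlow : ∀ ε > 0, ∀ n₀ : ℕ, ∃ n ≥ n₀, 0 < n ∧ (θ - ε) * (n : ℝ) ^ 2 ≤ cellCount e.E z n) :
    entropy2 (e.space HR VR) * (e.K : ℝ) ^ 2 = θ * (e.q * e.t * e.R.card) := by
  set D : ℝ := (e.q * e.t * e.R.card) with hD
  have hD0 : 0 ≤ D := by positivity
  have hK : (0 : ℤ) < e.K := by exact_mod_cast e.K_pos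
  have hKr : (0 : ℝ) < e.K := by exact_mod_cast e.K_pos
  have hne : (e.space HR VR).Nonempty := ⟨e.cfg z fun _ _ => e.u, 0, z, _, le_rfl, hK, le_rfl, hK, hz,
    fun p => by rw [add_zero]⟩
  refine le_antisymm ?_ ?_
  · refine le_of_forall_pos_le_add fun ε hε => ?_
    set δ := ε / (1 + D) with hδ
    have hδ0 : 0 < δ := by positivity
    have key : entropy2 (e.space HR VR) * (e.K : ℝ) ^ 2 ≤ δ + (θ + δ) * D := by
      refine le_of_frequently_quadratic (C := 2 * Real.logb 2 e.K)
        (mul_nonneg (entropy2_nonneg _) (by positivity)) fun n₀ => ?_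
      obtain ⟨n, hn, hn0, h1, h2⟩ := hup δ hδ0 (n₀ + 2)
      obtain ⟨n, rfl⟩ : ∃ m, n = m + 1 := ⟨n - 1, by omega⟩
      refine ⟨n + 1, by omega, ?_⟩
      set M := ⌊(θ + δ) * ((n + 1 : ℕ) : ℝ) ^ 2⌋₊ with hM
      have h3 : (M : ℝ) ≤ (θ + δ) * ((n + 1 : ℕ) : ℝ) ^ 2 :=
        Nat.floor_le ((Nat.cast_nonneg _).trans (h2 z hz))
      have h4 := patCount2_le (e := e) (HR := HR) (VR := VR) (n := n) (M := M)
        fun z hz => Nat.le_floor (h2 z hz)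
      have h5 := entropy2_mul_le (e.space HR VR) (n := n * e.K)
        (Nat.mul_pos (by omega) e.K_pos)
      have h6 : (0 : ℝ) < patCount2 (e.space HR VR) (n * e.K) (n * e.K) := by
        exact_mod_cast patCount2_pos hne _ _
      have h7 : (0 : ℝ) < sqCount (Adj HR VR) (n + 1) := by
        have : sqCount (Adj HR VR) (n + 1) ≠ 0 := fun h0 => by
          rw [h0] at h4
          have : 0 < patCount2 (e.space HR VR) (n * e.K) (n * e.K) := patCount2_pos hne _ _
          omega
        exact_mod_cast Nat.pos_of_ne_zero this
      have h8 : Real.logb 2 (patCount2 (e.space HR VR) (n * e.K) (n * e.K)) ≤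
          2 * Real.logb 2 e.K + Real.logb 2 (sqCount (Adj HR VR) (n + 1)) + M * D := by
        have h9 : (patCount2 (e.space HR VR) (n * e.K) (n * e.K) : ℝ) ≤
            (e.K : ℝ) ^ 2 * sqCount (Adj HR VR) (n + 1) * 2 ^ (e.q * (M * (e.t * e.R.card))) := by
          exact_mod_cast h4
        refine (Real.logb_le_logb_of_le (by norm_num) h6 h9).trans (le_of_eq ?_)
        rw [Real.logb_mul (by positivity) (by positivity), Real.logb_mul (by positivity) h7.ne',
          Real.logb_pow, Real.logb_pow, Real.logb_self_eq_one (by norm_num), hD]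
        push_cast
        ring
      have h10 : Real.logb 2 (sqCount (Adj HR VR) (n + 1)) ≤ δ * ((n + 1 : ℕ) : ℝ) ^ 2 := by
        rwa [Real.logb_le_iff_le_rpow (by norm_num) h7]
      have h11 : (M : ℝ) * D ≤ (θ + δ) * ((n + 1 : ℕ) : ℝ) ^ 2 * D := by gcongr
      push_cast at h5 h10 h11 ⊢
      nlinarith
    have h1 : δ * (1 + D) = ε := by rw [hδ]; field_simp
    linarith
  · rcases hD0.eq_or_lt with hD1 | hD1
    · rw [← hD1, mul_zero]
      exact mul_nonneg (entropy2_nonneg _) (by positivity)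
    refine le_of_forall_pos_le_add fun ε hε => ?_
    have key : (θ - ε / D) * D / (e.K : ℝ) ^ 2 ≤ entropy2 (e.space HR VR) := by
      refine le_entropy2 space_shift hne fun n₀ => ?_
      obtain ⟨n, hn, hn0, h1⟩ := hlow (ε / D) (by positivity) n₀
      refine ⟨n * e.K, hn.trans (Nat.le_mul_of_pos_right _ e.K_pos), ?_⟩
      have h2 := pow_le_patCount2 (e := e) hz n
      have h3 : (cellCount e.E z n : ℝ) * D ≤
          Real.logb 2 (patCount2 (e.space HR VR) (n * e.K) (n * e.K)) := by
        rw [Real.le_logb_iff_rpow_le (by norm_num) (by exact_mod_cast patCount2_pos hne _ _)]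
        have h4 : (cellCount e.E z n : ℝ) * D =
            ((e.q * (cellCount e.E z n * (e.t * e.R.card)) : ℕ) : ℝ) := by
          rw [hD]
          push_cast
          ring
        rw [h4, Real.rpow_natCast]
        exact_mod_cast h2
      refine le_trans (le_of_eq_of_le ?_ (mul_le_mul_of_nonneg_right h1 hD0)) h3
      push_cast
      field_simp
    rw [div_le_iff₀ (by positivity)] at key
    have h1 : (θ - ε / D) * D = θ * D - ε := by field_simp
    linarith

end Enc

end HEnt

namespace HEnt

section RatEncoding

theorem primrec_gcd : Primrec₂ Nat.gcd := by
  have h : ∀ a b : ℕ, Nat.gcd a b = Nat.findGreatest (fun c => c ∣ a ∧ c ∣ b) (a + b) := by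
    intro a b
    refine le_antisymm (Nat.le_findGreatest ?_ ⟨Nat.gcd_dvd_left a b, Nat.gcd_dvd_right a b⟩) ?_
    · rcases Nat.eq_zero_or_pos a with rfl | ha
      · simp
      · exact (Nat.gcd_le_left b ha).trans (Nat.le_add_right _ _)
    · rcases Nat.eq_zero_or_pos (a + b) with h0 | h0
      · simp [h0]
      · have h1 := Nat.findGreatest_spec (P := fun c => c ∣ a ∧ c ∣ b) (m := 1) (n := a + b) h0
          ⟨one_dvd _, one_dvd _⟩
        exact Nat.le_of_dvd (Nat.gcd_pos_iff.2 (by omega)) (Nat.dvd_gcd h1.1 h1.2)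
  have hdvd : ∀ c a : ℕ, c ∣ a ↔ a % c = 0 := fun c a => Nat.dvd_iff_mod_eq_zero
  have h2 : Primrec fun p : ℕ × ℕ => Nat.findGreatest (fun c => c ∣ p.1 ∧ c ∣ p.2) (p.1 + p.2) := by
    refine Primrec.nat_findGreatest (p := fun (p : ℕ × ℕ) c => c ∣ p.1 ∧ c ∣ p.2)
      (Primrec.nat_add.comp Primrec.fst Primrec.snd) ?_
    simp only [hdvd]
    exact PrimrecPred.and
      (Primrec.eq.comp (Primrec.nat_mod.comp (Primrec.fst.comp Primrec.fst) Primrec.snd)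
        (Primrec.const 0))
      (Primrec.eq.comp (Primrec.nat_mod.comp (Primrec.snd.comp Primrec.fst) Primrec.snd)
        (Primrec.const 0))
  exact h2.of_eq fun p => (h _ _).symm

theorem encode_rat (q : ℚ) : @Encodable.encode ℚ Rat.instEncodable q =
    Nat.pair (Encodable.encode q.num) q.den := rfl

theorem natAbs_eq_encode (a : ℤ) : a.natAbs = (Encodable.encode a + 1) / 2 := by
  cases a with
  | ofNat a =>
    have : Encodable.encode (Int.ofNat a) = 2 * a := rfl
    rw [this]
    simp only [Int.ofNat_eq_natCast, Int.natAbs_natCast]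
    omega
  | negSucc a =>
    have : Encodable.encode (Int.negSucc a) = 2 * a + 1 := rfl
    rw [this, Int.natAbs_negSucc]
    omega

theorem mem_range_encode_rat (n : ℕ) : n ∈ Set.range (@Encodable.encode ℚ Rat.instEncodable) ↔
    0 < n.unpair.2 ∧ Nat.gcd ((n.unpair.1 + 1) / 2) n.unpair.2 = 1 := by
  constructor
  · rintro ⟨q, rfl⟩
    rw [encode_rat]
    simp only [Nat.unpair_pair, ← natAbs_eq_encode]
    exact ⟨q.den_pos, q.reduced⟩
  · rintro ⟨h0, h1⟩
    obtain ⟨a, ha⟩ : ∃ a : ℤ, Encodable.encode a = n.unpair.1 :=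
      ⟨Denumerable.ofNat ℤ _, Denumerable.encode_ofNat _⟩
    rw [← ha, ← natAbs_eq_encode] at h1
    refine ⟨⟨a, n.unpair.2, h0.ne', h1⟩, ?_⟩
    rw [encode_rat]
    simp only [ha, Nat.pair_unpair]

theorem encode_rat_eq_sum (q : ℚ) : @Encodable.encode ℚ (Primcodable.ofDenumerable ℚ).toEncodable q =
    ∑ n ∈ Finset.range (Nat.pair (Encodable.encode q.num) q.den),
      if 0 < n.unpair.2 ∧ Nat.gcd ((n.unpair.1 + 1) / 2) n.unpair.2 = 1 then 1 else 0 := by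
  have h1 : @Encodable.encode ℚ (Primcodable.ofDenumerable ℚ).toEncodable q =
      (List.range (@Encodable.encode ℚ Rat.instEncodable q)).countP
        (fun n => @decide (n ∈ Set.range (@Encodable.encode ℚ Rat.instEncodable))
          (Encodable.decidableRangeEncode ℚ n)) := rfl
  rw [h1, encode_rat, Finset.sum_boole, List.countP_eq_length_filter]
  simp only [mem_range_encode_rat, Nat.cast_id]
  rfl

theorem primrec_ratio : Primrec₂ fun a b : ℕ => (a : ℚ) / ((b + 1 : ℕ) : ℚ) := by
  rw [Primrec₂, ← Primrec.encode_iff]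
  have h1 : ∀ a b : ℕ, Nat.pair (Encodable.encode ((a : ℚ) / ((b + 1 : ℕ) : ℚ)).num)
      ((a : ℚ) / ((b + 1 : ℕ) : ℚ)).den =
        Nat.pair (2 * (a / Nat.gcd a (b + 1))) ((b + 1) / Nat.gcd a (b + 1)) := by
    intro a b
    have hg : 0 < Nat.gcd a (b + 1) := Nat.gcd_pos_of_pos_right _ b.succ_pos
    obtain ⟨a', ha⟩ := Nat.gcd_dvd_left a (b + 1)
    obtain ⟨b', hb⟩ := Nat.gcd_dvd_right a (b + 1)
    have hb0 : 0 < b' := Nat.pos_of_ne_zero fun h => by simp [h] at hb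
    have hc : Nat.Coprime a' b' := by
      have := Nat.coprime_div_gcd_div_gcd hg
      rwa [Nat.div_eq_of_eq_mul_right hg ha, Nat.div_eq_of_eq_mul_right hg hb] at this
    have h2 : (a : ℚ) / ((b + 1 : ℕ) : ℚ) = ((a' : ℤ) : ℚ) / ((b' : ℤ) : ℚ) := by
      have h3 : (a : ℚ) = (Nat.gcd a (b + 1) : ℕ) * (a' : ℕ) := by exact_mod_cast ha
      have h4 : ((b + 1 : ℕ) : ℚ) = (Nat.gcd a (b + 1) : ℕ) * (b' : ℕ) := by exact_mod_cast hb
      have h5 : ((Nat.gcd a (b + 1) : ℕ) : ℚ) ≠ 0 := by exact_mod_cast hg.ne'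
      rw [h3, h4, mul_div_mul_left _ _ h5]
      simp
    have h6 : ((a : ℚ) / ((b + 1 : ℕ) : ℚ)).num = a' := by
      rw [h2, Rat.num_div_eq_of_coprime (a := a') (b := b') (by exact_mod_cast hb0) hc]
    have h7 : ((a : ℚ) / ((b + 1 : ℕ) : ℚ)).den = b' := by
      have := Rat.den_div_eq_of_coprime (a := a') (b := b') (by exact_mod_cast hb0) hc
      rw [h2]
      exact_mod_cast this
    rw [h6, h7, Nat.div_eq_of_eq_mul_right hg ha, Nat.div_eq_of_eq_mul_right hg hb]
    rfl
  refine Primrec.of_eq ?_ fun p : ℕ × ℕ => ((encode_rat_eq_sum _).trans (by rw [h1])).symm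
  have hg : Primrec fun p : ℕ × ℕ => Nat.gcd p.1 (p.2 + 1) :=
    primrec_gcd.comp Primrec.fst (Primrec.succ.comp Primrec.snd)
  refine primrec_sum_range ?_ ?_
  · exact Primrec₂.natPair.comp
      (Primrec.nat_mul.comp (Primrec.const 2) (Primrec.nat_div.comp Primrec.fst hg))
      (Primrec.nat_div.comp (Primrec.succ.comp Primrec.snd) hg)
  · have hu : Primrec fun p : (ℕ × ℕ) × ℕ => p.2.unpair := Primrec.unpair.comp Primrec.snd
    refine Primrec.ite (PrimrecPred.and ?_ ?_) (Primrec.const 1) (Primrec.const 0)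
    · exact Primrec.nat_lt.comp (Primrec.const 0) (Primrec.snd.comp hu)
    · exact Primrec.eq.comp (primrec_gcd.comp (Primrec.nat_div.comp
        (Primrec.succ.comp (Primrec.fst.comp hu)) (Primrec.const 2)) (Primrec.snd.comp hu))
        (Primrec.const 1)

theorem exists_computable_ratio {f : ℕ → ℚ} (hf : Computable f) (h0 : ∀ n, 0 ≤ f n) :
    ∃ N D : ℕ → ℕ, Computable N ∧ Computable D ∧ ∀ n, f n = (N n : ℚ) / ((D n + 1 : ℕ) : ℚ) := by
  classical
  let p : ℕ → ℕ → Bool := fun n m =>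
    decide (f n = (m.unpair.1 : ℚ) / ((m.unpair.2 + 1 : ℕ) : ℚ))
  have hp : Computable₂ p := by
    have h1 : Computable fun a : ℕ × ℕ => ((a.2.unpair.1 : ℚ) / ((a.2.unpair.2 + 1 : ℕ) : ℚ)) :=
      (primrec_ratio.comp (Primrec.fst.comp (Primrec.unpair.comp Primrec.snd))
        (Primrec.snd.comp (Primrec.unpair.comp Primrec.snd))).to_comp
    exact (Primrec.eq.decide.to_comp).comp (hf.comp Computable.fst) h1
  have hex : ∀ n, ∃ m, p n m = true := fun n => by
    refine ⟨Nat.pair (f n).num.toNat ((f n).den - 1), ?_⟩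
    have h1 : ((f n).num.toNat : ℚ) = (f n).num := by
      exact_mod_cast congrArg (Int.cast (R := ℚ)) (Int.toNat_of_nonneg (Rat.num_nonneg.2 (h0 n)))
    simp only [p, Nat.unpair_pair, decide_eq_true_eq, h1, Nat.sub_add_cancel (f n).den_pos]
    exact (Rat.num_div_den _).symm
  let g : ℕ → ℕ := fun n => Nat.find (hex n)
  have hg : Computable g := by
    have h1 : Partrec fun n => Nat.rfind fun m => (Part.some (p n m) : Part Bool) :=
      Partrec.rfind hp.partrec₂
    refine h1.of_eq_tot fun n => ?_
    refine Nat.mem_rfind.2 ⟨by simpa using Nat.find_spec (hex n), fun hm => by simpa using Nat.find_min (hex n) hm⟩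
  refine ⟨fun n => (g n).unpair.1, fun n => (g n).unpair.2,
    (Computable.fst.comp (Computable.unpair.comp hg)),
    (Computable.snd.comp (Computable.unpair.comp hg)), fun n => ?_⟩
  exact of_decide_eq_true (Nat.find_spec (hex n))

end RatEncoding

end HEnt

namespace HEnt

open Filter Topology

section LocalPatterns

variable {A : Type*}

theorem patCount2_mono [Finite A] {X Y : Set (ℤ × ℤ → A)} (h : X ⊆ Y) (m n : ℕ) :
    patCount2 X m n ≤ patCount2 Y m n :=
  Set.ncard_le_ncard (fun _ ⟨x, hx, hp⟩ => ⟨x, h hx, hp⟩) (Set.toFinite _)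

theorem patCount2_le_prod [Finite A] {X : Set (ℤ × ℤ → A)} {M N r : ℕ} (hN : 0 < N)
    (hM : M ≤ r * N) (Y : Fin r × Fin r → Set (ℤ × ℤ → A))
    (hY : ∀ x ∈ X, ∀ c, ∃ y ∈ Y c, ∀ i j : Fin N,
      x ((i : ℤ) + (c.1 * N : ℕ), (j : ℤ) + (c.2 * N : ℕ)) = y ((i : ℤ), (j : ℤ))) :
    patCount2 X M M ≤ ∏ c, patCount2 (Y c) N N := by
  set P := fun c => {p : Fin N → Fin N → A | ∃ x ∈ Y c, ∀ (i : Fin N) (j : Fin N),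
    x ((i : ℤ), (j : ℤ)) = p i j}
  set Q := {p : Fin M → Fin M → A | ∃ x ∈ X, ∀ (i : Fin M) (j : Fin M),
    x ((i : ℤ), (j : ℤ)) = p i j}
  have h1 : Nat.card (∀ c, P c) = ∏ c, patCount2 (Y c) N N := Nat.card_pi
  have h2 : Nat.card Q = patCount2 X M M := rfl
  rw [← h1, ← h2]
  choose x hx hxp using fun p : Q => p.2
  choose y hy hyx using hY
  refine Nat.card_le_card_of_injective (fun (p : Q) c => (⟨fun i j =>
    x p ((i : ℤ) + (c.1 * N : ℕ), (j : ℤ) + (c.2 * N : ℕ)),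
    _, hy _ (hx p) c, fun i j => (hyx _ (hx p) c i j).symm⟩ : P c)) ?_
  intro p p' h
  ext i j
  have hd : ∀ i : Fin M, (i : ℕ) / N < r := fun i =>
    (Nat.div_lt_iff_lt_mul hN).2 (i.2.trans_le hM)
  have h3 := congrFun (congrFun (congrArg Subtype.val (congrFun h (⟨i / N, hd i⟩, ⟨j / N, hd j⟩)))
    ⟨i % N, Nat.mod_lt _ hN⟩) ⟨j % N, Nat.mod_lt _ hN⟩
  simp only [← Nat.cast_add, Nat.mod_add_div'] at h3
  rwa [hxp, hxp] at h3

/-- The configurations in which no pattern of `F` occurs at a position whose `R`-neighborhood is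
contained in `[0,n) × [0,n)`. -/
def LocalSFT (F : Finset (Pattern2 A)) (R n : ℕ) : Set (ℤ × ℤ → A) :=
  {x | ∀ v : ℤ × ℤ, (R : ℤ) ≤ v.1 → v.1 + R < n → (R : ℤ) ≤ v.2 → v.2 + R < n →
    ∀ p ∈ F, ∃ u ∈ p.support, x (u + v) ≠ p.val u}

theorem not_occursIn_iff {p : Pattern2 A} {x : ℤ × ℤ → A} :
    ¬ p.OccursIn x ↔ ∀ v, ∃ u ∈ p.support, x (u + v) ≠ p.val u := by
  simp only [Pattern2.OccursIn, not_exists, not_forall, exists_prop, ne_eq]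

theorem SFT2_subset_localSFT (F : Finset (Pattern2 A)) (R n : ℕ) : SFT2 F ⊆ LocalSFT F R n :=
  fun _ hx v _ _ _ _ p hp => not_occursIn_iff.1 (hx p hp) v

theorem SFT2.shift {F : Finset (Pattern2 A)} {x : ℤ × ℤ → A} (hx : x ∈ SFT2 F) (c : ℤ × ℤ) :
    (fun v => x (v + c)) ∈ SFT2 F := fun p hp => not_occursIn_iff.2 fun v => by
  obtain ⟨u, hu, h⟩ := not_occursIn_iff.1 (hx p hp) (v + c)
  exact ⟨u, hu, by rwa [← add_assoc] at h⟩

/-- The number of locally admissible square patterns. -/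
noncomputable def localCount (F : Finset (Pattern2 A)) (R n : ℕ) : ℕ :=
  patCount2 (LocalSFT F R n) n n

variable [Finite A] (F : Finset (Pattern2 A)) (R : ℕ)

theorem patCount2_le_localCount (n : ℕ) : patCount2 (SFT2 F) n n ≤ localCount F R n :=
  patCount2_mono (SFT2_subset_localSFT F R n) n n

theorem localCount_two_mul_le {n : ℕ} (hn : 0 < n) :
    localCount F R (2 * n) ≤ localCount F R n ^ 4 := by
  refine (patCount2_le_prod hn le_rfl (fun _ => LocalSFT F R n) fun x hx c =>
    ⟨fun v => x (v + (((c.1 * n : ℕ) : ℤ), ((c.2 * n : ℕ) : ℤ))), ?_, fun i j => rfl⟩).trans ?_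
  · have hc : ∀ a : Fin 2, 0 ≤ ((a * n : ℕ) : ℤ) ∧ ((a * n : ℕ) : ℤ) ≤ n := fun a => by
      have : (a : ℕ) * n ≤ 1 * n := Nat.mul_le_mul_right _ (by omega)
      omega
    have h1 := hc c.1
    have h2 := hc c.2
    intro v hv1 hv2 hv3 hv4 p hp
    obtain ⟨u, hu, h⟩ := hx (v + (((c.1 * n : ℕ) : ℤ), ((c.2 * n : ℕ) : ℤ)))
      (by simp only [Prod.fst_add]; omega) (by simp only [Prod.fst_add]; omega)
      (by simp only [Prod.snd_add]; omega) (by simp only [Prod.snd_add]; omega) p hp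
    exact ⟨u, hu, by rwa [← add_assoc] at h⟩
  · rw [Finset.prod_const, Finset.card_univ, Fintype.card_prod, Fintype.card_fin]
    rfl

/-- Compactness: a configuration which is admissible on a sufficiently large box agrees with an
admissible configuration on a given box. -/
theorem exists_radius (n : ℕ) : ∃ m : ℕ, ∀ x : ℤ × ℤ → A,
    (∀ v : ℤ × ℤ, |v.1| ≤ m → |v.2| ≤ m → ∀ p ∈ F, ∃ u ∈ p.support, x (u + v) ≠ p.val u) →
    ∃ y ∈ SFT2 F, ∀ i j : Fin n, x ((i : ℤ), (j : ℤ)) = y ((i : ℤ), (j : ℤ)) := by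
  by_contra! hcon
  choose x hx hxy using hcon
  have h1 : ∀ u, ∃ a, ∀ᶠ m in (hyperfilter ℕ : Filter ℕ), x m u = a := fun u => by
    obtain ⟨a, ha⟩ := ((hyperfilter ℕ).map fun m => x m u).eq_pure_of_finite
    refine ⟨a, ?_⟩
    have h2 : {a} ∈ (hyperfilter ℕ).map fun m => x m u := by
      rw [ha]
      exact Filter.mem_pure.2 rfl
    exact h2
  choose y hy using h1
  have hlarge : ∀ N : ℕ, ∀ᶠ m in (hyperfilter ℕ : Filter ℕ), N ≤ m := fun N =>
    (Nat.hyperfilter_le_atTop) (eventually_ge_atTop N)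
  have hmem : y ∈ SFT2 F := fun p hp => not_occursIn_iff.2 fun v => by
    have h3 : ∀ᶠ m in (hyperfilter ℕ : Filter ℕ), ∀ u ∈ p.support, x m (u + v) = y (u + v) :=
      (eventually_all_finset _).2 fun u _ => hy _
    obtain ⟨m, hm1, hm2⟩ := (h3.and (hlarge (v.1.natAbs + v.2.natAbs))).exists
    obtain ⟨u, hu, h⟩ := hx m v (by rw [Int.abs_eq_natAbs]; omega)
      (by rw [Int.abs_eq_natAbs]; omega) p hp
    exact ⟨u, hu, by rwa [hm1 u hu] at h⟩
  have h4 : ∀ᶠ m in (hyperfilter ℕ : Filter ℕ), ∀ i j : Fin n,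
      x m ((i : ℤ), (j : ℤ)) = y ((i : ℤ), (j : ℤ)) :=
    eventually_all.2 fun i => eventually_all.2 fun j => hy _
  obtain ⟨m, hm⟩ := h4.exists
  obtain ⟨i, j, hij⟩ := hxy m y hmem
  exact hij (hm i j)

theorem card_boundary_le (s r : ℕ) : (Finset.univ.filter fun c : Fin r × Fin r =>
    ¬ ((s ≤ (c.1 : ℕ) ∧ c.1 + s < r) ∧ s ≤ (c.2 : ℕ) ∧ c.2 + s < r)).card ≤ 4 * s * r := by
  classical
  set B : Finset (Fin r) := Finset.univ.filter fun a => ¬ (s ≤ (a : ℕ) ∧ a + s < r)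
  have hB : B.card ≤ 2 * s := by
    have h1 : B.card ≤ (Finset.range s ∪ Finset.Ico (r - s) r).card := by
      refine Finset.card_le_card_of_injOn (fun a => (a : ℕ)) (fun a ha => ?_)
        (Fin.val_injective.injOn)
      simp only [B, Finset.coe_filter, Finset.mem_univ, true_and, Set.mem_ofPred_eq] at ha
      simp only [Finset.coe_union, Finset.coe_range, Finset.coe_Ico, Set.mem_union, Set.mem_Iio,
        Set.mem_Ico]
      omega
    refine h1.trans ((Finset.card_union_le _ _).trans ?_)
    rw [Finset.card_range, Nat.card_Ico]
    omega
  refine (Finset.card_le_card (t := (B ×ˢ Finset.univ) ∪ (Finset.univ ×ˢ B)) ?_).trans ?_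
  · intro c hc
    simp only [B, Finset.mem_filter, Finset.mem_univ, true_and, Finset.mem_union,
      Finset.mem_product, and_true] at hc ⊢
    tauto
  · refine (Finset.card_union_le _ _).trans ?_
    rw [Finset.card_product, Finset.card_product, Finset.card_univ, Fintype.card_fin]
    nlinarith

theorem exists_localCount_mul_le (hne : (SFT2 F).Nonempty) {n : ℕ} (hn : 0 < n) : ∃ s : ℕ, ∀ r,
    localCount F R (r * n) ≤ patCount2 (SFT2 F) n n ^ r ^ 2 *
      patCount2 (Set.univ : Set (ℤ × ℤ → A)) n n ^ (4 * s * r) := by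
  classical
  obtain ⟨m, hm⟩ := exists_radius F n
  refine ⟨m + R, fun r => ?_⟩
  set s := m + R with hs
  set X := SFT2 F
  set D : Fin r × Fin r → Prop := fun c => (s ≤ (c.1 : ℕ) ∧ c.1 + s < r) ∧ s ≤ (c.2 : ℕ) ∧ c.2 + s < r
    with hD
  have hpos : 0 < patCount2 X n n := patCount2_pos hne n n
  have hpos' : 0 < patCount2 (Set.univ : Set (ℤ × ℤ → A)) n n :=
    hpos.trans_le (patCount2_mono (Set.subset_univ _) n n)
  have h1 : localCount F R (r * n) ≤ ∏ c, patCount2 (if D c then X else Set.univ) n n := by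
    refine patCount2_le_prod hn le_rfl _ fun x hx c => ?_
    by_cases hc : D c
    · simp only [hc, if_true]
      refine hm (fun v => x (v + (((c.1 * n : ℕ) : ℤ), ((c.2 * n : ℕ) : ℤ)))) ?_
      have hb : ∀ (a : Fin r) (w : ℤ), s ≤ (a : ℕ) → a + s < r → |w| ≤ m →
          (R : ℤ) ≤ w + ((a * n : ℕ) : ℤ) ∧ w + ((a * n : ℕ) : ℤ) + R < ((r * n : ℕ) : ℤ) := by
        intro a w ha1 ha2 hw
        have e1 : s * n ≤ a * n := Nat.mul_le_mul_right _ ha1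
        have e2 : (a + s + 1) * n ≤ r * n := Nat.mul_le_mul_right _ ha2
        have e3 : s ≤ s * n := Nat.le_mul_of_pos_right _ hn
        have e4 : (a + s + 1) * n = a * n + s * n + n := by ring
        have := abs_le.1 hw
        omega
      intro v hv1 hv2 p hp
      have b1 := hb c.1 v.1 hc.1.1 hc.1.2 hv1
      have b2 := hb c.2 v.2 hc.2.1 hc.2.2 hv2
      obtain ⟨u, hu, h⟩ := hx (v + (((c.1 * n : ℕ) : ℤ), ((c.2 * n : ℕ) : ℤ)))
        b1.1 b1.2 b2.1 b2.2 p hp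
      exact ⟨u, hu, by rwa [← add_assoc] at h⟩
    · simp only [hc, if_false]
      exact ⟨fun v => x (v + (((c.1 * n : ℕ) : ℤ), ((c.2 * n : ℕ) : ℤ))), trivial, fun i j => rfl⟩
  refine h1.trans ?_
  have h2 : ∀ c, patCount2 (if D c then X else Set.univ) n n ≤
      patCount2 X n n * (if D c then 1 else patCount2 (Set.univ : Set (ℤ × ℤ → A)) n n) := fun c => by
    split_ifs
    · rw [mul_one]
    · exact Nat.le_mul_of_pos_left _ hpos
  refine (Finset.prod_le_prod' fun c _ => h2 c).trans ?_
  rw [Finset.prod_mul_distrib, Finset.prod_const, Finset.card_univ, Fintype.card_prod,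
    Fintype.card_fin, ← sq, Finset.prod_ite, Finset.prod_const_one, one_mul, Finset.prod_const]
  exact Nat.mul_le_mul_left _ (Nat.pow_le_pow_right hpos' (card_boundary_le s r))

/-- The logarithm of the number of locally admissible patterns of side `2 ^ j`, rounded up. -/
noncomputable def localLog (j : ℕ) : ℕ := Nat.clog 2 (localCount F R (2 ^ j))

theorem localLog_succ_le (j : ℕ) : localLog F R (j + 1) ≤ 4 * localLog F R j := by
  rw [localLog, Nat.clog_le_iff_le_pow one_lt_two, pow_succ', mul_comm 4, pow_mul]
  exact (localCount_two_mul_le F R (by positivity)).trans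
    (Nat.pow_le_pow_left (Nat.le_pow_clog one_lt_two _) 4)

theorem antitone_localLog : Antitone fun j => (localLog F R j : ℚ) / ((4 ^ j : ℕ) : ℚ) := by
  refine antitone_nat_of_succ_le fun j => ?_
  have h1 : (localLog F R (j + 1) : ℚ) ≤ 4 * localLog F R j := by exact_mod_cast localLog_succ_le F R j
  push_cast
  rw [div_le_div_iff₀ (by positivity) (by positivity), pow_succ]
  nlinarith [pow_pos (show (0 : ℚ) < 4 by norm_num) j]

theorem tendsto_localLog (hne : (SFT2 F).Nonempty) :
    Tendsto (fun j => (localLog F R j : ℝ) / 4 ^ j) atTop (𝓝 (entropy2 (SFT2 F))) := by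
  set X := SFT2 F with hX
  have hpos : ∀ n, 0 < patCount2 X n n := fun n => patCount2_pos hne n n
  have hpos' : ∀ n, 0 < localCount F R n := fun n =>
    (hpos n).trans_le (patCount2_le_localCount F R n)
  have h4 : ∀ j : ℕ, (4 : ℝ) ^ j = (2 ^ j) ^ 2 := fun j => by
    rw [← pow_mul, mul_comm, pow_mul]
    norm_num
  have hlow : ∀ j, entropy2 X ≤ (localLog F R j : ℝ) / 4 ^ j := fun j => by
    rw [le_div_iff₀ (by positivity), h4]
    have h1 := entropy2_mul_le X (n := 2 ^ j) (by positivity)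
    push_cast at h1
    refine h1.trans ?_
    rw [Real.logb_le_iff_le_rpow (by norm_num) (by exact_mod_cast hpos _), Real.rpow_natCast]
    exact_mod_cast (patCount2_le_localCount F R _).trans (Nat.le_pow_clog one_lt_two _)
  have hup : ∀ i, ∃ C : ℝ, ∀ j ≥ i, (localLog F R j : ℝ) / 4 ^ j ≤
      Real.logb 2 (patCount2 X (2 ^ i) (2 ^ i)) / 4 ^ i + C / 2 ^ j := fun i => by
    obtain ⟨s, hs⟩ := exists_localCount_mul_le F R hne (n := 2 ^ i) (by positivity)
    set c := Real.logb 2 (patCount2 (Set.univ : Set (ℤ × ℤ → A)) (2 ^ i) (2 ^ i))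
    have hcpos : 0 < patCount2 (Set.univ : Set (ℤ × ℤ → A)) (2 ^ i) (2 ^ i) :=
      (hpos _).trans_le (patCount2_mono (Set.subset_univ _) _ _)
    have hc : 0 ≤ c := Real.logb_nonneg (by norm_num) (by exact_mod_cast hcpos)
    refine ⟨4 * s * c + 1, fun j hj => ?_⟩
    obtain ⟨t, rfl⟩ := Nat.exists_eq_add_of_le hj
    have h1 := hs (2 ^ t)
    rw [← pow_add, add_comm t] at h1
    have h2 : (localLog F R (i + t) : ℝ) ≤ Real.logb 2 (localCount F R (2 ^ (i + t))) + 1 := by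
      have h3 := Real.natCeil_logb_natCast 2 (localCount F R (2 ^ (i + t)))
      rw [localLog, ← h3]
      exact (Nat.ceil_lt_add_one (Real.logb_nonneg (by norm_num)
        (by exact_mod_cast hpos' _))).le
    have h3 : Real.logb 2 (localCount F R (2 ^ (i + t))) ≤
        ((2 : ℝ) ^ t) ^ 2 * Real.logb 2 (patCount2 X (2 ^ i) (2 ^ i)) + 4 * s * 2 ^ t * c := by
      have h5 : (localCount F R (2 ^ (i + t)) : ℝ) ≤
          (patCount2 X (2 ^ i) (2 ^ i) : ℝ) ^ (2 ^ t) ^ 2 *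
          (patCount2 (Set.univ : Set (ℤ × ℤ → A)) (2 ^ i) (2 ^ i) : ℝ) ^ (4 * s * 2 ^ t) := by
        exact_mod_cast h1
      refine (Real.logb_le_logb_of_le (by norm_num) (by exact_mod_cast hpos' _) h5).trans ?_
      have e1 : (patCount2 X (2 ^ i) (2 ^ i) : ℝ) ≠ 0 := by exact_mod_cast (hpos _).ne'
      have e2 : (patCount2 (Set.univ : Set (ℤ × ℤ → A)) (2 ^ i) (2 ^ i) : ℝ) ≠ 0 := by
        exact_mod_cast hcpos.ne'
      rw [Real.logb_mul (pow_ne_zero _ e1) (pow_ne_zero _ e2), Real.logb_pow, Real.logb_pow]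
      push_cast
      exact le_rfl
    have h6 : (1 : ℝ) ≤ 2 ^ i := one_le_pow₀ (by norm_num)
    have h7 : (1 : ℝ) ≤ 2 ^ t := one_le_pow₀ (by norm_num)
    rw [h4, h4, pow_add, div_add_div _ _ (by positivity) (by positivity),
      div_le_div_iff₀ (by positivity) (by positivity)]
    set a := (2 : ℝ) ^ i
    set b := (2 : ℝ) ^ t
    set N := Real.logb 2 (patCount2 X (2 ^ i) (2 ^ i))
    set L := (localLog F R (i + t) : ℝ)
    have h8 : L ≤ b ^ 2 * N + 4 * s * b * c + 1 := by linarith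
    have h9 : L ≤ b ^ 2 * N + b * (4 * s * c + 1) * a := by
      have h10 : 0 ≤ b * (4 * s * c + 1) := by positivity
      nlinarith
    calc L * (a ^ 2 * (a * b)) ≤ (b ^ 2 * N + b * (4 * s * c + 1) * a) * (a ^ 2 * (a * b)) := by
          gcongr
      _ = _ := by ring
  refine tendsto_order.2 ⟨fun a ha => Eventually.of_forall fun j => ha.trans_le (hlow j),
    fun a ha => ?_⟩
  obtain ⟨a', ha', ha''⟩ := exists_between ha
  obtain ⟨i, hi⟩ : ∃ i : ℕ, Real.logb 2 (patCount2 X (2 ^ i) (2 ^ i)) / 4 ^ i < a' := by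
    by_contra! hcon
    refine absurd (le_entropy2 (a := a') (fun x hx c => SFT2.shift hx c) hne fun n₀ =>
      ⟨2 ^ n₀, Nat.lt_two_pow_self.le, ?_⟩) (not_le.2 ha')
    have h1 := hcon n₀
    rw [le_div_iff₀ (by positivity), h4] at h1
    exact_mod_cast h1
  obtain ⟨C, hC⟩ := hup i
  have hlim : Tendsto (fun j : ℕ => Real.logb 2 (patCount2 X (2 ^ i) (2 ^ i)) / 4 ^ i + C / 2 ^ j)
      atTop (𝓝 (Real.logb 2 (patCount2 X (2 ^ i) (2 ^ i)) / 4 ^ i + 0)) :=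
    tendsto_const_nhds.add (Tendsto.const_div_atTop (tendsto_pow_atTop_atTop_of_one_lt
      (by norm_num)) C)
  rw [add_zero] at hlim
  filter_upwards [hlim.eventually (gt_mem_nhds (hi.trans ha'')), eventually_ge_atTop i] with j h1 h2
  exact (hC j h2).trans_lt h1

end LocalPatterns

end HEnt

namespace HEnt

open Filter Topology

section Decoding

variable {k : ℕ}

/-- The configuration whose restriction to `[0,n) × [0,n)` is coded by the digits of `c`. -/
def decode (hk : 0 < k) (n c : ℕ) (v : ℤ × ℤ) : Fin k :=
  ⟨c / k ^ (v.2.toNat + n * v.1.toNat) % k, Nat.mod_lt _ hk⟩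

/-- The code `c` describes a locally admissible pattern. -/
def IsLocalCode (F : Finset (Pattern2 (Fin k))) (R n c : ℕ) : Prop :=
  ∀ w₁ < n, ∀ w₂ < n, w₁ + 2 * R < n → w₂ + 2 * R < n → ∀ p ∈ F, ∃ u ∈ p.support,
    c / k ^ ((w₂ + (u.2 + R).toNat) + n * (w₁ + (u.1 + R).toNat)) % k ≠ p.val u

theorem LocalSFT.congr {A : Type*} {F : Finset (Pattern2 A)} {R n : ℕ}
    (hR : ∀ p ∈ F, ∀ u ∈ p.support, |u.1| ≤ R ∧ |u.2| ≤ R) {x y : ℤ × ℤ → A}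
    (hx : x ∈ LocalSFT F R n)
    (hxy : ∀ i j : Fin n, x ((i : ℤ), (j : ℤ)) = y ((i : ℤ), (j : ℤ))) : y ∈ LocalSFT F R n := by
  intro v h1 h2 h3 h4 p hp
  obtain ⟨u, hu, h⟩ := hx v h1 h2 h3 h4 p hp
  refine ⟨u, hu, ?_⟩
  obtain ⟨hu1, hu2⟩ := hR p hp u hu
  rw [abs_le] at hu1 hu2
  have h5 := hxy ⟨(u.1 + v.1).toNat, by omega⟩ ⟨(u.2 + v.2).toNat, by omega⟩
  simp only [Int.toNat_of_nonneg (show 0 ≤ u.1 + v.1 by omega),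
    Int.toNat_of_nonneg (show 0 ≤ u.2 + v.2 by omega)] at h5
  have h6 : u + v = (u.1 + v.1, u.2 + v.2) := rfl
  rwa [h6, ← h5, ← h6]

theorem decode_mem_localSFT_iff {F : Finset (Pattern2 (Fin k))} {R : ℕ}
    (hR : ∀ p ∈ F, ∀ u ∈ p.support, |u.1| ≤ R ∧ |u.2| ≤ R) (hk : 0 < k) (n c : ℕ) :
    decode hk n c ∈ LocalSFT F R n ↔ IsLocalCode F R n c := by
  constructor
  · intro hx w₁ _ w₂ _ h1 h2 p hp
    obtain ⟨u, hu, h⟩ := hx ((w₁ : ℤ) + R, (w₂ : ℤ) + R) (by simp only; omega)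
      (by simp only; omega) (by simp only; omega) (by simp only; omega) p hp
    refine ⟨u, hu, fun h' => h (Fin.ext ?_)⟩
    obtain ⟨hu1, hu2⟩ := hR p hp u hu
    rw [abs_le] at hu1 hu2
    rw [← h', decode]
    simp only [Prod.fst_add, Prod.snd_add]
    rw [show (u.2 + ((w₂ : ℤ) + R)).toNat = w₂ + (u.2 + R).toNat by omega,
      show (u.1 + ((w₁ : ℤ) + R)).toNat = w₁ + (u.1 + R).toNat by omega]
  · intro hc v h1 h2 h3 h4 p hp
    obtain ⟨u, hu, h⟩ := hc (v.1 - R).toNat (by omega) (v.2 - R).toNat (by omega) (by omega)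
      (by omega) p hp
    refine ⟨u, hu, fun h' => h ?_⟩
    obtain ⟨hu1, hu2⟩ := hR p hp u hu
    rw [abs_le] at hu1 hu2
    rw [← h', decode]
    simp only [Prod.fst_add, Prod.snd_add]
    rw [show (u.2 + v.2).toNat = (v.2 - R).toNat + (u.2 + R).toNat by omega,
      show (u.1 + v.1).toNat = (v.1 - R).toNat + (u.1 + R).toNat by omega]

open Classical in
theorem localCount_eq_sum {F : Finset (Pattern2 (Fin k))} {R : ℕ}
    (hR : ∀ p ∈ F, ∀ u ∈ p.support, |u.1| ≤ R ∧ |u.2| ≤ R) (hk : 0 < k) (n : ℕ) :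
    localCount F R n = ∑ c ∈ Finset.range (k ^ (n * n)), if IsLocalCode F R n c then 1 else 0 := by
  let e : Fin (k ^ (n * n)) ≃ (Fin n → Fin n → Fin k) :=
    (finFunctionFinEquiv.symm.trans (Equiv.arrowCongr finProdFinEquiv.symm (Equiv.refl _))).trans
      (Equiv.curry _ _ _)
  have he : ∀ c i j, e c i j = decode hk n c ((i : ℤ), (j : ℤ)) := fun c i j => rfl
  rw [← Fin.sum_univ_eq_sum_range (fun c => if IsLocalCode F R n c then 1 else 0),
    Finset.sum_boole, Nat.cast_id, localCount, patCount2,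
    ← Set.ncard_preimage_of_injective_subset_range e.injective
      (by rw [e.surjective.range_eq]; exact Set.subset_univ _), ← Set.ncard_coe_finset]
  congr 1
  ext c
  simp only [Set.mem_preimage, Set.mem_ofPred_eq, Finset.coe_filter, Finset.mem_univ, true_and,
    ← decode_mem_localSFT_iff hR hk]
  constructor
  · rintro ⟨x, hx, hxe⟩
    exact LocalSFT.congr hR hx fun i j => (hxe i j).trans (he c i j)
  · intro h
    exact ⟨_, h, fun i j => (he c i j).symm⟩

end Decoding

section Computable

theorem primrecPred_forall_mem_finset {α β : Type*} [Primcodable α] [DecidableEq β] (s : Finset β)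
    {P : β → α → Prop} (h : ∀ b ∈ s, PrimrecPred (P b)) : PrimrecPred fun a => ∀ b ∈ s, P b a := by
  induction s using Finset.induction_on with
  | empty => exact (PrimrecPred.of_eq (p := fun _ => (0 : ℕ) = 0)
      (Primrec.eq.comp (Primrec.const 0) (Primrec.const 0)) fun a => by simp)
  | insert b s _ ih =>
    refine ((h b (Finset.mem_insert_self _ _)).and
      (ih fun c hc => h c (Finset.mem_insert_of_mem hc))).of_eq fun a => ?_
    simp only [Finset.forall_mem_insert]

theorem primrecPred_exists_mem_finset {α β : Type*} [Primcodable α] [DecidableEq β] (s : Finset β)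
    {P : β → α → Prop} (h : ∀ b ∈ s, PrimrecPred (P b)) : PrimrecPred fun a => ∃ b ∈ s, P b a :=
  (primrecPred_forall_mem_finset s fun b hb => (h b hb).not).not.of_eq fun a => by
    push Not
    rfl

theorem primrecRel_forall_lt {β : Type*} [Primcodable β] {C : ℕ → β → Prop} (h : PrimrecRel C) :
    PrimrecRel fun n y => ∀ x < n, C x y :=
  (h.forall_mem_list.comp (Primrec.list_range.comp Primrec.fst) Primrec.snd).of_eq fun a => by simp

theorem primrecPred_isLocalCode {k : ℕ} (F : Finset (Pattern2 (Fin k))) (R : ℕ) :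
    PrimrecPred fun a : ℕ × ℕ => IsLocalCode F R a.1 a.2 := by
  classical
  have hcore : ∀ p ∈ F, ∀ u ∈ p.support, PrimrecPred fun a : ℕ × ℕ × ℕ × ℕ =>
      a.2.2.2 / k ^ ((a.2.1 + (u.2 + R).toNat) + a.2.2.1 * (a.1 + (u.1 + R).toNat)) % k ≠
        p.val u := fun p _ u _ => by
    have h1 : Primrec fun a : ℕ × ℕ × ℕ × ℕ => a.2.1 := Primrec.fst.comp Primrec.snd
    have h2 : Primrec fun a : ℕ × ℕ × ℕ × ℕ => a.2.2.1 :=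
      Primrec.fst.comp (Primrec.snd.comp Primrec.snd)
    have h3 : Primrec fun a : ℕ × ℕ × ℕ × ℕ => a.2.2.2 :=
      Primrec.snd.comp (Primrec.snd.comp Primrec.snd)
    refine (Primrec.eq.comp (Primrec.nat_mod.comp (Primrec.nat_div.comp h3
      (primrec_pow.comp (Primrec.const k) ?_)) (Primrec.const k)) (Primrec.const _)).not
    exact Primrec.nat_add.comp (Primrec.nat_add.comp h1 (Primrec.const _))
      (Primrec.nat_mul.comp h2 (Primrec.nat_add.comp Primrec.fst (Primrec.const _)))
  have hin : PrimrecPred fun a : ℕ × ℕ × ℕ × ℕ => a.1 + 2 * R < a.2.2.1 → a.2.1 + 2 * R < a.2.2.1 →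
      ∀ p ∈ F, ∃ u ∈ p.support,
        a.2.2.2 / k ^ ((a.2.1 + (u.2 + R).toNat) + a.2.2.1 * (a.1 + (u.1 + R).toNat)) % k ≠
          p.val u := by
    have h1 : Primrec fun a : ℕ × ℕ × ℕ × ℕ => a.2.1 := Primrec.fst.comp Primrec.snd
    have h2 : Primrec fun a : ℕ × ℕ × ℕ × ℕ => a.2.2.1 :=
      Primrec.fst.comp (Primrec.snd.comp Primrec.snd)
    have c1 : PrimrecPred fun a : ℕ × ℕ × ℕ × ℕ => a.1 + 2 * R < a.2.2.1 :=
      Primrec.nat_lt.comp (Primrec.nat_add.comp Primrec.fst (Primrec.const _)) h2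
    have c2 : PrimrecPred fun a : ℕ × ℕ × ℕ × ℕ => a.2.1 + 2 * R < a.2.2.1 :=
      Primrec.nat_lt.comp (Primrec.nat_add.comp h1 (Primrec.const _)) h2
    refine (c1.not.or (c2.not.or (primrecPred_forall_mem_finset F fun p hp =>
      primrecPred_exists_mem_finset p.support (hcore p hp)))).of_eq fun a => ?_
    tauto
  let C : ℕ → ℕ × ℕ × ℕ → Prop := fun w₂ b => b.1 + 2 * R < b.2.1 → w₂ + 2 * R < b.2.1 →
    ∀ p ∈ F, ∃ u ∈ p.support,
      b.2.2 / k ^ ((w₂ + (u.2 + R).toNat) + b.2.1 * (b.1 + (u.1 + R).toNat)) % k ≠ p.val u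
  have hr2 : PrimrecRel C := hin.comp (f := fun q : ℕ × ℕ × ℕ × ℕ => (q.2.1, q.1, q.2.2))
    (Primrec.pair (Primrec.fst.comp Primrec.snd) (Primrec.pair Primrec.fst
      (Primrec.snd.comp Primrec.snd)))
  have hr1 : PrimrecRel fun (w₁ : ℕ) (b : ℕ × ℕ) => ∀ w₂ < b.1, C w₂ (w₁, b) :=
    have h := primrecRel_forall_lt hr2
    PrimrecRel.comp h (f := fun q : ℕ × ℕ × ℕ => q.2.1) (g := fun q => q)
      (Primrec.fst.comp Primrec.snd) Primrec.id
  have h := primrecRel_forall_lt hr1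
  exact PrimrecRel.comp h (f := fun a : ℕ × ℕ => a.1) (g := fun a => a) Primrec.fst Primrec.id

theorem primrec_localCount {k : ℕ} {F : Finset (Pattern2 (Fin k))} {R : ℕ}
    (hR : ∀ p ∈ F, ∀ u ∈ p.support, |u.1| ≤ R ∧ |u.2| ≤ R) (hk : 0 < k) :
    Primrec (localCount F R) := by
  classical
  refine Primrec.of_eq (primrec_sum_range (primrec_pow.comp (Primrec.const k)
    (Primrec.nat_mul.comp Primrec.id Primrec.id)) ?_) fun n => (localCount_eq_sum hR hk n).symm
  exact Primrec.ite (primrecPred_isLocalCode F R) (Primrec.const 1) (Primrec.const 0)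

theorem primrec_clog : Primrec (Nat.clog 2) := by
  refine Primrec.of_eq (primrec_sum_range Primrec.id (g := fun L i => if 2 ^ i < L then 1 else 0)
    (Primrec.ite (Primrec.nat_lt.comp (primrec_pow.comp (Primrec.const 2) Primrec.snd) Primrec.fst)
      (Primrec.const 1) (Primrec.const 0))) fun L => ?_
  rw [Finset.sum_boole, Nat.cast_id]
  have h1 : (Finset.range (id L)).filter (fun i => 2 ^ i < L) = Finset.range (Nat.clog 2 L) := by
    ext i
    simp only [Finset.mem_filter, Finset.mem_range, id, ← Nat.lt_clog_iff_pow_lt one_lt_two]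
    refine ⟨fun h => h.2, fun h => ⟨?_, h⟩⟩
    rw [Nat.lt_clog_iff_pow_lt one_lt_two] at h
    exact Nat.lt_two_pow_self.trans h
  rw [h1, Finset.card_range]

theorem pi1Computable_entropy2 {k : ℕ} (F : Finset (Pattern2 (Fin k))) (hne : (SFT2 F).Nonempty) :
    Pi1Computable (entropy2 (SFT2 F)) := by
  classical
  have hk : 0 < k := by
    obtain ⟨x, -⟩ := hne
    exact (x 0).pos
  obtain ⟨R, hR⟩ : ∃ R : ℕ, ∀ p ∈ F, ∀ u ∈ p.support, |u.1| ≤ R ∧ |u.2| ≤ R := by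
    refine ⟨(F.biUnion Pattern2.support).sup fun u => u.1.natAbs + u.2.natAbs, fun p hp u hu => ?_⟩
    have h1 := Finset.le_sup (f := fun u : ℤ × ℤ => u.1.natAbs + u.2.natAbs)
      (Finset.mem_biUnion.2 ⟨p, hp, hu⟩)
    simp only [Int.abs_eq_natAbs] at h1 ⊢
    omega
  refine ⟨fun j => (localLog F R j : ℚ) / ((4 ^ j : ℕ) : ℚ), ?_, antitone_localLog F R, ?_⟩
  · have h1 : Primrec (localLog F R) := primrec_clog.comp ((primrec_localCount hR hk).comp
      (primrec_pow.comp (Primrec.const 2) Primrec.id))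
    have h2 : Primrec fun j : ℕ => 4 ^ j - 1 :=
      Primrec.nat_sub.comp (primrec_pow.comp (Primrec.const 4) Primrec.id) (Primrec.const 1)
    refine (Primrec.of_eq (primrec_ratio.comp h1 h2) fun j => ?_).to_comp
    rw [Nat.sub_add_cancel (Nat.one_le_pow _ _ (by norm_num))]
  · refine (tendsto_localLog F R hne).congr fun j => ?_
    push_cast
    rfl

end Computable

theorem exists_SFT2_eq_XHF {k : ℕ} {H : Set (ℤ → Fin k)} (hH : IsSFT1 H)
    (F : Finset (Pattern2 (Fin k))) : ∃ F', XHF H F = SFT2 F' := by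
  classical
  obtain ⟨m, hm, P, rfl⟩ := exists_windowSFT hH
  obtain ⟨F', hF'⟩ := exists_forbidden (A := Fin k)
    ((Finset.range m).image (fun i => ((i : ℤ), (0 : ℤ))) ∪ F.biUnion fun p => p.support)
    (fun x => windowAt m (fun i => x (i, 0)) 0 ∈ P ∧ ∀ p ∈ F, ¬ ∀ u ∈ p.support, x u = p.val u) (by
      rintro x y hxy ⟨h1, h2⟩
      refine ⟨(congrArg (· ∈ P) (funext fun t => ?_)).mp h1, fun p hp h => h2 p hp fun u hu => ?_⟩
      · refine hxy _ (Finset.mem_union_left _ (Finset.mem_image.2 ⟨t, by simp, ?_⟩))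
        rw [zero_add]
      · rw [hxy u (Finset.mem_union_right _ (Finset.mem_biUnion.2 ⟨p, hp, hu⟩)), h u hu])
  refine ⟨F', Set.ext fun x => (Iff.trans ?_ (hF' x).symm)⟩
  simp only [XHF, WindowSFT, Set.mem_ofPred_eq, Pattern2.OccursIn, not_exists]
  have hw : ∀ v : ℤ × ℤ, windowAt m (fun i => x ((i, 0) + v)) 0 =
      windowAt m (fun i => x (i, v.2)) v.1 := fun v => funext fun t => by
    simp only [windowAt]
    congr 1
    ext
    · simp [add_comm]
    · simp
  constructor
  · rintro ⟨h1, h2⟩ v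
    exact ⟨by rw [hw]; exact h1 _ _, fun p hp => h2 p hp v⟩
  · intro h
    refine ⟨fun j i => ?_, fun p hp v => (h v).2 p hp⟩
    have := (h (i, j)).1
    rwa [hw] at this

theorem entropy2_XHF_mem {k : ℕ} {H : Set (ℤ → Fin k)} (hH : IsSFT1 H)
    {F : Finset (Pattern2 (Fin k))} (hne : (XHF H F).Nonempty) :
    Pi1Computable (entropy2 (XHF H F)) ∧ 0 ≤ entropy2 (XHF H F) ∧
      entropy2 (XHF H F) ≤ entropy1 H := by
  refine ⟨?_, entropy2_nonneg _, ?_⟩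
  · obtain ⟨F', hF'⟩ := exists_SFT2_eq_XHF hH F
    rw [hF'] at hne ⊢
    exact pi1Computable_entropy2 F' hne
  · refine entropy2_le_entropy1 ?_ (fun x hx => hx.1) hne
    obtain ⟨m, hm, P, rfl⟩ := exists_windowSFT hH
    exact fun x hx c => WindowSFT.shift hx c

theorem entropy2_XHF_empty {k : ℕ} {H : Set (ℤ → Fin k)} (hH : IsSFT1 H) (hne : H.Nonempty) :
    (XHF H ∅).Nonempty ∧ entropy2 (XHF H ∅) = entropy1 H := by
  have hX : ∀ x : ℤ × ℤ → Fin k, (∀ j : ℤ, (fun i => x (i, j)) ∈ H) → x ∈ XHF H ∅ :=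
    fun x hx => ⟨hx, by simp⟩
  have hne' : (XHF H ∅).Nonempty := by
    obtain ⟨y, hy⟩ := hne
    exact ⟨fun v => y v.1, hX _ fun _ => hy⟩
  refine ⟨hne', le_antisymm (entropy2_XHF_mem hH hne').2.2 (entropy1_le_entropy2 ?_ hne hX)⟩
  obtain ⟨m, hm, P, rfl⟩ := exists_windowSFT hH
  exact fun x hx c => WindowSFT.shift hx c

end HEnt

namespace HEnt

open Filter Topology

theorem exists_free_rows {s G : ℕ} (hs : 1 ≤ s) (hG : 2 * (2 * s + 1) ≤ G) :
    ∃ R : Finset ℕ, R.card = 2 * s * G ∧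
      ∀ r ∈ R, 2 * (2 * (s + 1)) ≤ r ∧ ¬ 2 * (s + 1) ∣ r ∧ r < G * (2 * (s + 1)) := by
  set b := 2 * (s + 1) with hb
  set T := (Finset.range (G - 2) ×ˢ Finset.range (2 * s + 1)).image
    fun p => (p.1 + 2) * b + (p.2 + 1) with hT
  have hcard : T.card = (G - 2) * (2 * s + 1) := by
    rw [hT, Finset.card_image_of_injOn, Finset.card_product, Finset.card_range, Finset.card_range]
    rintro ⟨g, c⟩ hp ⟨g', c'⟩ hp' h
    simp only [Finset.coe_product, Set.mem_prod, Finset.coe_range, Set.mem_Iio] at hp hp'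
    have hdiv : ∀ g c, c < 2 * s + 1 → ((g + 2) * b + (c + 1)) / b = g + 2 := fun g c hc => by
      rw [Nat.mul_comm, Nat.mul_add_div (by omega), Nat.div_eq_of_lt (by omega), Nat.add_zero]
    simp only at h
    have h1 := congrArg (· / b) h
    simp only [hdiv _ _ hp.2, hdiv _ _ hp'.2] at h1
    obtain rfl : g = g' := by omega
    simp only [Prod.mk.injEq, true_and]
    omega
  have hle : 2 * s * G ≤ T.card := by
    rw [hcard]
    obtain ⟨G', rfl⟩ := Nat.exists_eq_add_of_le (show 2 ≤ G by omega)
    have : 4 * s ≤ G' := by omega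
    rw [Nat.add_sub_cancel_left]
    nlinarith
  obtain ⟨R, hR, hRc⟩ := Finset.exists_subset_card_eq hle
  refine ⟨R, hRc, fun r hr => ?_⟩
  have := hR hr
  simp only [hT, Finset.mem_image, Finset.mem_product, Finset.mem_range] at this
  obtain ⟨⟨g, c⟩, ⟨hg, hc⟩, rfl⟩ := this
  simp only at hg hc ⊢
  refine ⟨?_, ?_, ?_⟩
  · nlinarith
  · rw [Nat.dvd_add_right (Dvd.intro_left _ rfl)]
    exact fun h => absurd (Nat.le_of_dvd (by omega) h) (by omega)
  · have : (g + 3) * b ≤ G * b := Nat.mul_le_mul_right _ (by omega)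
    nlinarith

theorem exists_code (S : Type*) [Finite S] {l s : ℕ} (hl : 0 < l) (hs : 1 ≤ s) :
    ∃ (t b : ℕ) (code : S → ℕ → Bool) (R : Finset ℕ), 2 ≤ t ∧ 2 ≤ b ∧ b ∣ l * t ∧ 2 * b < l * t ∧
      (∀ σ σ', (∀ j < t, code σ j = code σ' j) → σ = σ') ∧
      (∀ r ∈ R, 2 * b ≤ r ∧ ¬ b ∣ r ∧ r < l * t) ∧ R.card * (s + 1) = l * t * s := by
  classical
  have := Fintype.ofFinite S
  set m := 2 * (2 * s + 1) + Fintype.card S with hm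
  set b := 2 * (s + 1) with hb
  have hG : 2 * (2 * s + 1) ≤ l * m := by nlinarith
  obtain ⟨R, hRc, hR⟩ := exists_free_rows hs hG
  have hlt : l * (b * m) = l * m * b := by ring
  have hmb : m ≤ b * m := Nat.le_mul_of_pos_left _ (by omega)
  have e := Fintype.equivFin S
  refine ⟨b * m, b, fun σ j => decide (j = (e σ : ℕ)), R, by omega, by omega,
    ⟨l * m, by ring⟩, ?_, fun σ σ' h => ?_, fun r hr => ?_, ?_⟩
  · rw [hlt]
    nlinarith
  · have h1 := h (e σ) ((e σ).2.trans_le (by omega))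
    simp only [decide_true] at h1
    exact e.injective (Fin.ext (of_decide_eq_true h1.symm))
  · rw [hlt]
    exact hR r hr
  · rw [hRc, hb]
    ring

theorem exists_entropy2_eq_of_lt {k : ℕ} {H : Set (ℤ → Fin k)} (hH : IsSFT1 H) {h : ℝ}
    (hP : Pi1Computable h) (h0 : 0 ≤ h) (hlt : h < entropy1 H) :
    ∃ F : Finset (Pattern2 (Fin k)), (XHF H F).Nonempty ∧ entropy2 (XHF H F) = h := by
  obtain ⟨m, hm, P, rfl⟩ := exists_windowSFT hH
  obtain ⟨l, q, W, hl, hhl, hW, hWp, hWH⟩ := exists_blocks hm h0 hlt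
  obtain ⟨f, hf, hanti, hlim⟩ := hP
  have hle : ∀ n, h ≤ f n := fun n => by
    have h1 : Antitone fun n => (f n : ℝ) := fun a b hab =>
      Rat.cast_le.2 (hanti hab)
    exact h1.le_of_tendsto hlim n
  obtain ⟨N, D, hN, hD, hND⟩ := exists_computable_ratio hf fun n => by
    exact_mod_cast h0.trans (hle n)
  have hl' : (0 : ℝ) < l := by exact_mod_cast hl
  have hq' : (0 : ℝ) < q := (mul_nonneg h0 hl'.le).trans_lt hhl
  have hq : 0 < q := by exact_mod_cast hq'
  obtain ⟨s, hs⟩ := exists_nat_gt (max 1 (h * l / (q - h * l)))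
  have hs1 : (1 : ℝ) < s := (le_max_left _ _).trans_lt hs
  have hs1' : 1 ≤ s := by exact_mod_cast hs1.le
  have hs2 : h * l * (s + 1) < q * s := by
    have := (le_max_right _ _).trans_lt hs
    rw [div_lt_iff₀ (by linarith)] at this
    nlinarith
  set θ := h * ((l * (s + 1) : ℕ) : ℝ) / ((q * s : ℕ) : ℝ) with hθ
  have hqs : 0 < q * s := by positivity
  have hqs' : (0 : ℝ) < ((q * s : ℕ) : ℝ) := by exact_mod_cast hqs
  have hratio : ∀ n, ((N n * (l * (s + 1)) : ℕ) : ℝ) / (((D n + 1) * (q * s) : ℕ) : ℝ) =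
      (f n : ℝ) * ((l * (s + 1) : ℕ) : ℝ) / ((q * s : ℕ) : ℝ) := fun n => by
    rw [hND]
    push_cast
    have : (D n : ℝ) + 1 ≠ 0 := by positivity
    field_simp
  have hc : ∀ c : ℕ, Computable fun _ : ℕ => c := fun c => Computable.const c
  have hmul : Computable₂ ((· * ·) : ℕ → ℕ → ℕ) := Primrec.nat_mul.to_comp
  obtain ⟨S, _, HR, VR, E, hup, z, hz, hlow⟩ := exists_adjacency
    (N := fun n => N n * (l * (s + 1))) (D := fun n => (D n + 1) * (q * s)) (θ := θ)
    (hmul.comp hN (hc _)) (hmul.comp (Primrec.succ.to_comp.comp hD) (hc _))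
    (fun n => by positivity)
    (fun n => by
      rw [hratio, hθ]
      have := hle n
      gcongr)
    (by
      simp only [hratio]
      exact (hlim.mul_const _).div_const _)
    (by positivity)
    (by
      rw [hθ, div_lt_one hqs']
      push_cast
      linarith)
  obtain ⟨t, b, code, R, ht, hb, hbd, hbl, hcode, hR, hRc⟩ := exists_code S hl hs1'
  let e : Enc (Fin k) S := ⟨l, t, b, q, W, code, R, E, hl, ht, hb, hq, hbd, hbl, hW, hWp, hcode, hR⟩
  obtain ⟨F, hF⟩ := e.exists_XHF_eq (H := WindowSFT P) (HR := HR) (VR := VR)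
    (fun x hx c => WindowSFT.shift hx c) hWH
  have hK : (0 : ℤ) < e.K := by
    have : 0 < l * t := by positivity
    exact_mod_cast this
  refine ⟨F, ?_, ?_⟩
  · rw [hF]
    exact ⟨e.cfg z fun _ _ => e.u, 0, z, _, le_rfl, hK, le_rfl, hK, hz, fun p => by rw [add_zero]⟩
  · rw [hF]
    have h1 := e.entropy2_space (HR := HR) (VR := VR) hup hz hlow
    have hKr : (0 : ℝ) < e.K := by exact_mod_cast hK
    have hs0 : (0 : ℝ) < (s : ℝ) + 1 := by positivity
    have h2 : (e.R.card : ℝ) * (s + 1) = e.K * s := by exact_mod_cast hRc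
    have h3 : θ * (q * s) = h * (l * (s + 1)) := by
      rw [hθ]
      push_cast at hqs' ⊢
      field_simp
    have h4 : (e.K : ℝ) = l * t := by
      have : e.K = l * t := rfl
      exact_mod_cast this
    have h5 : (e.q : ℝ) = q := rfl
    have h6 : (e.t : ℝ) = t := rfl
    rw [h5, h6] at h1
    refine mul_right_cancel₀ (b := (e.K : ℝ) ^ 2 * (s + 1)) (by positivity) ?_
    calc entropy2 (e.space HR VR) * ((e.K : ℝ) ^ 2 * (s + 1))
        = θ * (q * t * e.R.card) * (s + 1) := by rw [← h1]; ring
      _ = θ * q * t * (e.R.card * (s + 1)) := by ring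
      _ = θ * (q * s) * t * e.K := by rw [h2]; ring
      _ = h * (l * t) * (s + 1) * e.K := by rw [h3]; ring
      _ = h * ((e.K : ℝ) ^ 2 * (s + 1)) := by rw [← h4]; ring

end HEnt

/-- the entropies of nonempty SFTs `X_{H,F}` with horizontal constraints from a
nonempty one-dimensional SFT `H` are exactly the Π₁-computable reals in `[0, h(H)]`. -/
theorem stmt7 (k : ℕ) (H : Set (ℤ → Fin k)) (hH : IsSFT1 H) (hne : H.Nonempty)
    (h : ℝ) :
    (∃ F : Finset (Pattern2 (Fin k)),
        (XHF H F).Nonempty ∧ entropy2 (XHF H F) = h) ↔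
      (Pi1Computable h ∧ 0 ≤ h ∧ h ≤ entropy1 H) := by
  constructor
  · rintro ⟨F, hF, rfl⟩
    exact HEnt.entropy2_XHF_mem hH hF
  · rintro ⟨hP, h0, hle⟩
    rcases hle.eq_or_lt with rfl | hlt
    · exact ⟨∅, HEnt.entropy2_XHF_empty hH hne⟩
    · exact HEnt.exists_entropy2_eq_of_lt hH hP h0 hlt
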